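/- Let Ω be a bounded Lipschitz domain in ℝ^N (N ≥ 2), x₀ ∈ Ω, a > 0, V ∈ 𝒱(Ω,a), let μ be a positive finite measure on ∂Ω and u = K_μ^V. Then: (1) for μ-almost all y ∈ ∂Ω the ratio u(x)/K_μ(x) tends to 1/c(y) as x → y nontangentially in Ω (with the convention 1/0 = +∞); (2) for every positive finite measure θ on ∂Ω, the ratio u(x)/K_θ(x) tends to (1/c(y))·(dμ/dθ)(y) nontangentially at y for θ-almost every y in Reg_V(Ω). -/

import Mathlib

open MeasureTheory Metric Set Filter Topology
open scoped ENNReal NNReal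

noncomputable section

namespace Anc

abbrev ES (N : ℕ) := EuclideanSpace ℝ (Fin N)

/-- `δ_Ω(x)`: the distance from `x` to the complement of `Ω`. -/
def dista {N : ℕ} (Ω : Set (ES N)) (x : ES N) : ℝ := infDist x Ωᶜ

/-- Pointwise Laplacian (junk values where the derivatives do not exist). -/
def lap {N : ℕ} (u : ES N → ℝ) (x : ES N) : ℝ :=
  ∑ i : Fin N,
    fderiv ℝ (fun y => fderiv ℝ u y (EuclideanSpace.single i 1)) x (EuclideanSpace.single i 1)

/-- Smooth compactly supported test functions in `Ω`. -/
def IsTestFun {N : ℕ} (Ω : Set (ES N)) (φ : ES N → ℝ) : Prop :=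
  ContDiff ℝ (⊤ : ℕ∞) φ ∧ IsCompact (tsupport φ) ∧ tsupport φ ⊆ Ω

/-- `u` is a continuous weak solution of `Δu - V·u = 0` in `Ω` (i.e. `L_V`-harmonic). -/
def LVHarmonic {N : ℕ} (Ω : Set (ES N)) (V u : ES N → ℝ) : Prop :=
  ContinuousOn u Ω ∧ LocallyIntegrableOn u Ω ∧
    LocallyIntegrableOn (fun x => V x * u x) Ω ∧
    ∀ φ, IsTestFun Ω φ → ∫ x in Ω, u x * lap φ x = ∫ x in Ω, V x * u x * φ x

/-- `s` is `L_V`-superharmonic in `Ω` (weakly, `Δs - V·s ≤ 0`, `s` l.s.c.). -/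
def LVSuperharmonic {N : ℕ} (Ω : Set (ES N)) (V s : ES N → ℝ) : Prop :=
  LowerSemicontinuousOn s Ω ∧ LocallyIntegrableOn s Ω ∧
    LocallyIntegrableOn (fun x => V x * s x) Ω ∧
    ∀ φ, IsTestFun Ω φ → (∀ x, 0 ≤ φ x) →
      ∫ x in Ω, s x * lap φ x ≤ ∫ x in Ω, V x * s x * φ x

/-- The class `𝒱(Ω,a)` of nonnegative Borel potentials with `V(x) ≤ a/δ_Ω(x)²`. -/
def VClass {N : ℕ} (Ω : Set (ES N)) (a : ℝ) (V : ES N → ℝ) : Prop :=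
  Measurable V ∧ ∀ x ∈ Ω, 0 ≤ V x ∧ V x * dista Ω x ^ 2 ≤ a

/-- Lipschitz domain: open, connected, and near every boundary point, after an
orthogonal change of coordinates, the domain is the region above the graph of a
Lipschitz function. -/
def IsLipschitzDomain {N : ℕ} (Ω : Set (ES N)) : Prop :=
  IsOpen Ω ∧ IsConnected Ω ∧
    ∀ z ∈ frontier Ω, ∃ (g : ES N ≃ₗᵢ[ℝ] ES N) (i : Fin N) (f : ES N → ℝ)
      (L : ℝ≥0) (ε : ℝ), 0 < ε ∧ LipschitzWith L f ∧
      (∀ x w : ES N, (∀ j, j ≠ i → x j = w j) → f x = f w) ∧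
      ∀ x ∈ ball z ε, (x ∈ Ω ↔ f (g x) < g x i)

/-- `Ω` has a `C^{1,α}` boundary near `y`. -/
def IsC1AlphaNear {N : ℕ} (Ω : Set (ES N)) (α : ℝ) (y : ES N) : Prop :=
  ∃ (g : ES N ≃ₗᵢ[ℝ] ES N) (i : Fin N) (f : ES N → ℝ) (C : ℝ≥0) (ε : ℝ),
    0 < ε ∧ ContDiff ℝ 1 f ∧ HolderWith C α.toNNReal (fderiv ℝ f) ∧
    (∀ x w : ES N, (∀ j, j ≠ i → x j = w j) → f x = f w) ∧
    ∀ x ∈ ball y ε, (x ∈ Ω ↔ f (g x) < g x i)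

/-- `K` is the `L_V`-Martin kernel of `Ω` with pole `y ∈ ∂Ω`, normalized at `x₀`:
the unique positive `L_V`-harmonic function vanishing on `∂Ω ∖ {y}` with `K x₀ = 1`. -/
def IsMartinKernel {N : ℕ} (Ω : Set (ES N)) (V : ES N → ℝ) (x₀ y : ES N)
    (K : ES N → ℝ) : Prop :=
  LVHarmonic Ω V K ∧ (∀ x ∈ Ω, 0 < K x) ∧ K x₀ = 1 ∧
    ∀ z ∈ frontier Ω, z ≠ y → Tendsto K (𝓝[Ω] z) (𝓝 0)

/-- `G` is the `L_V`-Green function of `Ω` with pole `y ∈ Ω`: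
positive, vanishing at the boundary, and `L_V G = -δ_y` weakly. -/
def IsGreenFunction {N : ℕ} (Ω : Set (ES N)) (V : ES N → ℝ) (y : ES N)
    (G : ES N → ℝ) : Prop :=
  ContinuousOn G (Ω \ {y}) ∧ (∀ x ∈ Ω \ {y}, 0 < G x) ∧ LocallyIntegrableOn G Ω ∧
    (∀ z ∈ frontier Ω, Tendsto G (𝓝[Ω \ {y}] z) (𝓝 0)) ∧
    ∀ φ, IsTestFun Ω φ → ∫ x in Ω, G x * (lap φ x - V x * φ x) = -φ y

/-- `y ∈ ∂Ω` is finely regular w.r.t. `V`, `Ky` being the classical Martin kernel at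
`y`: the greatest `L_V`-harmonic minorant of `Ky` is positive, equivalently `Ky`
admits a positive `L_V`-harmonic minorant. -/
def FinelyRegular {N : ℕ} (Ω : Set (ES N)) (V Ky : ES N → ℝ) : Prop :=
  ∃ h, LVHarmonic Ω V h ∧ (∀ x ∈ Ω, 0 < h x) ∧ ∀ x ∈ Ω, h x ≤ Ky x

/-- `h` is the greatest nonnegative `L_V`-harmonic minorant of `w` in `Ω`. -/
def IsGreatestLVHarmMinorant {N : ℕ} (Ω : Set (ES N)) (V w h : ES N → ℝ) : Prop :=
  LVHarmonic Ω V h ∧ (∀ x ∈ Ω, 0 ≤ h x ∧ h x ≤ w x) ∧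
    ∀ g, LVHarmonic Ω V g → (∀ x ∈ Ω, 0 ≤ g x ∧ g x ≤ w x) → ∀ x ∈ Ω, g x ≤ h x

/-- Classical superharmonicity via the sub-mean value property. -/
def IsSuperharmonicOn {N : ℕ} (W : Set (ES N)) (s : ES N → ℝ) : Prop :=
  LowerSemicontinuousOn s W ∧ LocallyIntegrableOn s W ∧
    ∀ x ∈ W, ∀ t > (0:ℝ), closedBall x t ⊆ W → ⨍ z in ball x t, s z ≤ s x

/-- The réduite of `w` over `A` in `W`: infimum of the nonnegative superharmonic
functions in `W` dominating `w` on `A`. -/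
def reduite {N : ℕ} (W : Set (ES N)) (w : ES N → ℝ) (A : Set (ES N)) (x : ES N) : ℝ :=
  sInf {v | ∃ s : ES N → ℝ, IsSuperharmonicOn W s ∧ (∀ z ∈ W, 0 ≤ s z) ∧
    (∀ z ∈ A, w z ≤ s z) ∧ v = s x}

/-- The lower semicontinuous regularization `R̂` of the réduite. -/
def reduiteReg {N : ℕ} (W : Set (ES N)) (w : ES N → ℝ) (A : Set (ES N)) (x : ES N) : ℝ :=
  liminf (reduite W w A) (𝓝[W] x)

/-- Nontangential approach region at `y` with aperture `κ`. -/
def ntRegion {N : ℕ} (Ω : Set (ES N)) (y : ES N) (κ : ℝ) : Set (ES N) :=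
  {x | x ∈ Ω ∧ dist x y ≤ κ * dista Ω x}

/-- `g` tends to `l` nontangentially at `y`. -/
def TendstoNT {N : ℕ} (Ω : Set (ES N)) (g : ES N → ℝ) (y : ES N) (l : Filter ℝ) : Prop :=
  ∀ κ > (0:ℝ), Tendsto g (𝓝[ntRegion Ω y κ] y) l

/-- Truncated cone `{y + t(ν+v) : 0 < t ≤ η, ‖v‖ ≤ η}` with vertex `y`. -/
def truncCone {N : ℕ} (y ν : ES N) (η : ℝ) : Set (ES N) :=
  {x | ∃ (t : ℝ) (v : ES N), 0 < t ∧ t ≤ η ∧ ‖v‖ ≤ η ∧ x = y + t • (ν + v)}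

/-- Last coordinate of a point of `ℝ^{n+1}`. -/
def lastC {n : ℕ} (x : ES (n + 1)) : ℝ := x (Fin.last n)

/-- First `n` coordinates of a point of `ℝ^{n+1}`. -/
def firstC {n : ℕ} (x : ES (n + 1)) : ES n :=
  (EuclideanSpace.equiv (Fin n) ℝ).symm fun i => x i.castSucc

/-- The region `U_f(r,ρ) = {(x',x_N) : |x'| < r, f(x') < x_N < ρ}`. -/
def Ucyl {n : ℕ} (f : ES n → ℝ) (r ρ : ℝ) : Set (ES (n + 1)) :=
  {x | ‖firstC x‖ < r ∧ f (firstC x) < lastC x ∧ lastC x < ρ}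

/-- The cylinder `T(t) = B_{N-1}(0,tr) × (-tρ, tρ)`. -/
def Tcyl (n : ℕ) (r ρ t : ℝ) : Set (ES (n + 1)) :=
  {x | ‖firstC x‖ < t * r ∧ |lastC x| < t * ρ}

/-- The graph part `∂_#U` of the boundary of `U_f(r,ρ)`. -/
def graphBdry {n : ℕ} (f : ES n → ℝ) (r ρ : ℝ) : Set (ES (n + 1)) :=
  frontier (Ucyl f r ρ) ∩ {x | ‖firstC x‖ < r ∧ lastC x = f (firstC x)}

section

/-! ## Section 1: radial kernels -/

def Psi (s : ℝ) : ℝ := expNegInvGlue (1 - s)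
def Psi1 (s : ℝ) : ℝ := -((1 - s)⁻¹ ^ 2 * expNegInvGlue (1 - s))
def Psi2 (s : ℝ) : ℝ :=
  (Polynomial.X ^ 2 * (Polynomial.X ^ 2 - Polynomial.derivative (Polynomial.X ^ 2)) :
    Polynomial ℝ).eval (1 - s)⁻¹ * expNegInvGlue (1 - s)

lemma Psi_hasDeriv (s : ℝ) : HasDerivAt Psi (Psi1 s) s := by
  have h := expNegInvGlue.hasDerivAt_polynomial_eval_inv_mul 1 (1 - s)
  have h2 := h.comp s ((hasDerivAt_id s).const_sub 1)
  have e1 : (fun x : ℝ => Polynomial.eval x⁻¹ 1 * expNegInvGlue x) ∘ (HSub.hSub 1) = Psi := by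
    funext x; simp [Psi]
  rw [e1] at h2
  refine h2.congr_deriv ?_
  simp [Psi1]

lemma Psi1_hasDeriv (s : ℝ) : HasDerivAt Psi1 (Psi2 s) s := by
  have h := expNegInvGlue.hasDerivAt_polynomial_eval_inv_mul (Polynomial.X ^ 2) (1 - s)
  have h2 := (h.comp s ((hasDerivAt_id s).const_sub 1)).neg
  have e1 : -((fun x : ℝ => Polynomial.eval x⁻¹ (Polynomial.X ^ 2) * expNegInvGlue x) ∘
      (HSub.hSub 1)) = Psi1 := by
    funext x; simp [Psi1]
  rw [e1] at h2
  refine h2.congr_deriv ?_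
  simp [Psi2]

lemma Psi_contDiff : ContDiff ℝ (⊤ : ℕ∞) Psi :=
  expNegInvGlue.contDiff.comp (contDiff_const.sub contDiff_id)

lemma Psi1_cont : Continuous Psi1 :=
  continuous_iff_continuousAt.2 fun s => (Psi1_hasDeriv s).continuousAt

lemma Psi2_cont : Continuous Psi2 :=
  (expNegInvGlue.continuous_polynomial_eval_inv_mul _).comp (continuous_const.sub continuous_id)

lemma Psi_nonneg (s : ℝ) : 0 ≤ Psi s := expNegInvGlue.nonneg _
lemma Psi_zero {s : ℝ} (h : 1 ≤ s) : Psi s = 0 := expNegInvGlue.zero_of_nonpos (by linarith)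
lemma Psi1_zero {s : ℝ} (h : 1 ≤ s) : Psi1 s = 0 := by
  simp [Psi1, expNegInvGlue.zero_of_nonpos (show 1 - s ≤ 0 by linarith)]
lemma Psi2_zero {s : ℝ} (h : 1 ≤ s) : Psi2 s = 0 := by
  simp [Psi2, expNegInvGlue.zero_of_nonpos (show 1 - s ≤ 0 by linarith)]
lemma Psi1_nonpos (s : ℝ) : Psi1 s ≤ 0 := by
  have := expNegInvGlue.nonneg (1 - s)
  simp only [Psi1, neg_nonpos]; positivity
lemma Psi1_neg {s : ℝ} (h : s < 1) : Psi1 s < 0 := by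
  have := expNegInvGlue.pos_of_pos (show 0 < 1 - s by linarith)
  have h2 : 0 < (1 - s)⁻¹ := by rw [inv_pos]; linarith
  simp only [Psi1, Left.neg_neg_iff]; positivity
lemma Psi_le {s : ℝ} (h : 0 ≤ s) : Psi s ≤ -Psi1 s := by
  rcases le_or_gt 1 s with h1 | h1
  · rw [Psi_zero h1, Psi1_zero h1]; simp
  · have := expNegInvGlue.nonneg (1 - s)
    have h2 : 1 ≤ (1 - s)⁻¹ := by rw [one_le_inv₀] <;> linarith
    have h3 : 1 ≤ (1 - s)⁻¹ ^ 2 := by nlinarith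
    simp only [Psi1, neg_neg, Psi]
    nlinarith

variable {N : ℕ}

lemma hasFDerivAt_sq (q y : ES N) :
    HasFDerivAt (fun y : ES N => ‖y - q‖ ^ 2) (2 • (innerSL ℝ (y - q))) y := by
  have h := ((hasFDerivAt_id (𝕜 := ℝ) y).sub_const q).norm_sq
  simpa using h

lemma inner_single' (v : ES N) (i : Fin N) :
    (innerSL ℝ v) (EuclideanSpace.single i (1:ℝ)) = v i := by
  simp [innerSL_apply_apply, EuclideanSpace.inner_single_right]

/-- Laplacian of a radial function. -/
lemma lap_radial (f f1 f2 : ℝ → ℝ) (h1 : ∀ s, HasDerivAt f (f1 s) s)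
    (h2 : ∀ s, HasDerivAt f1 (f2 s) s) (q y : ES N) :
    lap (fun y => f (‖y - q‖ ^ 2)) y =
      4 * ‖y - q‖ ^ 2 * f2 (‖y - q‖ ^ 2) + 2 * N * f1 (‖y - q‖ ^ 2) := by
  have d1 : ∀ i : Fin N, (fun y => fderiv ℝ (fun y : ES N => f (‖y - q‖ ^ 2)) y
      (EuclideanSpace.single i 1)) = fun y => f1 (‖y - q‖ ^ 2) * (2 * (y - q) i) := by
    intro i; funext y
    have := (h1 (‖y - q‖ ^ 2)).comp_hasFDerivAt y (hasFDerivAt_sq q y)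
    have e : (f ∘ fun y : ES N => ‖y - q‖ ^ 2) = fun y => f (‖y - q‖ ^ 2) := rfl
    rw [e] at this
    rw [this.fderiv]
    simp only [smul_apply, inner_single', smul_eq_mul, nsmul_eq_mul]
    norm_num
  have d2 : ∀ i : Fin N, fderiv ℝ (fun y : ES N => f1 (‖y - q‖ ^ 2) * (2 * (y - q) i)) y
      (EuclideanSpace.single i 1) = 4 * f2 (‖y - q‖ ^ 2) * ((y - q) i) ^ 2 +
        2 * f1 (‖y - q‖ ^ 2) := by
    intro i
    have a1 := (h2 (‖y - q‖ ^ 2)).comp_hasFDerivAt y (hasFDerivAt_sq q y)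
    have e : (f1 ∘ fun y : ES N => ‖y - q‖ ^ 2) = fun y => f1 (‖y - q‖ ^ 2) := rfl
    rw [e] at a1
    have a2 : HasFDerivAt (fun y : ES N => 2 * (y - q) i)
        ((2:ℝ) • (EuclideanSpace.proj i : ES N →L[ℝ] ℝ)) y := by
      have := ((EuclideanSpace.proj i : ES N →L[ℝ] ℝ).hasFDerivAt (x := y - q)).comp y
        ((hasFDerivAt_id (𝕜 := ℝ) y).sub_const q)
      exact (this.const_smul (2:ℝ))
    have a3 : HasFDerivAt (fun y : ES N => f1 (‖y - q‖ ^ 2) * (2 * (y - q) i)) _ y := a1.mul a2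
    rw [a3.fderiv]
    simp only [add_apply, smul_apply, inner_single',
      smul_eq_mul, nsmul_eq_mul]
    simp
    ring
  unfold lap
  simp only [d1, d2]
  rw [Finset.sum_add_distrib, ← Finset.mul_sum, ← EuclideanSpace.real_norm_sq_eq]
  simp
  ring

/-- The mean value kernel. -/
def kη (x : ES N) (t : ℝ) (y : ES N) : ℝ := (t ^ N)⁻¹ * (-2 * Psi1 (‖y - x‖ ^ 2 / t ^ 2))
/-- The test function attached to the kernel. -/
def ψη (x : ES N) (t : ℝ) (y : ES N) : ℝ := Psi (‖y - x‖ ^ 2 / t ^ 2)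
def Gη (N : ℕ) (s : ℝ) : ℝ := 2 * N * Psi1 s + 4 * s * Psi2 s
def cη (N : ℕ) : ℝ := ∫ y : ES N, -2 * Psi1 (‖y‖ ^ 2)

lemma lap_ψη (x : ES N) {t : ℝ} (ht : 0 < t) (y : ES N) :
    lap (ψη x t) y = (t ^ 2)⁻¹ * Gη N (‖y - x‖ ^ 2 / t ^ 2) := by
  have e : ψη x t = fun y => (fun r => Psi (r / t ^ 2)) (‖y - x‖ ^ 2) := rfl
  rw [e, lap_radial (fun r => Psi (r / t ^ 2)) (fun r => Psi1 (r / t ^ 2) / t ^ 2)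
    (fun r => Psi2 (r / t ^ 2) / t ^ 2 / t ^ 2)]
  · unfold Gη; field_simp; ring
  · intro s
    have := (Psi_hasDeriv (s / t ^ 2)).comp s ((hasDerivAt_id s).div_const (t ^ 2))
    simpa [div_eq_mul_inv, Function.comp_def] using this
  · intro s
    have := ((Psi1_hasDeriv (s / t ^ 2)).comp s ((hasDerivAt_id s).div_const (t ^ 2))).div_const (t^2)
    simpa [div_eq_mul_inv, Function.comp_def] using this

lemma kη_deriv (x y : ES N) {t : ℝ} (ht : 0 < t) :
    HasDerivAt (fun t => kη x t y) (t * (t ^ N)⁻¹ * lap (ψη x t) y) t := by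
  have h1 : HasDerivAt (fun t : ℝ => (t ^ N)⁻¹) (-(N * t ^ (N - 1)) / (t ^ N) ^ 2) t :=
    (hasDerivAt_pow N t).inv (by positivity)
  have h2 : HasDerivAt (fun t : ℝ => ‖y - x‖ ^ 2 / t ^ 2)
      ((0 * t ^ 2 - ‖y - x‖ ^ 2 * ((2:ℕ) * t ^ (2 - 1))) / (t ^ 2) ^ 2) t :=
    (hasDerivAt_const t _).div (hasDerivAt_pow 2 t) (by positivity)
  have h3 := ((Psi1_hasDeriv (‖y - x‖ ^ 2 / t ^ 2)).comp t h2).const_mul (-2)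
  have h4 := h1.mul h3
  refine HasDerivAt.congr_deriv (f := fun t => kη x t y) h4 ?_
  rw [lap_ψη x ht, Gη]
  simp only [Function.comp]
  rcases N with _ | n
  · field_simp; push_cast; ring
  · simp only [Nat.add_sub_cancel]; field_simp; push_cast; ring

lemma Gη_bdd (N : ℕ) : ∃ C : ℝ, 0 < C ∧ ∀ s, 0 ≤ s → |Gη N s| ≤ C := by
  have hc : Continuous (Gη N) := by
    unfold Gη
    exact (continuous_const.mul Psi1_cont).add ((continuous_const.mul continuous_id).mul Psi2_cont)
  obtain ⟨C, hC⟩ := (isCompact_Icc (a := (0:ℝ)) (b := 1)).exists_bound_of_continuousOn hc.continuousOn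
  refine ⟨max C 1, by positivity, fun s hs => ?_⟩
  rcases le_or_gt s 1 with h | h
  · exact (hC s ⟨hs, h⟩).trans (le_max_left _ _)
  · have : Gη N s = 0 := by simp [Gη, Psi1_zero h.le, Psi2_zero h.le]
    rw [this]; simp

lemma kη_nonneg (x : ES N) {t : ℝ} (ht : 0 < t) (y : ES N) : 0 ≤ kη x t y := by
  have := Psi1_nonpos (‖y - x‖ ^ 2 / t ^ 2)
  have h2 : 0 ≤ (t ^ N)⁻¹ := by positivity
  unfold kη; exact mul_nonneg h2 (by linarith)

lemma one_le_div_of_dist {x y : ES N} {t : ℝ} (ht : 0 < t) (h : t ≤ dist y x) :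
    1 ≤ ‖y - x‖ ^ 2 / t ^ 2 := by
  rw [dist_eq_norm] at h
  rw [le_div_iff₀ (by positivity)]; nlinarith [norm_nonneg (y - x)]

lemma kη_zero {x y : ES N} {t : ℝ} (ht : 0 < t) (h : t ≤ dist y x) : kη x t y = 0 := by
  simp [kη, Psi1_zero (one_le_div_of_dist ht h)]

lemma ψη_zero {x y : ES N} {t : ℝ} (ht : 0 < t) (h : t ≤ dist y x) : ψη x t y = 0 := by
  simp [ψη, Psi_zero (one_le_div_of_dist ht h)]

lemma kη_pos {x y : ES N} {t : ℝ} (ht : 0 < t) (h : dist y x < t) : 0 < kη x t y := by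
  have h1 : ‖y - x‖ ^ 2 / t ^ 2 < 1 := by
    rw [dist_eq_norm] at h
    rw [div_lt_one (by positivity)]; nlinarith [norm_nonneg (y - x)]
  have := Psi1_neg h1
  have h2 : 0 < (t ^ N)⁻¹ := by positivity
  unfold kη; exact mul_pos h2 (by linarith)

lemma kη_cont (x : ES N) (t : ℝ) : Continuous (kη x t) := by
  unfold kη
  have := Psi1_cont
  fun_prop

lemma ψη_le (x : ES N) {t : ℝ} (ht : 0 < t) (y : ES N) :
    ψη x t y ≤ t ^ N * kη x t y / 2 := by
  have := Psi_le (s := ‖y - x‖ ^ 2 / t ^ 2) (by positivity)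
  unfold ψη kη
  rw [← mul_assoc, mul_inv_cancel₀ (by positivity)]
  linarith

lemma ψη_nonneg (x : ES N) (t : ℝ) (y : ES N) : 0 ≤ ψη x t y := Psi_nonneg _

lemma tsupport_of_zero {f : ES N → ℝ} {x : ES N} {t : ℝ} (h : ∀ y, t ≤ dist y x → f y = 0) :
    tsupport f ⊆ closedBall x t := by
  refine closure_minimal ?_ isClosed_closedBall
  intro y hy
  by_contra hc
  rw [mem_closedBall, not_le] at hc
  exact hy (h y hc.le)

lemma ψη_test {D : Set (ES N)} (x : ES N) {t : ℝ} (ht : 0 < t) (h : closedBall x t ⊆ D) :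
    IsTestFun D (ψη x t) := by
  have hs : tsupport (ψη x t) ⊆ closedBall x t := tsupport_of_zero fun y => ψη_zero ht
  refine ⟨?_, (isCompact_closedBall x t).of_isClosed_subset (isClosed_tsupport _) hs, hs.trans h⟩
  unfold ψη
  refine Psi_contDiff.comp (ContDiff.div_const ?_ _)
  exact (contDiff_id.sub contDiff_const).norm_sq ℝ

lemma kη_mass (x : ES N) {t : ℝ} (ht : 0 < t) : ∫ y, kη x t y = cη N := by
  have h1 : ∫ y, kη x t y = ∫ y : ES N, (t ^ N)⁻¹ * (-2 * Psi1 (‖y‖ ^ 2 / t ^ 2)) := by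
    rw [← integral_sub_right_eq_self (fun y : ES N => (t ^ N)⁻¹ * (-2 * Psi1 (‖y‖ ^ 2 / t ^ 2))) x]
    rfl
  have h2 : ∀ y : ES N, Psi1 (‖y‖ ^ 2 / t ^ 2) = Psi1 (‖t⁻¹ • y‖ ^ 2) := by
    intro y
    congr 1
    rw [norm_smul, Real.norm_of_nonneg (by positivity)]
    field_simp
  rw [h1]
  simp only [h2]
  rw [integral_const_mul]
  have := Measure.integral_comp_smul (volume : Measure (ES N)) (fun y => -2 * Psi1 (‖y‖ ^ 2)) t⁻¹
  rw [this, cη]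
  simp only [finrank_euclideanSpace, Fintype.card_fin, smul_eq_mul]
  rw [abs_of_nonneg (by positivity), inv_pow, inv_inv, ← mul_assoc, inv_mul_cancel₀ (by positivity),
    one_mul]

lemma kη_compact (x : ES N) {t : ℝ} (ht : 0 < t) : HasCompactSupport (kη x t) :=
  (isCompact_closedBall x t).of_isClosed_subset (isClosed_tsupport _)
    (tsupport_of_zero fun y => kη_zero ht)

lemma kη_integrable (x : ES N) {t : ℝ} (ht : 0 < t) : Integrable (kη x t) :=
  (kη_cont x t).integrable_of_hasCompactSupport (kη_compact x ht)

lemma cη_pos : 0 < cη N := by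
  rw [← kη_mass (0 : ES N) one_pos]
  refine (kη_cont _ _).integral_pos_of_hasCompactSupport_nonneg_nonzero (kη_compact _ one_pos)
    (kη_nonneg _ one_pos) (x := 0) ?_
  exact (kη_pos one_pos (by simp)).ne'

lemma kη_bounds (N : ℕ) : ∃ c C : ℝ, 0 < c ∧ 0 < C ∧ ∀ (x y : ES N) (t : ℝ), 0 < t →
    kη x t y ≤ C * (t ^ N)⁻¹ ∧ (dist y x ≤ 2 / 3 * t → c * (t ^ N)⁻¹ ≤ kη x t y) := by
  obtain ⟨C, hC⟩ := (isCompact_Icc (a := (0:ℝ)) (b := 1)).exists_bound_of_continuousOn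
    Psi1_cont.continuousOn
  obtain ⟨m, hm, hmin⟩ := (isCompact_Icc (a := (0:ℝ)) (b := 4/9)).exists_isMinOn
    (f := fun s => -2 * Psi1 s) ⟨0, by norm_num⟩ (continuous_const.mul Psi1_cont).continuousOn
  have hmp : 0 < -2 * Psi1 m := by
    have := Psi1_neg (s := m) (by have := hm.2; linarith)
    linarith
  refine ⟨-2 * Psi1 m, 2 * max C 1, hmp, by positivity, fun x y t ht => ⟨?_, fun h => ?_⟩⟩
  · unfold kη
    rw [mul_comm (2 * max C 1)]
    refine mul_le_mul_of_nonneg_left ?_ (by positivity)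
    rcases le_or_gt (‖y - x‖ ^ 2 / t ^ 2) 1 with h | h
    · have := hC _ ⟨by positivity, h⟩
      rw [Real.norm_eq_abs] at this
      have h3 := neg_abs_le (Psi1 (‖y - x‖ ^ 2 / t ^ 2))
      have := le_max_left C 1
      linarith
    · rw [Psi1_zero h.le]; simp
  · unfold kη
    rw [mul_comm]
    refine mul_le_mul_of_nonneg_left ?_ (by positivity)
    refine hmin ⟨by positivity, ?_⟩
    rw [dist_eq_norm] at h
    rw [div_le_iff₀ (by positivity)]
    nlinarith [norm_nonneg (y - x)]

end


section

/-! ## Section 1b: supersolutions and mean values -/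

variable {N : ℕ}

structure Pot (Ω : Set (ES N)) (a : ℝ) (V : ES N → ℝ) : Prop where
  opn : IsOpen Ω
  meas : Measurable V
  nn : ∀ x ∈ Ω, 0 ≤ V x
  bd : ∀ x T, 0 < T → ball x (2 * T) ⊆ Ω → ∀ y ∈ ball x T, V y * T ^ 2 ≤ a

/-- Continuous weak supersolutions on `D`. -/
def Sp (V : ES N → ℝ) (D : Set (ES N)) (w : ES N → ℝ) : Prop :=
  ContinuousOn w D ∧ ∀ φ, IsTestFun D φ → (∀ x, 0 ≤ φ x) →
    ∫ x, w x * lap φ x ≤ ∫ x, V x * w x * φ x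

lemma Pot.bdd {Ω : Set (ES N)} {a : ℝ} {V : ES N → ℝ} (h : Pot Ω a V) {S : Set (ES N)}
    (hS : IsCompact S) (hSΩ : S ⊆ Ω) : ∃ B : ℝ, ∀ x ∈ S, |V x| ≤ B := by
  have key : ∃ B : ℝ, ∀ x ∈ S, V x ≤ B := by
    refine hS.induction_on (p := fun s => ∃ B : ℝ, ∀ x ∈ s, V x ≤ B) ⟨0, by simp⟩ ?_ ?_ ?_
    · rintro s t hst ⟨B, hB⟩; exact ⟨B, fun x hx => hB x (hst hx)⟩
    · rintro s t ⟨B, hB⟩ ⟨B', hB'⟩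
      refine ⟨max B B', fun x hx => ?_⟩
      rcases hx with hx | hx
      · exact (hB x hx).trans (le_max_left _ _)
      · exact (hB' x hx).trans (le_max_right _ _)
    · intro x hx
      obtain ⟨ε, hε, hb⟩ := Metric.isOpen_iff.1 h.opn x (hSΩ hx)
      refine ⟨ball x (ε / 2), mem_nhdsWithin_of_mem_nhds (ball_mem_nhds x (by positivity)),
        a / (ε / 2) ^ 2, fun y hy => ?_⟩
      rw [le_div_iff₀ (by positivity)]
      exact h.bd x (ε / 2) (by positivity) (by rwa [mul_div_cancel₀ _ (by norm_num)]) y hy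
  obtain ⟨B, hB⟩ := key
  exact ⟨B, fun x hx => by rw [abs_of_nonneg (h.nn x (hSΩ hx))]; exact hB x hx⟩

lemma cont_mul {D : Set (ES N)} (hD : IsOpen D) {w k : ES N → ℝ} (hw : ContinuousOn w D)
    (hk : Continuous k) (hs : tsupport k ⊆ D) : Continuous fun x => w x * k x := by
  refine continuous_of_tsupport fun x hx => ?_
  have hx' : x ∈ D := hs (closure_mono (Function.support_mul_subset_right w k) hx)
  exact (hw.continuousAt (hD.mem_nhds hx')).mul hk.continuousAt

lemma int_mul {D : Set (ES N)} (hD : IsOpen D) {w k : ES N → ℝ} (hw : ContinuousOn w D)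
    (hk : Continuous k) (hc : IsCompact (tsupport k)) (hs : tsupport k ⊆ D) :
    Integrable fun x => w x * k x :=
  (cont_mul hD hw hk hs).integrable_of_hasCompactSupport (HasCompactSupport.mul_left (f := w) hc)

lemma lap_cont {φ : ES N → ℝ} (h : ContDiff ℝ (⊤ : ℕ∞) φ) : Continuous (lap φ) := by
  unfold lap
  refine continuous_finset_sum _ fun i _ => ?_
  have h1 : ContDiff ℝ 1 (fun y => fderiv ℝ φ y (EuclideanSpace.single i 1)) :=
    (h.fderiv_right (m := 1) (by exact WithTop.coe_le_coe.2 le_top)).clm_apply contDiff_const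
  exact (h1.continuous_fderiv one_ne_zero).clm_apply continuous_const

lemma lap_tsupport (φ : ES N → ℝ) : tsupport (lap φ) ⊆ tsupport φ := by
  refine closure_minimal ?_ (isClosed_tsupport φ)
  intro x hx
  by_contra hc
  apply hx
  unfold lap
  refine Finset.sum_eq_zero fun i _ => ?_
  have h1 : tsupport (fun y => fderiv ℝ φ y (EuclideanSpace.single i (1:ℝ))) ⊆ tsupport φ :=
    tsupport_fderiv_apply_subset ℝ _
  have h2 := tsupport_fderiv_apply_subset ℝ (f := fun y => fderiv ℝ φ y (EuclideanSpace.single i (1:ℝ)))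
    (EuclideanSpace.single i (1:ℝ))
  by_contra h0
  exact hc (h1 (h2 (subset_tsupport _ h0)))

lemma test_int {D : Set (ES N)} (hD : IsOpen D) {w φ : ES N → ℝ} (hw : ContinuousOn w D)
    (hφ : IsTestFun D φ) : Integrable (fun x => w x * φ x) ∧ Integrable (fun x => w x * lap φ x) :=
  ⟨int_mul hD hw hφ.1.continuous hφ.2.1 hφ.2.2,
    int_mul hD hw (lap_cont hφ.1) (hφ.2.1.of_isClosed_subset (isClosed_tsupport _) (lap_tsupport φ))
      ((lap_tsupport φ).trans hφ.2.2)⟩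

lemma testV_int {Ω D : Set (ES N)} {a : ℝ} {V : ES N → ℝ} (hV : Pot Ω a V) (hDΩ : D ⊆ Ω)
    (hD : IsOpen D) {w φ : ES N → ℝ} (hw : ContinuousOn w D)
    (hφ : IsTestFun D φ) : Integrable (fun x => V x * w x * φ x) := by
  obtain ⟨B, hB⟩ := hV.bdd hφ.2.1 (hφ.2.2.trans hDΩ)
  have h1 := (test_int hD hw hφ).1
  refine (h1.norm.const_mul B).mono' ?_ ?_
  · simp_rw [mul_assoc]
    exact hV.meas.aestronglyMeasurable.mul h1.aestronglyMeasurable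
  · refine ae_of_all _ fun x => ?_
    by_cases hx : x ∈ tsupport φ
    · rw [mul_assoc, norm_mul]
      exact mul_le_mul_of_nonneg_right (hB x hx) (norm_nonneg _)
    · simp [image_eq_zero_of_notMem_tsupport hx]

section
variable {Ω D : Set (ES N)} {a : ℝ} {V : ES N → ℝ}

lemma IsTestFun.mono {D' : Set (ES N)} {φ : ES N → ℝ} (h : IsTestFun D φ) (hD : D ⊆ D') :
    IsTestFun D' φ := ⟨h.1, h.2.1, h.2.2.trans hD⟩

lemma Sp.mono {D' : Set (ES N)} {w : ES N → ℝ} (h : Sp V D w) (hD : D' ⊆ D) : Sp V D' w :=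
  ⟨h.1.mono hD, fun φ hφ h0 => h.2 φ (hφ.mono hD) h0⟩

lemma Sp.congr {w w' : ES N → ℝ} (h : Sp V D w) (he : ∀ x ∈ D, w x = w' x) : Sp V D w' := by
  refine ⟨h.1.congr fun x hx => (he x hx).symm, fun φ hφ h0 => ?_⟩
  have h2 := h.2 φ hφ h0
  have e1 : ∀ x, w' x * lap φ x = w x * lap φ x := by
    intro x
    by_cases hx : x ∈ tsupport φ
    · rw [he x (hφ.2.2 hx)]
    · rw [image_eq_zero_of_notMem_tsupport (fun h => hx (lap_tsupport φ h))]; simp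
  have e2 : ∀ x, V x * w' x * φ x = V x * w x * φ x := by
    intro x
    by_cases hx : x ∈ tsupport φ
    · rw [he x (hφ.2.2 hx)]
    · rw [image_eq_zero_of_notMem_tsupport hx]; simp
  simpa only [e1, e2] using h2

lemma Sp.add (hV : Pot Ω a V) (hD : IsOpen D) (hDΩ : D ⊆ Ω) {w w' : ES N → ℝ} (h : Sp V D w)
    (h' : Sp V D w') : Sp V D (fun x => w x + w' x) := by
  refine ⟨h.1.add h'.1, fun φ hφ h0 => ?_⟩
  have e1 := h.2 φ hφ h0
  have e2 := h'.2 φ hφ h0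
  simp only [add_mul, mul_add]
  rw [integral_add (test_int hD h.1 hφ).2 (test_int hD h'.1 hφ).2,
    integral_add (testV_int hV hDΩ hD h.1 hφ) (testV_int hV hDΩ hD h'.1 hφ)]
  linarith

lemma Sp.smul {w : ES N → ℝ} (h : Sp V D w) {c : ℝ} (hc : 0 ≤ c) :
    Sp V D (fun x => c * w x) := by
  refine ⟨continuousOn_const.mul h.1, fun φ hφ h0 => ?_⟩
  have e1 := h.2 φ hφ h0
  have e2 : ∀ x, V x * (c * w x) * φ x = c * (V x * w x * φ x) := fun x => by ring
  simp only [mul_assoc c, e2]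
  rw [integral_const_mul, integral_const_mul]
  exact mul_le_mul_of_nonneg_left e1 hc

lemma Sp.change {V' : ES N → ℝ} {a' : ℝ} (hV : Pot Ω a V) (hV' : Pot Ω a' V') (hD : IsOpen D)
    (hDΩ : D ⊆ Ω) {w : ES N → ℝ} (h : Sp V D w) (hle : ∀ x ∈ D, V x * w x ≤ V' x * w x) :
    Sp V' D w := by
  refine ⟨h.1, fun φ hφ h0 => (h.2 φ hφ h0).trans ?_⟩
  refine integral_mono (testV_int hV hDΩ hD h.1 hφ) (testV_int hV' hDΩ hD h.1 hφ) fun x => ?_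
  by_cases hx : x ∈ tsupport φ
  · exact mul_le_mul_of_nonneg_right (hle x (hφ.2.2 hx)) (h0 x)
  · simp [image_eq_zero_of_notMem_tsupport hx]

lemma Sp.of_harm {u : ES N → ℝ} (h : LVHarmonic Ω V u) (hDΩ : D ⊆ Ω) :
    Sp V D u ∧ Sp V D (fun x => -u x) := by
  have key : ∀ φ, IsTestFun D φ → ∫ x, u x * lap φ x = ∫ x, V x * u x * φ x := by
    intro φ hφ
    have := h.2.2.2 φ (hφ.mono hDΩ)
    rw [setIntegral_eq_integral_of_forall_compl_eq_zero,
      setIntegral_eq_integral_of_forall_compl_eq_zero] at this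
    · exact this
    · intro x hx
      rw [image_eq_zero_of_notMem_tsupport (fun h => hx (hDΩ (hφ.2.2 h)))]; simp
    · intro x hx
      rw [image_eq_zero_of_notMem_tsupport (fun h => hx (hDΩ (hφ.2.2 (lap_tsupport φ h))))]; simp
  refine ⟨⟨h.1.mono hDΩ, fun φ hφ _ => (key φ hφ).le⟩, (h.1.mono hDΩ).neg, fun φ hφ _ => ?_⟩
  simp only [neg_mul, mul_neg]
  rw [integral_neg, integral_neg, key φ hφ]

lemma lap_ibp {b φ : ES N → ℝ} (hb : ContDiff ℝ (⊤ : ℕ∞) b) (hφ : IsTestFun univ φ) :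
    ∫ x, b x * lap φ x = ∫ x, lap b x * φ x := by
  have hi : ∀ {f k : ES N → ℝ}, Continuous f → Continuous k → tsupport k ⊆ tsupport φ →
      Integrable fun x => f x * k x := fun {f k} hf hk hs =>
    int_mul isOpen_univ hf.continuousOn hk (hφ.2.1.of_isClosed_subset (isClosed_tsupport _) hs)
      (subset_univ _)
  have hs1 : ∀ i : Fin N, tsupport (fun y => fderiv ℝ φ y (EuclideanSpace.single i (1:ℝ))) ⊆
      tsupport φ := fun i => tsupport_fderiv_apply_subset ℝ _
  have hs2 : ∀ i : Fin N, tsupport (fun y => fderiv ℝ (fun y => fderiv ℝ φ y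
      (EuclideanSpace.single i (1:ℝ))) y (EuclideanSpace.single i (1:ℝ))) ⊆ tsupport φ :=
    fun i => (tsupport_fderiv_apply_subset ℝ _).trans (hs1 i)
  have c1 : ∀ {f : ES N → ℝ}, ContDiff ℝ (⊤ : ℕ∞) f → ∀ i : Fin N,
      ContDiff ℝ 1 (fun y => fderiv ℝ f y (EuclideanSpace.single i 1)) := fun {f} hf i =>
    (hf.fderiv_right (m := 1) (by exact WithTop.coe_le_coe.2 le_top)).clm_apply contDiff_const
  have c2 : ∀ {f : ES N → ℝ}, ContDiff ℝ (⊤ : ℕ∞) f → ∀ i : Fin N,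
      Continuous (fun y => fderiv ℝ (fun y => fderiv ℝ f y (EuclideanSpace.single i 1)) y
        (EuclideanSpace.single i 1)) := fun {f} hf i =>
    ((c1 hf i).continuous_fderiv one_ne_zero).clm_apply continuous_const
  unfold lap
  simp only [Finset.mul_sum, Finset.sum_mul]
  rw [integral_finset_sum _ fun i _ => hi hb.continuous (c2 hφ.1 i) (hs2 i),
    integral_finset_sum _ fun i _ => hi (c2 hb i) hφ.1.continuous subset_rfl]
  refine Finset.sum_congr rfl fun i _ => ?_
  rw [integral_mul_fderiv_eq_neg_fderiv_mul_of_integrable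
    (f := b) (g := fun y => fderiv ℝ φ y (EuclideanSpace.single i 1))]
  · rw [integral_mul_fderiv_eq_neg_fderiv_mul_of_integrable
      (f := fun y => fderiv ℝ b y (EuclideanSpace.single i 1)) (g := φ), neg_neg]
    · exact hi (c2 hb i) hφ.1.continuous subset_rfl
    · exact hi (c1 hb i).continuous (c1 hφ.1 i).continuous (hs1 i)
    · exact hi (c1 hb i).continuous hφ.1.continuous subset_rfl
    · exact fun x _ => (c1 hb i).differentiable one_ne_zero x
    · exact fun x _ => hφ.1.differentiable (by simp) x
  · exact hi (c1 hb i).continuous (c1 hφ.1 i).continuous (hs1 i)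
  · exact hi hb.continuous (c2 hφ.1 i) (hs2 i)
  · exact hi hb.continuous (c1 hφ.1 i).continuous (hs1 i)
  · exact fun x _ => hb.differentiable (by simp) x
  · exact fun x _ => (c1 hφ.1 i).differentiable one_ne_zero x

lemma Sp.of_smooth (hV : Pot Ω a V) (hDΩ : D ⊆ Ω) {b : ES N → ℝ}
    (hb : ContDiff ℝ (⊤ : ℕ∞) b) (h0 : ∀ x ∈ D, 0 ≤ b x) (hl : ∀ x ∈ D, lap b x ≤ 0) :
    Sp V D b := by
  refine ⟨hb.continuous.continuousOn, fun φ hφ hφ0 => ?_⟩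
  rw [lap_ibp hb (hφ.mono (subset_univ _))]
  have hz : ∀ x, x ∉ D → φ x = 0 := fun x hx =>
    image_eq_zero_of_notMem_tsupport fun h => hx (hφ.2.2 h)
  refine le_trans (integral_nonpos fun x => ?_) (integral_nonneg fun x => ?_)
  · by_cases hx : x ∈ D
    · exact mul_nonpos_of_nonpos_of_nonneg (hl x hx) (hφ0 x)
    · simp [hz x hx]
  · by_cases hx : x ∈ D
    · exact mul_nonneg (mul_nonneg (hV.nn x (hDΩ hx)) (h0 x hx)) (hφ0 x)
    · simp [hz x hx]

lemma Sp.const (hV : Pot Ω a V) (hDΩ : D ⊆ Ω) {c : ℝ} (hc : 0 ≤ c) : Sp V D (fun _ => c) :=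
  Sp.of_smooth hV hDΩ contDiff_const (fun _ _ => hc) (fun x _ => by simp [lap])

/-! mean values -/

lemma phi_int (hD : IsOpen D) {w : ES N → ℝ} (hw : ContinuousOn w D) {x : ES N} {t T : ℝ}
    (ht : 0 < t) (htT : t < T) (hb : ball x T ⊆ D) : Integrable fun y => w y * kη x t y :=
  int_mul hD hw (kη_cont x t) (kη_compact x ht)
    ((tsupport_of_zero fun _ => kη_zero ht).trans ((closedBall_subset_ball htT).trans hb))

lemma phi_hasDeriv (hD : IsOpen D) {w : ES N → ℝ} (hw : ContinuousOn w D) {x : ES N} {t T : ℝ}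
    (ht : 0 < t) (htT : t < T) (hb : ball x T ⊆ D) :
    HasDerivAt (fun t => ∫ y, w y * kη x t y)
      (t * (t ^ N)⁻¹ * ∫ y, w y * lap (ψη x t) y) t := by
  obtain ⟨C, hC0, hC⟩ := Gη_bdd N
  obtain ⟨T', h1, h2⟩ := exists_between htT
  have hcb : closedBall x T' ⊆ D := (closedBall_subset_ball h2).trans hb
  have hT' : 0 < T' := ht.trans h1
  have hwi : IntegrableOn w (closedBall x T') :=
    (hw.mono hcb).integrableOn_compact (isCompact_closedBall x T')
  have hz : ∀ s, 0 < s → s ≤ T' → ∀ y, y ∉ closedBall x T' → lap (ψη x s) y = 0 := by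
    intro s hs hsT y hy
    rw [mem_closedBall, not_le] at hy
    rw [lap_ψη x hs]
    have := one_le_div_of_dist hs (hsT.trans hy.le)
    simp [Gη, Psi1_zero this, Psi2_zero this]
  have key := hasDerivAt_integral_of_dominated_loc_of_deriv_le (μ := (volume : Measure (ES N)))
    (F := fun t y => w y * kη x t y)
    (F' := fun t y => w y * (t * (t ^ N)⁻¹ * lap (ψη x t) y)) (x₀ := t) (s := Ioo (t / 2) T')
    (bound := fun y => indicator (closedBall x T') (fun y => ‖w y‖ *
      (T' * ((t/2) ^ N)⁻¹ * (((t/2) ^ 2)⁻¹ * C))) y)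
    (Ioo_mem_nhds (by linarith) h1) ?_ ?_ ?_ ?_ ?_ ?_
  · have k2 := key.2
    refine k2.congr_deriv ?_
    rw [← integral_const_mul]
    congr 1; funext y; ring
  · filter_upwards [Ioo_mem_nhds (show t/2 < t by linarith) h1] with s hs
    exact (phi_int hD hw (by linarith [hs.1]) (hs.2.trans h2) hb).aestronglyMeasurable
  · exact phi_int hD hw ht htT hb
  · have := (test_int hD hw (ψη_test x ht ((closedBall_subset_ball htT).trans hb))).2
    refine (this.const_mul (t * (t ^ N)⁻¹)).aestronglyMeasurable.congr (ae_of_all _ fun y => ?_)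
    ring
  · refine ae_of_all _ fun y s hs => ?_
    have hs0 : 0 < s := by linarith [hs.1]
    by_cases hy : y ∈ closedBall x T'
    · rw [indicator_of_mem hy, norm_mul]
      refine mul_le_mul_of_nonneg_left ?_ (norm_nonneg _)
      rw [lap_ψη x hs0, Real.norm_eq_abs, abs_mul, abs_mul, abs_mul, abs_of_pos hs0,
        abs_of_pos (show 0 < (s ^ N)⁻¹ by positivity), abs_of_pos (show 0 < (s ^ 2)⁻¹ by positivity)]
      have a1 : s ≤ T' := hs.2.le
      have a2 : t / 2 ≤ s := hs.1.le
      have a3 := hC (‖y - x‖ ^ 2 / s ^ 2) (by positivity)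
      gcongr
    · rw [indicator_of_notMem hy, hz s hs0 hs.2.le y hy]; simp
  · rw [integrable_indicator_iff measurableSet_closedBall]
    exact hwi.norm.mul_const _
  · refine ae_of_all _ fun y s hs => ?_
    have hs0 : 0 < s := by linarith [hs.1]
    exact (kη_deriv x y hs0).const_mul (w y)

lemma phi_tendsto (hD : IsOpen D) {w : ES N → ℝ} (hw : ContinuousOn w D) {x : ES N} (hx : x ∈ D) :
    Tendsto (fun t => ∫ y, w y * kη x t y) (𝓝[>] 0) (𝓝 (cη N * w x)) := by
  rw [Metric.tendsto_nhds]
  intro ε hε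
  obtain ⟨T, hT, hb⟩ := Metric.isOpen_iff.1 hD x hx
  have hc := hw.continuousAt (hD.mem_nhds hx)
  have hcη := cη_pos (N := N)
  obtain ⟨d, hd, hcd⟩ := Metric.continuousAt_iff.1 hc (ε / (2 * cη N)) (by positivity)
  filter_upwards [Ioo_mem_nhdsGT (show 0 < min T d by positivity)] with t ht
  have ht0 : 0 < t := ht.1
  have htT : t < T := ht.2.trans_le (min_le_left _ _)
  have htd : t < d := ht.2.trans_le (min_le_right _ _)
  have i1 := phi_int hD hw ht0 htT hb
  have i2 := (kη_integrable x ht0).const_mul (w x)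
  have e : (∫ y, w y * kη x t y) - cη N * w x = ∫ y, (w y * kη x t y - w x * kη x t y) := by
    rw [integral_sub i1 i2, integral_const_mul, kη_mass x ht0]; ring
  rw [Real.dist_eq, e]
  calc |∫ y, (w y * kη x t y - w x * kη x t y)|
      ≤ ∫ y, |w y * kη x t y - w x * kη x t y| := abs_integral_le_integral_abs
    _ ≤ ∫ y, ε / (2 * cη N) * kη x t y := by
        refine integral_mono (i1.sub i2).abs ((kη_integrable x ht0).const_mul _) fun y => ?_
        have hk := kη_nonneg x ht0 y
        show |w y * kη x t y - w x * kη x t y| ≤ _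
        rw [← sub_mul, abs_mul, abs_of_nonneg hk]
        rcases le_or_gt t (dist y x) with h | h
        · rw [kη_zero ht0 h]; simp
        · exact mul_le_mul_of_nonneg_right (hcd (h.trans htd)).le hk
    _ = ε / 2 := by rw [integral_const_mul, kη_mass x ht0]; field_simp
    _ < ε := by linarith

/-- Mean value inequality. -/
lemma mean_le (hV : Pot Ω a V) (hDΩ : D ⊆ Ω) (hD : IsOpen D) {w : ES N → ℝ} (hw : Sp V D w)
    {x : ES N} {t T B : ℝ} (ht : 0 < t) (htT : t < T) (hb : ball x T ⊆ D)
    (H : ∀ y ∈ ball x T, ∀ p h : ℝ, 0 ≤ p → p ≤ h → V y * w y * p ≤ B * w y * h) :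
    ∫ y, w y * kη x t y ≤ Real.exp (B * t ^ 2 / 4) * (cη N * w x) := by
  set Φ := fun t => ∫ y, w y * kη x t y with hΦ
  set g := fun t => Real.exp (-(B * t ^ 2 / 4)) * Φ t with hg
  have hder : ∀ s ∈ Ioo 0 T, HasDerivAt g (Real.exp (-(B * s ^ 2 / 4)) * (-(B * s / 2)) * Φ s +
      Real.exp (-(B * s ^ 2 / 4)) * (s * (s ^ N)⁻¹ * ∫ y, w y * lap (ψη x s) y)) s := by
    intro s hs
    have h1 : HasDerivAt (fun s : ℝ => -(B * s ^ 2 / 4)) (-(B * s / 2)) s := by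
      have := (((hasDerivAt_pow 2 s).const_mul B).div_const 4).neg
      refine this.congr_deriv ?_
      norm_num; ring
    exact h1.exp.mul (phi_hasDeriv hD hw.1 hs.1 hs.2 hb)
  have hneg : ∀ s ∈ Ioo 0 T, Real.exp (-(B * s ^ 2 / 4)) * (-(B * s / 2)) * Φ s +
      Real.exp (-(B * s ^ 2 / 4)) * (s * (s ^ N)⁻¹ * ∫ y, w y * lap (ψη x s) y) ≤ 0 := by
    intro s hs
    have hs0 : 0 < s := hs.1
    have hcb : closedBall x s ⊆ D := (closedBall_subset_ball hs.2).trans hb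
    have ht := ψη_test x hs0 hcb
    have h1 := hw.2 _ ht (ψη_nonneg x s)
    have h2 : ∫ y, V y * w y * ψη x s y ≤ ∫ y, B * s ^ N / 2 * (w y * kη x s y) := by
      refine integral_mono (testV_int hV hDΩ hD hw.1 ht)
        ((phi_int hD hw.1 hs0 hs.2 hb).const_mul _) fun y => ?_
      show V y * w y * ψη x s y ≤ B * s ^ N / 2 * (w y * kη x s y)
      rcases le_or_gt s (dist y x) with h | h
      · rw [ψη_zero hs0 h, kη_zero hs0 h]; simp
      · have := H y (mem_ball.2 (h.trans hs.2)) _ _ (ψη_nonneg x s y) (ψη_le x hs0 y)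
        linarith
    rw [integral_const_mul] at h2
    have h3 : s * (s ^ N)⁻¹ * ∫ y, w y * lap (ψη x s) y ≤ B * s / 2 * Φ s := by
      calc s * (s ^ N)⁻¹ * ∫ y, w y * lap (ψη x s) y
          ≤ s * (s ^ N)⁻¹ * (B * s ^ N / 2 * Φ s) :=
            mul_le_mul_of_nonneg_left (h1.trans h2) (by positivity)
        _ = B * s / 2 * Φ s := by field_simp
    have := mul_le_mul_of_nonneg_left h3 (Real.exp_pos (-(B * s ^ 2 / 4))).le
    linarith
  have hanti : AntitoneOn g (Ioo 0 T) := by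
    refine antitoneOn_of_deriv_nonpos (convex_Ioo 0 T)
      (fun s hs => (hder s hs).continuousAt.continuousWithinAt) ?_ ?_
    · intro s hs; rw [interior_Ioo] at hs
      exact (hder s hs).differentiableAt.differentiableWithinAt
    · intro s hs; rw [interior_Ioo] at hs
      rw [(hder s hs).deriv]; exact hneg s hs
  have hxD : x ∈ D := hb (mem_ball_self (ht.trans htT))
  have hlim : Tendsto g (𝓝[>] 0) (𝓝 (1 * (cη N * w x))) := by
    refine Tendsto.mul ?_ (phi_tendsto hD hw.1 hxD)
    have : Tendsto (fun s : ℝ => Real.exp (-(B * s ^ 2 / 4))) (𝓝 0) (𝓝 (Real.exp (-(B * 0 ^ 2 / 4)))) :=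
      Continuous.tendsto (by fun_prop) 0
    simp only [ne_eq, OfNat.ofNat_ne_zero, not_false_eq_true, zero_pow, mul_zero, zero_div, neg_zero,
      Real.exp_zero] at this
    exact this.mono_left nhdsWithin_le_nhds
  have hge : g t ≤ 1 * (cη N * w x) := by
    refine ge_of_tendsto hlim ?_
    filter_upwards [Ioo_mem_nhdsGT ht] with s hs
    exact hanti ⟨hs.1, hs.2.trans htT⟩ ⟨ht, htT⟩ hs.2.le
  have e : Φ t = Real.exp (B * t ^ 2 / 4) * g t := by
    rw [hg]; simp only; rw [← mul_assoc, ← Real.exp_add]; simp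
  rw [show (∫ y, w y * kη x t y) = Φ t from rfl, e]
  refine mul_le_mul_of_nonneg_left ?_ (Real.exp_pos _).le
  linarith

end

end


section

/-! ## Section 2: maximum principle, decay, weak Harnack -/

variable {N : ℕ} {Ω D : Set (ES N)} {a : ℝ} {V : ES N → ℝ}

lemma mean_nonpos (hV : Pot Ω a V) (hDΩ : D ⊆ Ω) (hD : IsOpen D) {w : ES N → ℝ} (hw : Sp V D w)
    {x : ES N} {t T : ℝ} (ht : 0 < t) (htT : t < T) (hb : ball x T ⊆ D)
    (h0 : ∀ y ∈ ball x T, w y ≤ 0) : ∫ y, w y * kη x t y ≤ cη N * w x := by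
  have := mean_le (B := 0) hV hDΩ hD hw ht htT hb (fun y hy p h hp _ => by
    have := mul_nonpos_of_nonneg_of_nonpos (hV.nn y (hDΩ (hb hy))) (h0 y hy)
    have := mul_nonpos_of_nonpos_of_nonneg this hp
    simpa using this)
  simpa using this

lemma mean_nonneg (hV : Pot Ω a V) (hDΩ : D ⊆ Ω) (hD : IsOpen D) {w : ES N → ℝ} (hw : Sp V D w)
    {x : ES N} {t T B : ℝ} (ht : 0 < t) (htT : t < T) (hb : ball x T ⊆ D)
    (hB0 : 0 ≤ B) (hB : ∀ y ∈ ball x T, V y ≤ B)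
    (h0 : ∀ y ∈ ball x T, 0 ≤ w y) :
    ∫ y, w y * kη x t y ≤ Real.exp (B * t ^ 2 / 4) * (cη N * w x) := by
  refine mean_le hV hDΩ hD hw ht htT hb (fun y hy p h hp hph => ?_)
  have h1 := h0 y hy
  have h2 := hB y hy
  have : V y * w y ≤ B * w y := mul_le_mul_of_nonneg_right h2 h1
  have h3 : V y * w y * p ≤ B * w y * p := mul_le_mul_of_nonneg_right this hp
  have h4 : B * w y * p ≤ B * w y * h := mul_le_mul_of_nonneg_left hph (by positivity)
  linarith

lemma max_principle (hN : 0 < N) (hV : Pot Ω a V) (hDΩ : D ⊆ Ω) (hD : IsOpen D)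
    (hDb : Bornology.IsBounded D) {w : ES N → ℝ} (hw : Sp V D w)
    (hbd : ∀ ξ ∈ frontier D, ∀ ε > 0, ∀ᶠ x in 𝓝[D] ξ, -ε < w x) : ∀ x ∈ D, 0 ≤ w x := by
  intro x1 hx1
  by_contra hneg
  push Not at hneg
  have hcomp : ∀ m < 0, IsCompact {x | x ∈ D ∧ w x ≤ m} := by
    intro m hm
    refine isCompact_of_isClosed_isBounded ?_ (hDb.subset fun x hx => hx.1)
    rw [← closure_subset_iff_isClosed]
    intro x hx
    have hfr : ∃ᶠ y in 𝓝 x, y ∈ D ∧ w y ≤ m := mem_closure_iff_frequently.1 hx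
    have hxc : x ∈ closure D := closure_mono (fun y hy => hy.1) hx
    by_cases hxD : x ∈ D
    · refine ⟨hxD, ?_⟩
      by_contra hc
      push Not at hc
      have := (hw.1.continuousAt (hD.mem_nhds hxD)).eventually (lt_mem_nhds hc)
      obtain ⟨y, hy, hy2⟩ := (hfr.and_eventually this).exists
      linarith [hy.2]
    · have hxf : x ∈ frontier D := ⟨hxc, by rwa [hD.interior_eq]⟩
      have := hbd x hxf (-m) (by linarith)
      rw [eventually_nhdsWithin_iff] at this
      obtain ⟨y, hy, hy2⟩ := (hfr.and_eventually this).exists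
      have := hy2 hy.1
      linarith [hy.2]
  have hne : ({x | x ∈ D ∧ w x ≤ w x1} : Set (ES N)).Nonempty := ⟨x1, hx1, le_rfl⟩
  obtain ⟨z, hz, hzmin⟩ := (hcomp (w x1) hneg).exists_isMinOn hne (hw.1.mono fun x hx => hx.1)
  have hmin : ∀ x ∈ D, w z ≤ w x := by
    intro x hx
    rcases le_or_gt (w x) (w x1) with h | h
    · exact hzmin ⟨hx, h⟩
    · exact hz.2.trans h.le
  have hm : w z < 0 := hz.2.trans_lt hneg
  set Z : Set (ES N) := {x | x ∈ D ∧ w x ≤ w z} with hZ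
  have hZc : IsCompact Z := hcomp _ hm
  have hZo : IsOpen Z := by
    rw [Metric.isOpen_iff]
    rintro x ⟨hxD, hxm⟩
    have hxz : w x = w z := le_antisymm hxm (hmin x hxD)
    have hneg0 : ∀ᶠ y in 𝓝 x, w y < 0 :=
      (hw.1.continuousAt (hD.mem_nhds hxD)).eventually (gt_mem_nhds (by rw [hxz]; exact hm))
    obtain ⟨T, hT, hb⟩ := Metric.mem_nhds_iff.1 (inter_mem (hD.mem_nhds hxD) hneg0)
    have hbD : ball x T ⊆ D := fun y hy => (hb hy).1
    have ht : 0 < T / 2 := by positivity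
    have h1 := mean_nonpos hV hDΩ hD hw ht (half_lt_self hT) hbD (fun y hy => (hb hy).2.le)
    have i1 := phi_int hD hw.1 ht (half_lt_self hT) hbD
    have i2 := (kη_integrable x ht).const_mul (w z)
    have hsupp : tsupport (kη x (T / 2)) ⊆ D := (tsupport_of_zero fun _ => kη_zero ht).trans
      ((closedBall_subset_ball (half_lt_self hT)).trans hbD)
    have hnn : ∀ y, 0 ≤ w y * kη x (T / 2) y - w z * kη x (T / 2) y := by
      intro y
      by_cases hy : y ∈ D
      · rw [← sub_mul]
        exact mul_nonneg (by linarith [hmin y hy]) (kη_nonneg x ht y)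
      · rw [image_eq_zero_of_notMem_tsupport fun h => hy (hsupp h)]; simp
    have hintgr : ∫ y, (w y * kη x (T / 2) y - w z * kη x (T / 2) y) = 0 := by
      refine le_antisymm ?_ (integral_nonneg hnn)
      rw [integral_sub i1 i2, integral_const_mul, kη_mass x ht]
      rw [hxz] at h1; linarith
    have hcont : Continuous fun y => w y * kη x (T / 2) y - w z * kη x (T / 2) y :=
      (cont_mul hD hw.1 (kη_cont _ _) hsupp).sub (continuous_const.mul (kη_cont _ _))
    have hzero := hcont.ae_eq_iff_eq volume continuous_zero |>.1
      ((integral_eq_zero_iff_of_nonneg hnn (i1.sub i2)).1 hintgr)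
    refine ⟨T / 2, ht, fun y hy => ?_⟩
    have hyD : y ∈ D := hbD (ball_subset_ball (half_le_self hT.le) hy)
    have e := congrFun hzero y
    simp only [Pi.zero_apply, ← sub_mul] at e
    rcases mul_eq_zero.1 e with e | e
    · exact ⟨hyD, by linarith⟩
    · exact absurd e (kη_pos ht hy).ne'
  have hclopen : IsClopen Z := ⟨hZc.isClosed, hZo⟩
  have : Nonempty (Fin N) := ⟨⟨0, hN⟩⟩
  have : Nontrivial (ES N) := inferInstance
  have huniv := hclopen.eq_univ ⟨z, hz.1, le_rfl⟩
  exact NormedSpace.unbounded_univ ℝ (ES N) (huniv ▸ hZc.isBounded)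

/-- Decay lemma with an exterior ball. -/
lemma decay (hN : 0 < N) (κ : ℝ) (hκ : 0 < κ) : ∃ η : ℝ, 0 < η ∧ η < 1 ∧
    ∀ (Ω D : Set (ES N)) (a : ℝ) (V : ES N → ℝ) (_ : Pot Ω a V) (_ : D ⊆ Ω) (_ : IsOpen D)
      (w : ES N → ℝ) (_ : Sp V D w) (q : ES N) (ρ m : ℝ) (_ : 0 < ρ) (_ : 0 ≤ m)
      (_ : ∀ x ∈ D, κ * ρ ≤ dist x q) (_ : ∀ x ∈ D, dist x q < ρ → -m ≤ w x)
      (_ : ∀ ξ ∈ frontier D, dist ξ q < ρ → ∀ ε > 0, ∀ᶠ x in 𝓝[D] ξ, -ε < w x),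
      ∀ x ∈ D, dist x q ≤ ρ / 2 → -((1 - η) * m) ≤ w x := by
  set l : ℝ := N / (2 * κ ^ 2) with hl
  have hN' : (0:ℝ) < N := by exact_mod_cast hN
  have hlpos : 0 < l := by positivity
  refine ⟨Real.exp (-l / 4) - Real.exp (-l), ?_, ?_, ?_⟩
  · rw [sub_pos, Real.exp_lt_exp]; linarith
  · have : Real.exp (-l / 4) ≤ 1 := Real.exp_le_one_iff.2 (by linarith)
    linarith [Real.exp_pos (-l)]
  intro Ω D a V hV hDΩ hD w hw q ρ m hρ hm hfar hlow hbd x hx hxq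
  set f : ℝ → ℝ := fun r => 1 + Real.exp (-l) - Real.exp (-(l / ρ ^ 2) * r) with hf
  set b : ES N → ℝ := fun y => f (‖y - q‖ ^ 2) with hb
  have hfder : ∀ s, HasDerivAt f (l / ρ ^ 2 * Real.exp (-(l / ρ ^ 2) * s)) s := by
    intro s
    have := (((hasDerivAt_id s).const_mul (-(l / ρ ^ 2))).exp).const_sub (1 + Real.exp (-l))
    refine this.congr_deriv ?_
    simp; ring
  have hfder2 : ∀ s, HasDerivAt (fun s => l / ρ ^ 2 * Real.exp (-(l / ρ ^ 2) * s))
      (-(l / ρ ^ 2) ^ 2 * Real.exp (-(l / ρ ^ 2) * s)) s := by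
    intro s
    have := (((hasDerivAt_id s).const_mul (-(l / ρ ^ 2))).exp).const_mul (l / ρ ^ 2)
    refine this.congr_deriv ?_
    simp; ring
  have hbs : ContDiff ℝ (⊤ : ℕ∞) b := by
    have h1 : ContDiff ℝ (⊤ : ℕ∞) (fun y : ES N => ‖y - q‖ ^ 2) :=
      (contDiff_id.sub contDiff_const).norm_sq ℝ
    have h2 : ContDiff ℝ (⊤ : ℕ∞) f := by
      rw [hf]; exact contDiff_const.sub (Real.contDiff_exp.comp (contDiff_const.mul contDiff_id))
    exact h2.comp h1
  have hbpos : ∀ y, 0 ≤ b y := by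
    intro y
    have : Real.exp (-(l / ρ ^ 2) * ‖y - q‖ ^ 2) ≤ 1 := by
      rw [Real.exp_le_one_iff]
      have : 0 ≤ l / ρ ^ 2 * ‖y - q‖ ^ 2 := by positivity
      linarith
    simp only [hb, hf]; linarith [Real.exp_pos (-l)]
  set D' := D ∩ ball q ρ with hD'
  have hD'o : IsOpen D' := hD.inter isOpen_ball
  have hD'Ω : D' ⊆ Ω := inter_subset_left.trans hDΩ
  have hbS : Sp V D' b := by
    refine Sp.of_smooth hV hD'Ω hbs (fun y _ => hbpos y) (fun y hy => ?_)
    rw [hb, lap_radial f _ _ hfder hfder2]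
    have h1 := hfar y hy.1
    rw [dist_eq_norm] at h1
    have h2 : κ ^ 2 * ρ ^ 2 ≤ ‖y - q‖ ^ 2 := by
      rw [← mul_pow]; gcongr
    have h3 : (2:ℝ) * N ≤ 4 * ‖y - q‖ ^ 2 * (l / ρ ^ 2) := by
      have : 4 * (κ ^ 2 * ρ ^ 2) * (l / ρ ^ 2) = 2 * N := by rw [hl]; field_simp; ring
      rw [← this]; gcongr
    have h4 : 0 ≤ l / ρ ^ 2 * Real.exp (-(l / ρ ^ 2) * ‖y - q‖ ^ 2) := by positivity
    nlinarith
  have hsum := Sp.add hV hD'o hD'Ω (hw.mono inter_subset_left) (hbS.smul hm)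
  have hbc : Continuous b := hbs.continuous
  have hMP := max_principle hN hV hD'Ω hD'o (isBounded_ball.subset inter_subset_right) hsum (by
    intro ξ hξ ε hε
    rcases lt_or_ge (dist ξ q) ρ with h | h
    · have hξD : ξ ∈ frontier D := by
        refine ⟨closure_mono inter_subset_left hξ.1, fun hc => ?_⟩
        rw [hD.interior_eq] at hc
        exact hξ.2 (by rw [hD'o.interior_eq]; exact ⟨hc, h⟩)
      have := (hbd ξ hξD h ε hε).filter_mono (nhdsWithin_mono ξ (inter_subset_left : D' ⊆ D))
      filter_upwards [this] with y hy
      have := mul_nonneg hm (hbpos y)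
      linarith
    · have hbξ : 1 ≤ b ξ := by
        have : Real.exp (-(l / ρ ^ 2) * ‖ξ - q‖ ^ 2) ≤ Real.exp (-l) := by
          rw [Real.exp_le_exp]
          rw [dist_eq_norm] at h
          have : l / ρ ^ 2 * ρ ^ 2 ≤ l / ρ ^ 2 * ‖ξ - q‖ ^ 2 := by gcongr
          rw [div_mul_cancel₀ _ (by positivity)] at this
          linarith
        simp only [hb, hf]; linarith
      have hcont : ContinuousAt (fun y => m * b y) ξ := (continuous_const.mul hbc).continuousAt
      have h1 : m - ε < m * b ξ := by nlinarith
      have := (hcont.eventually (lt_mem_nhds h1)).filter_mono (nhdsWithin_le_nhds (s := D'))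
      filter_upwards [this, self_mem_nhdsWithin] with y hy hyD
      have := hlow y hyD.1 hyD.2
      linarith)
  have hfin := hMP x ⟨hx, mem_ball.2 (by linarith)⟩
  have hbx : b x ≤ 1 - (Real.exp (-l / 4) - Real.exp (-l)) := by
    have : Real.exp (-l / 4) ≤ Real.exp (-(l / ρ ^ 2) * ‖x - q‖ ^ 2) := by
      rw [Real.exp_le_exp]
      rw [dist_eq_norm] at hxq
      have : l / ρ ^ 2 * ‖x - q‖ ^ 2 ≤ l / ρ ^ 2 * (ρ / 2) ^ 2 := by gcongr
      have e : l / ρ ^ 2 * (ρ / 2) ^ 2 = l / 4 := by field_simp; ring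
      linarith
    simp only [hb, hf]; linarith
  have := mul_le_mul_of_nonneg_left hbx hm
  linarith

/-- Weak Harnack inequality, integral version. -/
lemma wh_int (N : ℕ) (a : ℝ) : ∃ c : ℝ, 0 < c ∧ c ≤ 1 ∧
    ∀ (Ω D : Set (ES N)) (V : ES N → ℝ) (_ : Pot Ω a V) (_ : D ⊆ Ω) (_ : IsOpen D)
      (w : ES N → ℝ) (_ : Sp V D w) (x : ES N) (t : ℝ) (_ : 0 < t) (_ : ball x (16 * t) ⊆ Ω)
      (_ : ball x (8 * t) ⊆ D) (_ : ∀ y ∈ ball x (8 * t), 0 ≤ w y),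
      ∀ z, dist z x ≤ 2 * t → c * ∫ y, w y * kη x t y ≤ cη N * w z := by
  obtain ⟨c0, C1, hc0, hC1, hk⟩ := kη_bounds N
  set e : ℝ := Real.exp |a| with he
  have hepos : 0 < e := Real.exp_pos _
  have he1 : 1 ≤ e := Real.one_le_exp (abs_nonneg a)
  set c : ℝ := c0 * (5 ^ N)⁻¹ / C1 with hc
  have hcpos : 0 < c := by positivity
  refine ⟨min (c / e) 1, by positivity, min_le_right _ _, ?_⟩
  intro Ω D V hV hDΩ hD w hw x t ht hbΩ hbD h0 z hz
  have hsub : ball z (6 * t) ⊆ ball x (8 * t) := by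
    intro y hy; rw [mem_ball] at *
    linarith [dist_triangle y z x]
  have hxx : x ∈ ball x (8 * t) := mem_ball_self (by positivity)
  have ha0 : 0 ≤ a := by
    have h1 := hV.bd x (8 * t) (by positivity) (by convert hbΩ using 2; ring) x hxx
    have h2 := hV.nn x (hDΩ (hbD hxx))
    have : 0 ≤ V x * (8 * t) ^ 2 := by positivity
    linarith
  have h1 := mean_nonneg (B := a / (8 * t) ^ 2) (t := 5 * t) (T := 6 * t) (x := z) hV hDΩ hD hw
    (by positivity) (by linarith) (hsub.trans hbD) (by positivity) (by
      intro y hy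
      rw [le_div_iff₀ (by positivity)]
      exact hV.bd x (8 * t) (by positivity) (by convert hbΩ using 2; ring) y (hsub hy))
    (fun y hy => h0 y (hsub hy))
  have i1 := phi_int hD hw.1 (show 0 < 5 * t by positivity) (show 5 * t < 6 * t by linarith)
    (hsub.trans hbD)
  have i2 := phi_int hD hw.1 ht (show t < 8 * t by linarith) hbD
  have hcomp : c * ∫ y, w y * kη x t y ≤ ∫ y, w y * kη z (5 * t) y := by
    rw [← integral_const_mul]
    refine integral_mono (i2.const_mul c) i1 fun y => ?_
    show c * (w y * kη x t y) ≤ w y * kη z (5 * t) y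
    rcases lt_or_ge (dist y x) t with h | h
    · have hy : y ∈ ball x (8 * t) := mem_ball.2 (by linarith)
      have hwy := h0 y hy
      have hl : c * kη x t y ≤ kη z (5 * t) y := by
        have b1 := (hk x y t ht).1
        have b2 := (hk z y (5 * t) (by positivity)).2 (by
          have := dist_triangle y x z
          rw [dist_comm z x] at hz
          linarith)
        calc c * kη x t y ≤ c * (C1 * (t ^ N)⁻¹) := by gcongr
          _ = c0 * ((5 * t) ^ N)⁻¹ := by rw [hc, mul_pow]; field_simp
          _ ≤ _ := b2
      calc c * (w y * kη x t y) = w y * (c * kη x t y) := by ring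
        _ ≤ _ := mul_le_mul_of_nonneg_left hl hwy
    · rw [kη_zero ht h]
      simp only [mul_zero]
      rcases lt_or_ge (dist y z) (5 * t) with h2 | h2
      · exact mul_nonneg (h0 y (hsub (mem_ball.2 (by linarith)))) (kη_nonneg _ (by positivity) _)
      · rw [kη_zero (by positivity) h2]; simp
  have hexp : Real.exp (a / (8 * t) ^ 2 * (5 * t) ^ 2 / 4) ≤ e := by
    rw [he, Real.exp_le_exp, abs_of_nonneg ha0]
    have : a / (8 * t) ^ 2 * (5 * t) ^ 2 / 4 = a * (25 / 256) := by field_simp; ring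
    rw [this]; linarith
  have hwz : 0 ≤ w z := h0 z (mem_ball.2 (by linarith))
  have hcη := cη_pos (N := N)
  have hΦ : 0 ≤ ∫ y, w y * kη x t y := by
    refine integral_nonneg fun y => ?_
    rcases lt_or_ge (dist y x) t with h | h
    · exact mul_nonneg (h0 y (mem_ball.2 (by linarith))) (kη_nonneg _ ht _)
    · rw [kη_zero ht h]; simp
  have h2 : c * ∫ y, w y * kη x t y ≤ e * (cη N * w z) :=
    (hcomp.trans h1).trans (by gcongr)
  calc min (c / e) 1 * ∫ y, w y * kη x t y ≤ c / e * ∫ y, w y * kη x t y := by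
        gcongr; exact min_le_left _ _
    _ = (c * ∫ y, w y * kη x t y) / e := by ring
    _ ≤ _ := by rw [div_le_iff₀ hepos]; linarith

/-- Weak Harnack and Harnack at one step. -/
lemma wh_step (N : ℕ) (a : ℝ) : ∃ c : ℝ, 0 < c ∧ c ≤ 1 ∧
    ∀ (Ω D : Set (ES N)) (V : ES N → ℝ) (_ : Pot Ω a V) (_ : D ⊆ Ω) (_ : IsOpen D)
      (w : ES N → ℝ) (_ : Sp V D w) (x : ES N) (t : ℝ) (_ : 0 < t) (_ : ball x (16 * t) ⊆ Ω)
      (_ : ball x (8 * t) ⊆ D) (_ : ∀ y ∈ ball x (8 * t), 0 ≤ w y),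
      (∀ m, (∀ y ∈ ball x t, m ≤ w y) → ∀ z, dist z x ≤ 2 * t → c * m ≤ w z) ∧
      (Sp V D (fun x => - w x) → ∀ z, dist z x ≤ 2 * t → c * w x ≤ w z) := by
  obtain ⟨c, hc0, hc1, H⟩ := wh_int N a
  refine ⟨c, hc0, hc1, ?_⟩
  intro Ω D V hV hDΩ hD w hw x t ht hbΩ hbD h0
  have hcη := cη_pos (N := N)
  have i2 := phi_int hD hw.1 ht (show t < 8 * t by linarith) hbD
  have key : ∀ m, cη N * m ≤ ∫ y, w y * kη x t y → ∀ z, dist z x ≤ 2 * t → c * m ≤ w z := by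
    intro m hm z hz
    have h1 := H Ω D V hV hDΩ hD w hw x t ht hbΩ hbD h0 z hz
    have h2 : c * (cη N * m) ≤ cη N * w z := (mul_le_mul_of_nonneg_left hm hc0.le).trans h1
    have h3 : cη N * (c * m) ≤ cη N * w z := by linarith
    exact le_of_mul_le_mul_left h3 hcη
  refine ⟨fun m hm => key m ?_, fun hs => key _ ?_⟩
  · rw [← kη_mass x ht, mul_comm, ← integral_const_mul]
    refine integral_mono ((kη_integrable x ht).const_mul m) i2 fun y => ?_
    show m * kη x t y ≤ w y * kη x t y
    rcases lt_or_ge (dist y x) t with h | h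
    · exact mul_le_mul_of_nonneg_right (hm y h) (kη_nonneg _ ht _)
    · rw [kη_zero ht h]; simp
  · have := mean_nonpos hV hDΩ hD hs ht (show t < 8 * t by linarith) hbD (fun y hy => by
      have := h0 y hy; simpa using this)
    simp only [neg_mul, integral_neg, mul_neg] at this
    linarith

end


section

/-! ## Section 3: charts, chains, boundary estimates -/

variable {N : ℕ} {Ω : Set (ES N)} {a : ℝ} {V : ES N → ℝ}

structure Chart (Ω : Set (ES N)) (L R : ℝ) (p e : ES N) (F : ES N → ℝ) : Prop where
  L1 : 1 ≤ L
  R0 : 0 < R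
  he : ‖e‖ = 1
  lin : ∀ x τ, F (x + τ • e) = F x + τ
  lip : ∀ x x', |F x - F x'| ≤ L * dist x x'
  zero : F p = 0
  mem : ∀ x ∈ ball p R, (x ∈ Ω ↔ 0 < F x)

/-- lower boundary values -/
def LBd (Ω S : Set (ES N)) (w : ES N → ℝ) : Prop :=
  ∀ ξ ∈ frontier Ω, ξ ∈ S → ∀ ε > 0, ∀ᶠ x in 𝓝[Ω] ξ, -ε < w x

def Van (Ω S : Set (ES N)) (u : ES N → ℝ) : Prop :=
  ∀ ξ ∈ frontier Ω, ξ ∈ S → Tendsto u (𝓝[Ω] ξ) (𝓝 0)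

lemma Van.mono {S S' : Set (ES N)} {u : ES N → ℝ} (h : Van Ω S u) (hs : S' ⊆ S) : Van Ω S' u :=
  fun ξ hξ hS => h ξ hξ (hs hS)

lemma LBd.mono {S S' : Set (ES N)} {u : ES N → ℝ} (h : LBd Ω S u) (hs : S' ⊆ S) : LBd Ω S' u :=
  fun ξ hξ hS => h ξ hξ (hs hS)

lemma Van.neg_LBd {S : Set (ES N)} {u : ES N → ℝ} (h : Van Ω S u) (c : ℝ) :
    LBd Ω S (fun x => -(c * u x)) := by
  intro ξ hξ hS ε hε
  have h1 : Tendsto (fun x => -(c * u x)) (𝓝[Ω] ξ) (𝓝 (-(c * 0))) := ((h ξ hξ hS).const_mul c).neg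
  rw [mul_zero, neg_zero] at h1
  exact h1.eventually (lt_mem_nhds (by linarith))

lemma LBd.of_nonneg {S : Set (ES N)} {u : ES N → ℝ} (h : ∀ x ∈ Ω, x ∈ S → 0 ≤ u x) (hS : IsOpen S) :
    LBd Ω S u := by
  intro ξ _ hξS ε hε
  filter_upwards [self_mem_nhdsWithin, mem_nhdsWithin_of_mem_nhds (hS.mem_nhds hξS)] with x hx hxS
  linarith [h x hx hxS]

lemma LBd.add {S : Set (ES N)} {u v : ES N → ℝ} (h : LBd Ω S u) (h' : LBd Ω S v) :
    LBd Ω S (fun x => u x + v x) := by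
  intro ξ hξ hS ε hε
  filter_upwards [h ξ hξ hS (ε / 2) (by positivity), h' ξ hξ hS (ε / 2) (by positivity)] with x h1 h2
  linarith

lemma frontier_inter_open {D B : Set (ES N)} (hB : IsOpen B) {ξ : ES N}
    (hξ : ξ ∈ frontier (D ∩ B)) (hb : ξ ∈ B) : ξ ∈ frontier D := by
  refine ⟨closure_mono inter_subset_left hξ.1, fun hc => hξ.2 ?_⟩
  rw [interior_inter, hB.interior_eq]
  exact ⟨hc, hb⟩

namespace Chart
variable {L R : ℝ} {p e : ES N} {F : ES N → ℝ}

lemma L0 (h : Chart Ω L R p e F) : 0 < L := by linarith [h.L1]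

lemma dist_up (h : Chart Ω L R p e F) (x : ES N) {τ : ℝ} (hτ : 0 ≤ τ) : dist (x + τ • e) x = τ := by
  rw [dist_eq_norm]; simp [norm_smul, h.he, abs_of_nonneg hτ]

lemma dist_down (h : Chart Ω L R p e F) (x : ES N) {τ : ℝ} (hτ : 0 ≤ τ) :
    dist (x - τ • e) x = τ := by
  rw [dist_eq_norm]; simp [norm_smul, h.he, abs_of_nonneg hτ]

lemma lin' (h : Chart Ω L R p e F) (x : ES N) (τ : ℝ) : F (x - τ • e) = F x - τ := by
  rw [sub_eq_add_neg, ← neg_smul, h.lin]; ring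

lemma F_ge (h : Chart Ω L R p e F) (x y : ES N) : F x - L * dist y x ≤ F y := by
  have := (abs_le.1 (h.lip x y)).2
  rw [dist_comm] at this; linarith

lemma F_le (h : Chart Ω L R p e F) (x : ES N) : F x ≤ L * dist x p := by
  have := (abs_le.1 (h.lip x p)).2
  rw [h.zero] at this; linarith

lemma F_abs (h : Chart Ω L R p e F) (x : ES N) : |F x| ≤ L * dist x p := by
  have := h.lip x p
  rwa [h.zero, sub_zero] at this

lemma restrict (h : Chart Ω L R p e F) {p' : ES N} {R' : ℝ} (hR' : 0 < R') (h0 : F p' = 0)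
    (hd : dist p' p + R' ≤ R) : Chart Ω L R' p' e F :=
  ⟨h.L1, hR', h.he, h.lin, h.lip, h0, fun x hx => h.mem x (by
    rw [mem_ball] at *; linarith [dist_triangle x p' p])⟩

lemma foot (h : Chart Ω L R p e F) (x : ES N) : F (x - F x • e) = 0 := by rw [h.lin']; ring

lemma ball_sub (h : Chart Ω L R p e F) {x : ES N} {s : ℝ} (hs : L * s ≤ F x)
    (hd : dist x p + s ≤ R) : ball x s ⊆ Ω := by
  intro y hy
  rw [mem_ball] at hy
  rw [h.mem y (by rw [mem_ball]; linarith [dist_triangle y x p])]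
  have h1 := h.F_ge x y
  have h2 : L * dist y x < L * s := mul_lt_mul_of_pos_left hy h.L0
  linarith

lemma frontier_zero (h : Chart Ω L R p e F) (ho : IsOpen Ω) {ξ : ES N} (hξ : ξ ∈ frontier Ω)
    (hb : dist ξ p < R) : F ξ = 0 := by
  have hFc : Continuous F := by
    refine (LipschitzWith.of_dist_le_mul (K := ⟨L, h.L0.le⟩) fun x y => ?_).continuous
    rw [Real.dist_eq]; exact h.lip x y
  refine le_antisymm ?_ ?_
  · by_contra hc
    push Not at hc
    have := (h.mem ξ hb).2 hc
    exact hξ.2 (by rwa [ho.interior_eq])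
  · by_contra hc
    push Not at hc
    have h1 : ∀ᶠ x in 𝓝 ξ, F x < 0 := hFc.continuousAt.eventually (gt_mem_nhds hc)
    have h2 : ∀ᶠ x in 𝓝 ξ, x ∈ ball p R := isOpen_ball.mem_nhds hb
    have h3 := mem_closure_iff_frequently.1 hξ.1
    obtain ⟨x, hx, hx1, hx2⟩ := (h3.and_eventually (h1.and h2)).exists
    have := (h.mem x hx2).1 hx
    linarith

lemma mem_frontier (h : Chart Ω L R p e F) (ho : IsOpen Ω) {ξ : ES N} (h0 : F ξ = 0)
    (hb : dist ξ p < R) : ξ ∈ frontier Ω := by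
  constructor
  · rw [Metric.mem_closure_iff]
    intro ε hε
    set τ := min (ε / 2) ((R - dist ξ p) / 2) with hτ
    have hτ0 : 0 < τ := by
      have : 0 < R - dist ξ p := by linarith
      positivity
    have h1 : τ ≤ ε / 2 := min_le_left _ _
    have h2 : τ ≤ (R - dist ξ p) / 2 := min_le_right _ _
    refine ⟨ξ + τ • e, ?_, ?_⟩
    · rw [h.mem]
      · rw [h.lin, h0]; linarith
      · rw [mem_ball]
        have := dist_triangle (ξ + τ • e) ξ p
        rw [h.dist_up ξ hτ0.le] at this
        linarith
    · rw [dist_comm, h.dist_up ξ hτ0.le]; linarith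
  · rw [ho.interior_eq, h.mem ξ hb]; linarith

end Chart

/-- Harnack chains along a segment. -/
lemma chain (hV : Pot Ω a V) : ∃ c : ℝ, 0 < c ∧ c ≤ 1 ∧
    ∀ (D : Set (ES N)) (_ : D ⊆ Ω) (_ : IsOpen D) (w : ES N → ℝ) (_ : Sp V D w)
      (_ : ∀ y ∈ D, 0 ≤ w y) (p p' : ES N) (t : ℝ) (n : ℕ) (_ : 0 < t) (_ : dist p p' ≤ n * t)
      (_ : ∀ s ∈ Icc (0:ℝ) 1, ball (p + s • (p' - p)) (16 * t) ⊆ D),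
      (∀ m, (∀ y ∈ ball p t, m ≤ w y) → ∀ z ∈ ball p' t, c ^ n * m ≤ w z) ∧
      (Sp V D (fun x => - w x) → c ^ (n + 1) * w p ≤ w p') := by
  obtain ⟨c, hc0, hc1, H⟩ := wh_step N a
  refine ⟨c, hc0, hc1, ?_⟩
  intro D hDΩ hD w hw h0 p p' t n ht hpp hseg
  have key : ∀ m, (∀ y ∈ ball p t, m ≤ w y) → ∀ z ∈ ball p' t, c ^ n * m ≤ w z := by
    intro m hm
    rcases Nat.eq_zero_or_pos n with hn | hn
    · subst hn
      have : dist p p' ≤ 0 := by simpa using hpp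
      have : p = p' := dist_le_zero.1 this
      subst this; simpa using hm
    have hn' : (0:ℝ) < n := by exact_mod_cast hn
    have ind : ∀ i : ℕ, i ≤ n → ∀ z ∈ ball (p + ((i:ℝ) / n) • (p' - p)) t, c ^ i * m ≤ w z := by
      intro i
      induction i with
      | zero => intro _; simpa using hm
      | succ i ih =>
        intro hi z hz
        have hi' : i ≤ n := by omega
        have hin : ((i:ℝ) / n) ∈ Icc (0:ℝ) 1 :=
          ⟨by positivity, by rw [div_le_one hn']; exact_mod_cast hi'⟩
        have hb := hseg _ hin
        have hb8 : ball (p + ((i:ℝ) / n) • (p' - p)) (8 * t) ⊆ D :=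
          (ball_subset_ball (by linarith)).trans hb
        have h1 := (H Ω D V hV hDΩ hD w hw (p + ((i:ℝ) / n) • (p' - p)) t ht (hb.trans hDΩ) hb8
          (fun y hy => h0 y (hb8 hy))).1 (c ^ i * m) (ih hi') z (by
            have e : dist (p + (((i + 1 : ℕ):ℝ) / n) • (p' - p)) (p + ((i:ℝ) / n) • (p' - p)) ≤ t := by
              rw [dist_eq_norm, add_sub_add_left_eq_sub, ← sub_smul, norm_smul]
              have : ((i + 1 : ℕ):ℝ) / n - (i:ℝ) / n = 1 / n := by push_cast; field_simp; ring
              rw [this, Real.norm_of_nonneg (by positivity), ← dist_eq_norm, dist_comm]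
              rw [one_div, inv_mul_le_iff₀ hn']; exact hpp
            rw [mem_ball] at hz
            linarith [dist_triangle z (p + (((i + 1 : ℕ):ℝ) / n) • (p' - p))
              (p + ((i:ℝ) / n) • (p' - p))])
        rw [pow_succ]; linarith
    have := ind n le_rfl
    rw [div_self hn'.ne', one_smul, add_sub_cancel] at this
    exact this
  refine ⟨key, fun hs => ?_⟩
  have hb := hseg 0 (by simp)
  rw [zero_smul, add_zero] at hb
  have hb8 : ball p (8 * t) ⊆ D := (ball_subset_ball (by linarith)).trans hb
  have h1 := (H Ω D V hV hDΩ hD w hw p t ht (hb.trans hDΩ) hb8 (fun y hy => h0 y (hb8 hy))).2 hs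
  have h2 := key (c * w p) (fun y hy => h1 y (by rw [mem_ball] at hy; linarith)) p' (mem_ball_self ht)
  rw [pow_succ]; linarith

/-- Connection lemma inside a chart. -/
lemma conn (hV : Pot Ω a V) (L : ℝ) (hL : 1 ≤ L) (M ε : ℝ) (hM : 1 ≤ M) (hε0 : 0 < ε) (hε1 : ε ≤ 1) :
    ∃ c : ℝ, 0 < c ∧ c ≤ 1 ∧
    ∀ (R : ℝ) (y e : ES N) (F : ES N → ℝ) (_ : Chart Ω L R y e F) (D : Set (ES N)) (_ : D ⊆ Ω)
      (_ : IsOpen D) (w : ES N → ℝ) (_ : Sp V D w) (_ : ∀ y ∈ D, 0 ≤ w y) (r : ℝ) (_ : 0 < r)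
      (_ : ∀ x, ε / 2 * r ≤ F x → dist x y < (4 * L * M) * r → x ∈ D) (x x' : ES N)
      (_ : ε * r ≤ F x) (_ : ε * r ≤ F x') (_ : dist x y ≤ M * r) (_ : dist x' y ≤ M * r),
      (∀ m, (∀ z ∈ ball x (ε / (32 * L) * r), m ≤ w z) →
        ∀ z ∈ ball x' (ε / (32 * L) * r), c * m ≤ w z) ∧
      (Sp V D (fun x => - w x) → c * w x ≤ w x') := by
  obtain ⟨c, hc0, hc1, H⟩ := chain hV
  have hL0 : 0 < L := by linarith
  set n : ℕ := ⌈64 * L ^ 2 * M / ε⌉₊ with hn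
  have hn1 : 64 * L ^ 2 * M / ε ≤ n := Nat.le_ceil _
  refine ⟨c ^ (n + 1) * (c ^ (n + 1) * c ^ (n + 1)), by positivity,
    mul_le_one₀ (pow_le_one₀ hc0.le hc1) (by positivity)
      (mul_le_one₀ (pow_le_one₀ hc0.le hc1) (by positivity) (pow_le_one₀ hc0.le hc1)), ?_⟩
  intro R y e F hch D hDΩ hD w hw h0 r hr hDsub x x' hFx hFx' hdx hdx'
  set t := ε / (32 * L) * r with ht
  have ht0 : 0 < t := by positivity
  have hLM : 1 ≤ L * M := by nlinarith
  have h16 : 16 * t * L = ε / 2 * r := by rw [ht]; field_simp; ring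
  have h16' : 16 * t ≤ r / 2 := by
    have : 16 * t ≤ 16 * t * L := by nlinarith
    nlinarith
  have hnt : 2 * L * M * r ≤ n * t := by
    have : 64 * L ^ 2 * M / ε * t = 2 * L * M * r := by rw [ht]; field_simp; ring
    rw [← this]; gcongr
  -- good points
  have good : ∀ z, ε * r ≤ F z → dist z y ≤ (3 * L * M) * r → ball z (16 * t) ⊆ D := by
    intro z hz hzd b hb
    rw [mem_ball] at hb
    refine hDsub b ?_ ?_
    · have h1 := hch.F_ge z b
      have h2 : L * dist b z ≤ L * (16 * t) := by gcongr
      linarith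
    · have h1 := dist_triangle b z y
      have : r ≤ L * M * r := by nlinarith
      linarith
  set T := 2 * L * M * r with hT
  have hT0 : 0 < T := by positivity
  have hMr : M * r ≤ L * M * r := by nlinarith
  have up : ∀ z, ε * r ≤ F z → dist z y ≤ M * r → ∀ s ∈ Icc (0:ℝ) 1,
      ball (z + (s * T) • e) (16 * t) ⊆ D := by
    intro z hz hzd s hs
    have hsT : 0 ≤ s * T := mul_nonneg hs.1 hT0.le
    refine good _ (by rw [hch.lin]; linarith) ?_
    have := dist_triangle (z + (s * T) • e) z y
    rw [hch.dist_up z hsT] at this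
    have h2 : s * T ≤ T := by nlinarith [hs.2]
    linarith
  have seg1 : ∀ s ∈ Icc (0:ℝ) 1, ball (x + s • ((x + T • e) - x)) (16 * t) ⊆ D := by
    intro s hs
    have := up x hFx hdx s hs
    rwa [add_sub_cancel_left, smul_smul]
  have seg2 : ∀ s ∈ Icc (0:ℝ) 1, ball ((x + T • e) + s • ((x' + T • e) - (x + T • e))) (16 * t) ⊆ D := by
    intro s hs
    have e1 : (x + T • e) + s • ((x' + T • e) - (x + T • e)) = (x + s • (x' - x)) + T • e := by
      rw [add_sub_add_right_eq_sub]; abel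
    rw [e1]
    have hz : dist (x + s • (x' - x)) y ≤ M * r := by
      have hcv := (convex_closedBall y (M * r)).add_smul_sub_mem (x := x) (y := x')
        (mem_closedBall.2 hdx) (mem_closedBall.2 hdx') hs
      exact mem_closedBall.1 hcv
    refine good _ ?_ ?_
    · rw [hch.lin]
      have := (abs_le.1 (hch.F_abs (x + s • (x' - x)))).1
      have h2 : L * dist (x + s • (x' - x)) y ≤ L * (M * r) := by gcongr
      have h3 : ε * r ≤ L * M * r := by nlinarith
      linarith
    · have := dist_triangle (x + s • (x' - x) + T • e) (x + s • (x' - x)) y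
      rw [hch.dist_up _ hT0.le] at this
      linarith
  have seg3 : ∀ s ∈ Icc (0:ℝ) 1, ball ((x' + T • e) + s • (x' - (x' + T • e))) (16 * t) ⊆ D := by
    intro s hs
    have := up x' hFx' hdx' (1 - s) ⟨by linarith [hs.2], by linarith [hs.1]⟩
    have e1 : (x' + T • e) + s • (x' - (x' + T • e)) = x' + ((1 - s) * T) • e := by
      rw [sub_add_cancel_left, smul_neg, smul_smul, sub_mul, one_mul, sub_smul]; abel
    rwa [e1]
  have d1 : dist x (x + T • e) ≤ n * t := by rw [dist_comm, hch.dist_up x hT0.le]; exact hnt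
  have d3 : dist (x' + T • e) x' ≤ n * t := by rw [hch.dist_up x' hT0.le]; exact hnt
  have d2 : dist (x + T • e) (x' + T • e) ≤ n * t := by
    rw [dist_add_right]
    have := dist_triangle_right x x' y
    linarith
  have c1 := H D hDΩ hD w hw h0 x (x + T • e) t n ht0 d1 seg1
  have c2 := H D hDΩ hD w hw h0 (x + T • e) (x' + T • e) t n ht0 d2 seg2
  have c3 := H D hDΩ hD w hw h0 (x' + T • e) x' t n ht0 d3 seg3
  have hx'D : ball x' (16 * t) ⊆ D := good x' hFx' (by nlinarith)
  constructor
  · intro m hm z hz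
    have k := c3.1 _ (c2.1 _ (c1.1 m hm)) z hz
    have hwz : 0 ≤ w z := h0 z (hx'D (ball_subset_ball (by linarith) hz))
    rcases le_or_gt 0 m with hm0 | hm0
    · refine le_trans ?_ k
      have hcn : c ^ (n + 1) ≤ c ^ n := pow_le_pow_of_le_one hc0.le hc1 (Nat.le_succ n)
      have hp : 0 < c ^ n := by positivity
      calc c ^ (n + 1) * (c ^ (n + 1) * c ^ (n + 1)) * m ≤ c ^ n * (c ^ n * c ^ n) * m := by gcongr
        _ = _ := by ring
    · refine le_trans ?_ hwz
      exact mul_nonpos_of_nonneg_of_nonpos (by positivity) hm0.le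
  · intro hs
    have k1 := c1.2 hs
    have k2 := c2.2 hs
    have k3 := c3.2 hs
    have hp : 0 ≤ c ^ (n + 1) := by positivity
    calc c ^ (n + 1) * (c ^ (n + 1) * c ^ (n + 1)) * w x
        = c ^ (n + 1) * (c ^ (n + 1) * (c ^ (n + 1) * w x)) := by ring
      _ ≤ c ^ (n + 1) * (c ^ (n + 1) * w (x + T • e)) := by gcongr
      _ ≤ c ^ (n + 1) * w (x' + T • e) := by gcongr
      _ ≤ _ := k3

/-- Boundary decay. -/
lemma bdecay (hN : 0 < N) (hV : Pot Ω a V) (L : ℝ) (hL : 1 ≤ L) : ∃ η : ℝ, 0 < η ∧ η < 1 ∧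
    ∀ (R : ℝ) (p e : ES N) (F : ES N → ℝ) (_ : Chart Ω L R p e F) (s : ℝ) (_ : 0 < s) (_ : s ≤ R)
      (u : ES N → ℝ) (_ : Sp V (Ω ∩ ball p s) (fun x => - u x)) (_ : Van Ω (ball p s) u)
      (M : ℝ) (_ : 0 ≤ M) (_ : ∀ x ∈ Ω, dist x p < s → u x ≤ M) (J : ℕ),
      ∀ x ∈ Ω, dist x p < s / 8 ^ J → u x ≤ (1 - η) ^ J * M := by
  have hL0 : 0 < L := by linarith
  obtain ⟨η, hη0, hη1, H⟩ := decay hN (1 / (3 * L)) (by positivity)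
  refine ⟨η, hη0, hη1, ?_⟩
  intro R p e F hch s hs hsR u hu hvan M hM hb J
  induction J with
  | zero => simpa using hb
  | succ J ih =>
    intro x hx hxp
    set s' := s / 8 ^ J with hs'
    have hs'0 : 0 < s' := by positivity
    have hs's : s' ≤ s := div_le_self hs.le (one_le_pow₀ (by norm_num))
    have hxp' : dist x p < s' / 8 := by
      have : s / 8 ^ (J + 1) = s' / 8 := by rw [hs', pow_succ]; field_simp
      rwa [this] at hxp
    set q := p - (s' / 4) • e with hq
    have hqp : dist q p = s' / 4 := hch.dist_down p (by positivity)
    have hFq : F q = -(s' / 4) := by rw [hq, hch.lin', hch.zero]; ring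
    have hsub : Ω ∩ ball p s' ⊆ Ω ∩ ball p s := inter_subset_inter_right _ (ball_subset_ball hs's)
    have k := H Ω (Ω ∩ ball p s') a V hV inter_subset_left (hV.opn.inter isOpen_ball)
      (fun x => -u x) (hu.mono hsub) q (3 / 4 * s') ((1 - η) ^ J * M) (by positivity)
      (mul_nonneg (pow_nonneg (by linarith) _) hM) ?_ ?_ ?_ x ⟨hx, mem_ball.2 (by linarith)⟩ ?_
    · rw [pow_succ]; linarith
    · rintro y ⟨hyΩ, hy⟩
      have h1 : 0 < F y := (hch.mem y (ball_subset_ball (hs's.trans hsR) hy)).1 hyΩ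
      have h2 := (abs_le.1 (hch.lip y q)).2
      rw [hFq] at h2
      have h3 : s' / 4 ≤ L * dist y q := by linarith
      have : 1 / (3 * L) * (3 / 4 * s') = (s' / 4) / L := by field_simp
      rw [this, div_le_iff₀ hL0]; linarith
    · rintro y ⟨hyΩ, hy⟩ _
      have := ih y hyΩ hy
      linarith
    · intro ξ hξ hξq ε hε
      have hξp : ξ ∈ ball p s' := by
        rw [mem_ball]; linarith [dist_triangle ξ q p]
      have hξΩ := frontier_inter_open isOpen_ball hξ hξp
      have h1 := (hvan ξ hξΩ (ball_subset_ball hs's hξp)).eventually (gt_mem_nhds hε)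
      have h2 := h1.filter_mono (nhdsWithin_mono ξ (inter_subset_left : Ω ∩ ball p s' ⊆ Ω))
      filter_upwards [h2] with y hy
      linarith
    · linarith [dist_triangle x p q, dist_comm p q]

/-- Boundedness near the boundary. -/
lemma bdd_near {S : Set (ES N)} (hS : IsCompact S) (ho : IsOpen Ω) {u : ES N → ℝ}
    (hu : ContinuousOn u (Ω ∩ S)) (hSo : ∀ x ∈ Ω ∩ S, ContinuousAt u x) (hvan : Van Ω S u) :
    ∃ M : ℝ, ∀ x ∈ Ω ∩ S, |u x| ≤ M := by
  have key : ∃ M : ℝ, ∀ x ∈ S, x ∈ Ω → |u x| ≤ M := by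
    refine hS.induction_on (p := fun s => ∃ B : ℝ, ∀ x ∈ s, x ∈ Ω → |u x| ≤ B) ⟨0, by simp⟩ ?_ ?_ ?_
    · rintro s t hst ⟨B, hB⟩; exact ⟨B, fun x hx => hB x (hst hx)⟩
    · rintro s t ⟨B, hB⟩ ⟨B', hB'⟩
      refine ⟨max B B', fun x hx hxΩ => ?_⟩
      rcases hx with hx | hx
      · exact (hB x hx hxΩ).trans (le_max_left _ _)
      · exact (hB' x hx hxΩ).trans (le_max_right _ _)
    · intro x hx
      by_cases hxΩ : x ∈ Ω
      · have hc := (hSo x ⟨hxΩ, hx⟩).abs.eventually (gt_mem_nhds (show |u x| < |u x| + 1 by linarith))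
        exact ⟨_, mem_nhdsWithin_of_mem_nhds hc, |u x| + 1, fun y hy _ => hy.le⟩
      · by_cases hxc : x ∈ closure Ω
        · have hxf : x ∈ frontier Ω := ⟨hxc, by rwa [ho.interior_eq]⟩
          have h1 := (hvan x hxf hx).abs.eventually (gt_mem_nhds (show |(0:ℝ)| < 1 by simp))
          rw [eventually_nhdsWithin_iff] at h1
          exact ⟨_, mem_nhdsWithin_of_mem_nhds h1, 1, fun y hy hyΩ => (hy hyΩ).le⟩
        · refine ⟨(closure Ω)ᶜ, mem_nhdsWithin_of_mem_nhds
            (isClosed_closure.isOpen_compl.mem_nhds hxc), 0, fun y hy hyΩ => ?_⟩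
          exact absurd (subset_closure hyΩ) hy
  obtain ⟨M, hM⟩ := key
  exact ⟨M, fun x hx => hM x hx.2 hx.1⟩

/-- Halving lemma. -/
lemma halve {α : Type*} {S : Set α} {g : α → ℝ} {A : ℝ} (hA : 0 ≤ A)
    (hb : ∃ M, ∀ x ∈ S, g x ≤ M)
    (h : ∀ M, 0 ≤ M → (∀ x ∈ S, g x ≤ M) → ∀ x ∈ S, g x ≤ max A (M / 2)) : ∀ x ∈ S, g x ≤ A := by
  intro x hx
  obtain ⟨M, hM⟩ := hb
  set s := sSup (g '' S) with hs
  have hbdd : BddAbove (g '' S) := ⟨M, by rintro _ ⟨y, hy, rfl⟩; exact hM y hy⟩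
  have hle : ∀ y ∈ S, g y ≤ s := fun y hy => le_csSup hbdd (mem_image_of_mem g hy)
  have h1 := h (max s 0) (le_max_right _ _) (fun y hy => (hle y hy).trans (le_max_left _ _))
  have h2 : s ≤ max A (max s 0 / 2) :=
    csSup_le ⟨g x, mem_image_of_mem g hx⟩ (by rintro _ ⟨y, hy, rfl⟩; exact h1 y hy)
  refine (hle x hx).trans ?_
  rcases le_total s 0 with h0 | h0
  · linarith
  · rw [max_eq_left h0] at h2
    rcases le_max_iff.1 h2 with h3 | h3
    · exact h3
    · linarith

end


section

variable {N : ℕ} {Ω : Set (ES N)} {a : ℝ} {V : ES N → ℝ}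

lemma seg_eq (x e : ES N) (T s : ℝ) : (x + T • e) + s • (x - (x + T • e)) = x + ((1 - s) * T) • e := by
  rw [sub_add_cancel_left, smul_neg, smul_smul, sub_mul, one_mul, sub_smul]; abel

lemma seg_eq' (x e : ES N) (T s : ℝ) : x + s • ((x + T • e) - x) = x + (s * T) • e := by
  rw [add_sub_cancel_left, smul_smul]

/-- one step of Lemma L -/
lemma lemL_step (hN : 0 < N) (hV : Pot Ω a V) (L : ℝ) (hL : 1 ≤ L) : ∃ β a' : ℝ, 0 < β ∧ β ≤ 1 / 24 ∧
    0 < a' ∧ a' ≤ 1 ∧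
    ∀ (R : ℝ) (p e : ES N) (F : ES N → ℝ) (_ : Chart Ω L R p e F) (s : ℝ) (_ : 0 < s) (_ : s ≤ R)
      (w : ES N → ℝ) (_ : Sp V (Ω ∩ ball p s) w) (_ : LBd Ω (ball p s) w)
      (m : ℝ) (_ : 0 ≤ m) (_ : ∀ x ∈ Ω, dist x p < s → -m ≤ w x)
      (_ : ∀ x, β * s ≤ F x → dist x p < s → m ≤ w x),
      (∀ x ∈ Ω, dist x p < s / 2 → -(a' * m) ≤ w x) ∧
      (∀ x, β * (s / 2) ≤ F x → dist x p < s / 2 → a' * m ≤ w x) := by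
  have hL0 : 0 < L := by linarith
  obtain ⟨η, hη0, hη1, HD⟩ := decay hN (1 / (4 * L)) (by positivity)
  obtain ⟨c, hc0, hc1, HC⟩ := chain hV
  set n : ℕ := ⌈64 * L⌉₊ with hn
  have hn1 : 64 * L ≤ n := Nat.le_ceil _
  obtain ⟨j, hj⟩ := exists_pow_lt_of_lt_one (show 0 < c ^ n / 2 by positivity)
    (show 1 - η < 1 by linarith)
  -- replace j by j+1
  have hj' : (1 - η) ^ (j + 1) ≤ c ^ n / 2 := by
    refine le_trans ?_ hj.le
    rw [pow_succ]
    exact mul_le_of_le_one_right (pow_nonneg (by linarith) _) (by linarith)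
  set J := j + 1 with hJ
  set a' := (1 - η) ^ J with ha'
  have ha0 : 0 < a' := pow_pos (by linarith) _
  have ha1 : a' ≤ 1 := pow_le_one₀ (by linarith) (by linarith)
  have hJ1 : (1:ℝ) ≤ J := by rw [hJ]; push_cast; linarith [(Nat.cast_nonneg j : (0:ℝ) ≤ j)]
  set β : ℝ := 1 / (24 * J) with hβ
  have hβJ : 6 * J * β = 1 / 4 := by rw [hβ]; field_simp; norm_num
  have hβ0 : 0 < β := by positivity
  have hβ1 : β ≤ 1 / 24 := by nlinarith
  refine ⟨β, a', hβ0, hβ1, ha0, ha1, ?_⟩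
  intro R p e F hch s hs hsR w hw hbd m hm hlow hup
  have hβs : 0 < β * s := by positivity
  have i1 : ∀ i : ℕ, i ≤ J → ∀ x ∈ Ω, dist x p < s - 6 * i * (β * s) → -((1 - η) ^ i * m) ≤ w x := by
    intro i
    induction i with
    | zero => intro _ x hx hd; simpa using hlow x hx (by simpa using hd)
    | succ i ih =>
      intro hi x hx hd
      push_cast at hd
      have ih' := ih (by omega)
      set s' := s - 6 * i * (β * s) with hs'
      have hs's : s' ≤ s := by
        have : 0 ≤ 6 * i * (β * s) := by positivity
        linarith
      rcases le_or_gt (β * s) (F x) with hF | hF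
      · have h1 := hup x hF (by nlinarith)
        have : 0 ≤ (1 - η) ^ (i + 1) * m := mul_nonneg (pow_nonneg (by linarith) _) hm
        linarith
      have hFx : 0 < F x := (hch.mem x (mem_ball.2 (by linarith))).1 hx
      set q := x - (F x + β * s) • e with hq
      have hqx : dist q x = F x + β * s := hch.dist_down x (by linarith)
      have hFq : F q = -(β * s) := by rw [hq, hch.lin']; ring
      have hsub : Ω ∩ ball p s' ⊆ Ω ∩ ball p s := inter_subset_inter_right _ (ball_subset_ball hs's)
      have k := HD Ω (Ω ∩ ball p s') a V hV inter_subset_left (hV.opn.inter isOpen_ball)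
        w (hw.mono hsub) q (4 * (β * s)) ((1 - η) ^ i * m) (by positivity)
        (mul_nonneg (pow_nonneg (by linarith) _) hm) ?_ ?_ ?_ x ⟨hx, mem_ball.2 (by linarith)⟩ ?_
      · rw [pow_succ]; linarith
      · rintro y ⟨hyΩ, hy⟩
        have h1 : 0 < F y := (hch.mem y (ball_subset_ball (hs's.trans hsR) hy)).1 hyΩ
        have h2 := (abs_le.1 (hch.lip y q)).2
        rw [hFq] at h2
        have h3 : β * s ≤ L * dist y q := by linarith
        have : 1 / (4 * L) * (4 * (β * s)) = (β * s) / L := by field_simp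
        rw [this, div_le_iff₀ hL0]; linarith
      · rintro y ⟨hyΩ, hy⟩ _
        exact ih' y hyΩ hy
      · intro ξ hξ hξq ε hε
        have hξp : ξ ∈ ball p s' := by
          rw [mem_ball]; linarith [dist_triangle ξ q p, dist_triangle q x p]
        have hξΩ := frontier_inter_open isOpen_ball hξ hξp
        have h1 := hbd ξ hξΩ (ball_subset_ball hs's hξp) ε hε
        exact h1.filter_mono (nhdsWithin_mono ξ (inter_subset_left : Ω ∩ ball p s' ⊆ Ω))
      · rw [dist_comm]; linarith
  have i2 : ∀ x ∈ Ω, dist x p < 3 / 4 * s → -(a' * m) ≤ w x := by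
    intro x hx hd
    refine i1 J le_rfl x hx ?_
    have : 6 * J * (β * s) = 1 / 4 * s := by rw [← hβJ]; ring
    linarith
  refine ⟨fun x hx hd => i2 x hx (by linarith), ?_⟩
  intro x hF hd
  rcases le_or_gt (β * s) (F x) with hF1 | hF1
  · have := hup x hF1 (by linarith)
    nlinarith
  set D := Ω ∩ ball p (3 / 4 * s) with hD
  have hDs : D ⊆ Ω ∩ ball p s := inter_subset_inter_right _ (ball_subset_ball (by linarith))
  set t := β * s / (32 * L) with ht
  have ht0 : 0 < t := by positivity
  have hLt : L * t = β * s / 32 := by rw [ht]; field_simp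
  have htL : t ≤ L * t := by nlinarith
  have k := (HC D inter_subset_left (hV.opn.inter isOpen_ball) (fun x => w x + a' * m)
    ((hw.mono hDs).add hV (hV.opn.inter isOpen_ball) inter_subset_left
      (Sp.const hV inter_subset_left (by positivity))) ?_ (x + (2 * (β * s)) • e) x t n ht0 ?_ ?_).1
      m ?_ x (mem_ball_self ht0)
  · have : a' * m ≤ c ^ n / 2 * m := by gcongr
    linarith
  · rintro y ⟨hy, hy'⟩
    have := i2 y hy hy'
    linarith
  · rw [hch.dist_up x (by positivity)]
    have : 64 * L * t ≤ n * t := by gcongr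
    linarith
  · intro r hr y hy
    rw [seg_eq, mem_ball] at hy
    set b := (1 - r) * (2 * (β * s)) with hb
    have hb0 : 0 ≤ b := mul_nonneg (by linarith [hr.2]) (by positivity)
    have hb1 : b ≤ 2 * (β * s) := mul_le_of_le_one_left (by positivity) (by linarith [hr.1])
    have h1 := hch.dist_up x hb0
    have h2 := dist_triangle y (x + b • e) p
    have h3 := dist_triangle (x + b • e) x p
    have h4 : β * s ≤ 1 / 24 * s := by gcongr
    have h5 : dist y p < 3 / 4 * s := by linarith
    refine ⟨(hch.mem y (mem_ball.2 (by linarith))).2 ?_, h5⟩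
    have h6 := hch.F_ge (x + b • e) y
    rw [hch.lin] at h6
    have : L * dist y (x + b • e) < L * (16 * t) := by gcongr
    linarith
  · intro y hy
    rw [mem_ball] at hy
    have h1 := hch.dist_up x (show 0 ≤ 2 * (β * s) by positivity)
    have h2 := dist_triangle y (x + (2 * (β * s)) • e) p
    have h3 := dist_triangle (x + (2 * (β * s)) • e) x p
    have h4 : β * s ≤ 1 / 24 * s := by gcongr
    have h6 := hch.F_ge (x + (2 * (β * s)) • e) y
    rw [hch.lin] at h6
    have : L * dist y (x + (2 * (β * s)) • e) < L * t := by gcongr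
    have := hup y (by linarith) (by linarith)
    have : 0 ≤ a' * m := by positivity
    linarith

/-- Lemma L -/
lemma lemL (hN : 0 < N) (hV : Pot Ω a V) (L : ℝ) (hL : 1 ≤ L) : ∃ β : ℝ, 0 < β ∧ β ≤ 1 / 24 ∧
    ∀ (R : ℝ) (p e : ES N) (F : ES N → ℝ) (_ : Chart Ω L R p e F) (s : ℝ) (_ : 0 < s) (_ : s ≤ R)
      (w : ES N → ℝ) (_ : Sp V (Ω ∩ ball p s) w) (_ : LBd Ω (ball p s) w)
      (m : ℝ) (_ : 0 ≤ m) (_ : ∀ x ∈ Ω, dist x p < s → -m ≤ w x)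
      (_ : ∀ x, β * s ≤ F x → dist x p < s → m ≤ w x),
      ∀ τ, 0 < τ → τ < s → 0 ≤ w (p + τ • e) := by
  obtain ⟨β, a', hβ0, hβ1, ha0, ha1, H⟩ := lemL_step hN hV L hL
  refine ⟨β, hβ0, hβ1, ?_⟩
  intro R p e F hch s hs hsR w hw hbd m hm hlow hup τ hτ0 hτs
  have key : ∀ k : ℕ, (∀ x ∈ Ω, dist x p < s / 2 ^ k → -(a' ^ k * m) ≤ w x) ∧
      (∀ x, β * (s / 2 ^ k) ≤ F x → dist x p < s / 2 ^ k → a' ^ k * m ≤ w x) := by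
    intro k
    induction k with
    | zero => simpa using ⟨hlow, hup⟩
    | succ k ih =>
      have hle : s / 2 ^ k ≤ s := div_le_self hs.le (one_le_pow₀ (by norm_num))
      have := H R p e F hch (s / 2 ^ k) (by positivity) (hle.trans hsR) w
        (hw.mono (inter_subset_inter_right _ (ball_subset_ball hle)))
        (hbd.mono (ball_subset_ball hle)) (a' ^ k * m) (by positivity) ih.1 ih.2
      rw [show s / 2 ^ (k + 1) = s / 2 ^ k / 2 by rw [pow_succ]; field_simp,
        show a' ^ (k + 1) * m = a' * (a' ^ k * m) by ring]
      exact this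
  have hex : ∃ k : ℕ, β * (s / 2 ^ k) ≤ τ := by
    obtain ⟨k, hk⟩ := exists_pow_lt_of_lt_one (show 0 < τ / (β * s) by positivity)
      (show (1:ℝ) / 2 < 1 by norm_num)
    refine ⟨k, ?_⟩
    rw [lt_div_iff₀ (by positivity), one_div, inv_pow] at hk
    calc β * (s / 2 ^ k) = (2 ^ k)⁻¹ * (β * s) := by rw [div_eq_mul_inv]; ring
      _ ≤ τ := hk.le
  classical
  have hk := Nat.find_spec hex
  have hk' : τ < s / 2 ^ (Nat.find hex) := by
    rcases Nat.eq_zero_or_pos (Nat.find hex) with h0 | h0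
    · rw [h0]; simpa using hτs
    · have h1 := Nat.find_min hex (m := Nat.find hex - 1) (by omega)
      push Not at h1
      have e : s / 2 ^ (Nat.find hex) = s / 2 ^ (Nat.find hex - 1) / 2 := by
        generalize Nat.find hex = k at h0
        obtain ⟨k, rfl⟩ : ∃ l, k = l + 1 := ⟨k - 1, by omega⟩
        rw [Nat.add_sub_cancel, pow_succ]; field_simp
      rw [e]
      have : 0 < s / 2 ^ (Nat.find hex - 1) := by positivity
      nlinarith
  have := (key (Nat.find hex)).2 (p + τ • e) (by rw [hch.lin, hch.zero]; linarith)
    (by rw [hch.dist_up p hτ0.le]; exact hk')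
  exact le_trans (by positivity) this

end


section

variable {N : ℕ} {Ω : Set (ES N)} {a : ℝ} {V : ES N → ℝ}

/-- Carleson, step a -/
lemma carl_a (hV : Pot Ω a V) (L : ℝ) (hL : 1 ≤ L) : ∃ C : ℝ, 1 ≤ C ∧
    ∀ (R : ℝ) (y e : ES N) (F : ES N → ℝ) (_ : Chart Ω L R y e F) (r : ℝ) (_ : 0 < r)
      (_ : 24 * L * r ≤ R) (u : ES N → ℝ) (_ : Sp V (Ω ∩ ball y (24 * L * r)) u)
      (_ : Sp V (Ω ∩ ball y (24 * L * r)) (fun x => -u x))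
      (_ : ∀ x ∈ Ω, dist x y < 24 * L * r → 0 ≤ u x) (k : ℕ),
      ∀ x, r / 2 ^ k ≤ F x → dist x y ≤ 4 * r + min (F x) (2 * r) → u x ≤ C ^ (k + 1) * u (y + r • e) := by
  have hL0 : 0 < L := by linarith
  obtain ⟨c, hc0, hc1, HC⟩ := chain hV
  obtain ⟨c', hc'0, hc'1, HX⟩ := conn hV L hL 6 1 (by norm_num) one_pos le_rfl
  set n : ℕ := ⌈32 * L⌉₊ with hn
  have hn1 : 32 * L ≤ n := Nat.le_ceil _
  set b := c ^ (n + 1) * c' with hb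
  have hp0 : 0 < c ^ (n + 1) := by positivity
  have hp1 : c ^ (n + 1) ≤ 1 := pow_le_one₀ hc0.le hc1
  have hb0 : 0 < b := by positivity
  have hb1 : b ≤ 1 := mul_le_one₀ hp1 hc'0.le hc'1
  have hbc : b ≤ c ^ (n + 1) := mul_le_of_le_one_right hp0.le hc'1
  have hbc' : b ≤ c' := mul_le_of_le_one_left hc'0.le hp1
  refine ⟨b⁻¹, (one_le_inv₀ hb0).2 hb1, ?_⟩
  intro R y e F hch r hr hrR u hu hu' h0
  set D := Ω ∩ ball y (24 * L * r) with hD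
  have hDo : IsOpen D := hV.opn.inter isOpen_ball
  have hDm : ∀ x, 0 < F x → dist x y < 24 * L * r → x ∈ D := fun x h1 h2 =>
    ⟨(hch.mem x (mem_ball.2 (by linarith))).2 h1, h2⟩
  have hLr : r ≤ L * r := by nlinarith
  have h0A : 0 ≤ u (y + r • e) := by
    have h := hDm (y + r • e) (by rw [hch.lin, hch.zero]; linarith)
      (by rw [hch.dist_up y hr.le]; linarith)
    exact h0 _ h.1 h.2
  have base : ∀ x, r ≤ F x → dist x y ≤ 6 * r → u x ≤ b⁻¹ * u (y + r • e) := by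
    intro x hF hd
    have := (HX R y e F hch D inter_subset_left hDo u hu (fun z hz => h0 z hz.1 hz.2) r hr
      (fun z hz hz' => hDm z (by linarith) (by linarith)) x (y + r • e) (by linarith)
      (by rw [hch.lin, hch.zero]; linarith) hd (by rw [hch.dist_up y hr.le]; linarith)).2 hu'
    have hx := hDm x (by linarith) (by linarith)
    have hx0 := h0 x hx.1 hx.2
    rw [← div_eq_inv_mul, le_div_iff₀ hb0]
    nlinarith
  have hinv : 1 ≤ b⁻¹ := (one_le_inv₀ hb0).2 hb1
  intro k
  induction k with
  | zero =>
    intro x hF hd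
    rw [zero_add, pow_one]
    exact base x (by simpa using hF) (by linarith [min_le_right (F x) (2 * r)])
  | succ k ih =>
    intro x hF hd
    have hstep : ∀ j : ℕ, b⁻¹ * u (y + r • e) ≤ b⁻¹ ^ (j + 1) * u (y + r • e) := fun j => by
      rw [pow_succ, mul_assoc]
      exact le_mul_of_one_le_left (by positivity) (one_le_pow₀ hinv)
    rcases le_or_gt r (F x) with h1 | h1
    · exact (base x h1 (by linarith [min_le_right (F x) (2 * r)])).trans (hstep _)
    rw [min_eq_left (by linarith)] at hd
    have hF0 : 0 < F x := lt_of_lt_of_le (by positivity) hF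
    have hup := hch.dist_up x hF0.le
    have hFup : F (x + F x • e) = 2 * F x := by rw [hch.lin]; ring
    have k1 := ih (x + F x • e) (by
        rw [hFup]
        have : r / 2 ^ (k + 1) = r / 2 ^ k / 2 := by rw [pow_succ]; field_simp
        linarith) (by
        rw [hFup, min_eq_left (by linarith)]
        linarith [dist_triangle (x + F x • e) x y])
    set t := F x / (32 * L) with ht
    have ht0 : 0 < t := by positivity
    have hLt : L * t = F x / 32 := by rw [ht]; field_simp
    have htL : t ≤ L * t := by nlinarith
    have k2 := (HC D inter_subset_left hDo u hu (fun z hz => h0 z hz.1 hz.2) x (x + F x • e) t n ht0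
      (by
        rw [dist_comm, hup]
        have : 32 * L * t ≤ n * t := by gcongr
        linarith) (by
        intro s hs z hz
        rw [seg_eq', mem_ball] at hz
        have hb0 : 0 ≤ s * F x := mul_nonneg hs.1 hF0.le
        have hb1 : s * F x ≤ F x := mul_le_of_le_one_left hF0.le hs.2
        have h1 := hch.dist_up x hb0
        have h2 := dist_triangle z (x + (s * F x) • e) y
        have h3 := dist_triangle (x + (s * F x) • e) x y
        have h6 := hch.F_ge (x + (s * F x) • e) z
        rw [hch.lin] at h6
        have : L * dist z (x + (s * F x) • e) < L * (16 * t) := by gcongr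
        exact hDm z (by linarith) (by linarith))).2 hu'
    have hx := hDm x (by linarith) (by linarith)
    have hx0 := h0 x hx.1 hx.2
    have k3 : u x ≤ b⁻¹ * u (x + F x • e) := by
      rw [← div_eq_inv_mul, le_div_iff₀ hb0]
      nlinarith
    rw [pow_succ', mul_assoc]
    exact k3.trans (by gcongr)

/-- Carleson estimate -/
lemma carleson (hN : 0 < N) (hV : Pot Ω a V) (L : ℝ) (hL : 1 ≤ L) : ∃ C : ℝ, 1 ≤ C ∧
    ∀ (R : ℝ) (y e : ES N) (F : ES N → ℝ) (_ : Chart Ω L R y e F) (r : ℝ) (_ : 0 < r)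
      (_ : 24 * L * r ≤ R) (u : ES N → ℝ) (_ : Sp V (Ω ∩ ball y (24 * L * r)) u)
      (_ : Sp V (Ω ∩ ball y (24 * L * r)) (fun x => -u x))
      (_ : ∀ x ∈ Ω, dist x y < 24 * L * r → 0 ≤ u x) (_ : Van Ω (ball y (24 * L * r)) u),
      ∀ x ∈ Ω, dist x y < r → u x ≤ C * u (y + r • e) := by
  have hL0 : 0 < L := by linarith
  obtain ⟨C0, hC0, HA⟩ := carl_a hV L hL
  obtain ⟨η, hη0, hη1, HB⟩ := bdecay hN hV L hL
  obtain ⟨γ, hγ⟩ := pow_unbounded_of_one_lt C0 (show (1:ℝ) < 2 by norm_num)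
  obtain ⟨J, hJ⟩ := exists_pow_lt_of_lt_one (show (0:ℝ) < 1 / 2 / 2 ^ γ by positivity)
    (show 1 - η < 1 by linarith)
  have hJ' : (1 - η) ^ J * 2 ^ γ ≤ 1 / 2 := by
    rw [lt_div_iff₀ (by positivity)] at hJ; exact hJ.le
  set i : ℕ := 3 * J + 2 with hi
  have hC00 : 0 < C0 := by linarith
  refine ⟨C0 ^ (i + 1) * 2 ^ γ, one_le_mul_of_one_le_of_one_le (one_le_pow₀ hC0)
    (one_le_pow₀ (by norm_num)), ?_⟩
  intro R y e F hch r hr hrR u hu hu' h0 hvan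
  have hLr : r ≤ L * r := by nlinarith
  set D := Ω ∩ ball y (24 * L * r) with hD
  have hDo : IsOpen D := hV.opn.inter isOpen_ball
  have h0A : 0 ≤ u (y + r • e) := by
    refine h0 _ ((hch.mem _ (mem_ball.2 ?_)).2 ?_) ?_
    · rw [hch.dist_up y hr.le]; linarith
    · rw [hch.lin, hch.zero]; linarith
    · rw [hch.dist_up y hr.le]; linarith
  set g : ES N → ℝ := fun x => u x * ((2 * r - dist x y) / r) ^ γ with hg
  set S := Ω ∩ ball y (2 * r) with hS
  have main : ∀ x ∈ S, g x ≤ C0 ^ (i + 1) * 2 ^ γ * u (y + r • e) := by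
    refine halve (by positivity) ?_ ?_
    · obtain ⟨M, hM⟩ := bdd_near (isCompact_closedBall y (2 * r)) hV.opn (u := u)
        (hu.1.mono (inter_subset_inter_right _ (fun z hz => by
          rw [mem_closedBall] at hz; rw [mem_ball]; linarith)))
        (fun z hz => hu.1.continuousAt (hDo.mem_nhds ⟨hz.1, by
          have := hz.2; rw [mem_closedBall] at this; rw [mem_ball]; linarith⟩))
        (hvan.mono (fun z hz => by rw [mem_closedBall] at hz; rw [mem_ball]; linarith))
      refine ⟨M * 2 ^ γ, fun x hx => ?_⟩
      have h1 := hM x ⟨hx.1, ball_subset_closedBall hx.2⟩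
      have h2 : dist x y < 2 * r := hx.2
      have h3 : (2 * r - dist x y) / r ≤ 2 := by
        rw [div_le_iff₀ hr]; linarith [dist_nonneg (x := x) (y := y)]
      have h4 : 0 ≤ (2 * r - dist x y) / r := div_nonneg (by linarith) hr.le
      simp only [hg]
      have : 0 ≤ M := (abs_nonneg _).trans h1
      exact mul_le_mul ((le_abs_self _).trans h1) (pow_le_pow_left₀ h4 h3 _) (by positivity) this
    · intro M hM hMS x hx
      have hx2 : dist x y < 2 * r := hx.2
      set d := 2 * r - dist x y with hd
      have hd0 : 0 < d := by linarith
      have hd2 : d ≤ 2 * r := by linarith [dist_nonneg (x := x) (y := y)]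
      have hFx : 0 < F x := (hch.mem x (mem_ball.2 (by linarith))).1 hx.1
      rcases le_or_gt (d / 2 ^ i) (F x) with hF | hF
      · refine le_max_of_le_left ?_
        obtain ⟨j, hj1, hj2⟩ := exists_nat_pow_near_of_lt_one (show 0 < d / (2 * r) by positivity)
          ((div_le_one (by positivity)).2 hd2) (show (0:ℝ) < 1 / 2 by norm_num) (by norm_num)
        rw [lt_div_iff₀ (by positivity), pow_succ] at hj1
        have hj1' : r / 2 ^ j ≤ d := by
          rw [div_eq_mul_inv, ← inv_pow, ← one_div]; linarith
        have k1 := HA R y e F hch r hr hrR u hu hu' h0 (i + j) x (by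
          refine le_trans ?_ hF
          rw [pow_add, mul_comm, ← div_div]; gcongr) (by
          have : 0 ≤ min (F x) (2 * r) := le_min hFx.le (by positivity)
          linarith)
        have h3 : d / r ≤ 2 * (1 / 2) ^ j := by
          rw [div_le_iff₀ (by positivity)] at hj2 ⊢; linarith
        calc g x ≤ (C0 ^ (i + j + 1) * u (y + r • e)) * (2 * (1 / 2) ^ j) ^ γ := by
              simp only [hg]
              gcongr
          _ = C0 ^ (i + 1) * 2 ^ γ * u (y + r • e) * (C0 / 2 ^ γ) ^ j := by
              have e2 : (2 * (1 / 2 : ℝ) ^ j) ^ γ = 2 ^ γ * ((2 ^ γ) ^ j)⁻¹ := by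
                rw [mul_pow, one_div, inv_pow, inv_pow, ← pow_mul, ← pow_mul, mul_comm j γ]
              rw [e2, div_pow, show i + j + 1 = (i + 1) + j by ring, pow_add, div_eq_mul_inv]
              ring
          _ ≤ C0 ^ (i + 1) * 2 ^ γ * u (y + r • e) * 1 := by
              refine mul_le_mul_of_nonneg_left ?_ (by positivity)
              exact pow_le_one₀ (by positivity) ((div_le_one (by positivity)).2 hγ.le)
          _ = _ := mul_one _
      · refine le_max_of_le_right ?_
        set p := x - F x • e with hp
        have hpx : dist p x = F x := hch.dist_down x hFx.le
        have e1 : d / 2 ^ i = d / 4 / 8 ^ J := by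
          rw [hi, pow_add, pow_mul]; norm_num; field_simp
        rw [e1] at hF
        have hF4 : F x < d / 4 := hF.trans_le (div_le_self (by positivity) (one_le_pow₀ (by norm_num)))
        have hsub : ball p (d / 4) ⊆ ball x (d / 2) := by
          intro z hz; rw [mem_ball] at *; linarith [dist_triangle z p x]
        have hpy := dist_triangle p x y
        have hbd : ∀ z ∈ Ω, dist z p < d / 4 → u z ≤ M * (2 * r / d) ^ γ := by
          intro z hz hzp
          have hzx : dist z x < d / 2 := hsub hzp
          have hzy := dist_triangle z x y
          have h1 := hMS z ⟨hz, mem_ball.2 (by linarith)⟩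
          simp only [hg] at h1
          have h2 : d / 2 ≤ 2 * r - dist z y := by linarith
          have h3 : (d / 2 / r) ^ γ ≤ ((2 * r - dist z y) / r) ^ γ := by gcongr
          have hz0 : 0 ≤ u z := h0 z hz (by linarith)
          have h4 : u z * (d / 2 / r) ^ γ ≤ M := le_trans (by gcongr) h1
          rw [show 2 * r / d = (d / 2 / r)⁻¹ by field_simp, inv_pow, ← div_eq_mul_inv,
            le_div_iff₀ (by positivity)]
          exact h4
        have hsub2 : ball p (d / 4) ⊆ ball y (24 * L * r) := by
          intro z hz; rw [mem_ball] at *; linarith [dist_triangle z p y]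
        have k := HB (d / 4) p e F (hch.restrict (by positivity) (hch.foot x) (by linarith)) (d / 4)
          (by positivity) le_rfl u (hu'.mono (inter_subset_inter_right _ hsub2)) (hvan.mono hsub2)
          (M * (2 * r / d) ^ γ) (by positivity) hbd J x hx.1 (by rw [dist_comm, hpx]; exact hF)
        calc g x ≤ ((1 - η) ^ J * (M * (2 * r / d) ^ γ)) * (d / r) ^ γ := by
              simp only [hg]; gcongr
          _ = ((1 - η) ^ J * 2 ^ γ) * M := by
              rw [div_pow, div_pow, mul_pow]; field_simp
          _ ≤ 1 / 2 * M := by gcongr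
          _ = M / 2 := by ring
  intro x hx hxd
  have h1 := main x ⟨hx, mem_ball.2 (by linarith)⟩
  refine le_trans ?_ h1
  simp only [hg]
  refine le_mul_of_one_le_right (h0 x hx (by linarith)) (one_le_pow₀ ?_)
  rw [le_div_iff₀ hr]; linarith

end


section

variable {N : ℕ} {Ω : Set (ES N)} {a : ℝ} {V : ES N → ℝ}

/-- Boundary Harnack principle -/
lemma bhp (hN : 0 < N) (hV : Pot Ω a V) (L : ℝ) (hL : 1 ≤ L) : ∃ C : ℝ, 1 ≤ C ∧
    ∀ (R : ℝ) (y e : ES N) (F : ES N → ℝ) (_ : Chart Ω L R y e F) (r : ℝ) (_ : 0 < r)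
      (_ : 96 * L ^ 2 * r ≤ R) (u v : ES N → ℝ) (_ : Sp V (Ω ∩ ball y (96 * L ^ 2 * r)) u)
      (_ : Sp V (Ω ∩ ball y (96 * L ^ 2 * r)) (fun x => -u x))
      (_ : ∀ x ∈ Ω, dist x y < 96 * L ^ 2 * r → 0 ≤ u x) (_ : Van Ω (ball y (96 * L ^ 2 * r)) u)
      (_ : Sp V (Ω ∩ ball y (96 * L ^ 2 * r)) v)
      (_ : ∀ x ∈ Ω, dist x y < 96 * L ^ 2 * r → 0 ≤ v x) (m : ℝ) (_ : 0 ≤ m)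
      (_ : ∀ x ∈ ball (y + r • e) (r / (32 * L)), m ≤ v x),
      ∀ x ∈ Ω, dist x y < r → m * u x ≤ C * u (y + r • e) * v x := by
  have hL0 : 0 < L := by linarith
  obtain ⟨C1, hC1, HC⟩ := carleson hN hV L hL
  obtain ⟨β, hβ0, hβ1, HL⟩ := lemL hN hV L hL
  obtain ⟨c, hc0, hc1, HX⟩ := conn hV L hL (4 * L) β (by linarith) hβ0 (by linarith)
  refine ⟨2 * (C1 / c) / c, ?_, ?_⟩
  · rw [le_div_iff₀ hc0]
    have : C1 ≤ C1 / c := by rw [le_div_iff₀ hc0]; nlinarith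
    linarith
  intro R y e F hch r hr hrR u v hu hu' hu0 hvan hv hv0 m hm hvm x hx hxd
  have hLr : r ≤ L * r := by nlinarith
  have hLr2 : L * r ≤ L ^ 2 * r := by rw [pow_two]; nlinarith
  set T := 96 * L ^ 2 * r with hT
  set D := Ω ∩ ball y T with hD
  have hDo : IsOpen D := hV.opn.inter isOpen_ball
  have hDm : ∀ x, 0 < F x → dist x y < T → x ∈ D := fun x h1 h2 =>
    ⟨(hch.mem x (mem_ball.2 (by linarith))).2 h1, h2⟩
  have hβr : β * r ≤ r := by nlinarith
  have hD2 : ∀ z, β / 2 * r ≤ F z → dist z y < 4 * L * (4 * L) * r → z ∈ D := fun z h1 h2 =>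
    hDm z (lt_of_lt_of_le (by positivity) h1) (by nlinarith)
  have hFA : ∀ τ, F (y + τ • e) = τ := fun τ => by rw [hch.lin, hch.zero]; ring
  have hAD : ∀ τ, 0 < τ → τ ≤ 4 * L * r → y + τ • e ∈ D := fun τ h1 h2 =>
    hDm _ (by rw [hFA]; exact h1) (by rw [hch.dist_up y h1.le]; linarith)
  set U := u (y + r • e) with hU
  have hU0 : 0 ≤ U := by
    have := hAD r hr (by linarith); exact hu0 _ this.1 this.2
  have hUA : u (y + (4 * L * r) • e) ≤ U / c := by
    have := (HX R y e F hch D inter_subset_left hDo u hu (fun z hz => hu0 z hz.1 hz.2) r hr hD2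
      (y + (4 * L * r) • e) (y + r • e) (by rw [hFA]; linarith) (by rw [hFA]; linarith)
      (by rw [hch.dist_up y (by positivity)]) (by rw [hch.dist_up y hr.le]; linarith)).2 hu'
    rw [le_div_iff₀ hc0]; linarith
  have hub : ∀ z ∈ Ω, dist z y < 4 * L * r → u z ≤ C1 / c * U := by
    have hTT : 24 * L * (4 * L * r) = T := by rw [hT]; ring
    have := HC R y e F hch (4 * L * r) (by positivity) (by rw [hTT]; exact hrR) u (by rw [hTT]; exact hu)
      (by rw [hTT]; exact hu') (by rw [hTT]; exact hu0) (by rw [hTT]; exact hvan)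
    intro z hz hzd
    refine (this z hz hzd).trans ?_
    calc C1 * u (y + (4 * L * r) • e) ≤ C1 * (U / c) := by gcongr
      _ = _ := by ring
  have hvb : ∀ z, β * r ≤ F z → dist z y < 4 * L * r → c * m ≤ v z := by
    intro z hz hzd
    refine (HX R y e F hch D inter_subset_left hDo v hv (fun z hz => hv0 z hz.1 hz.2) r hr hD2
      (y + r • e) z (by rw [hFA]; linarith) hz (by rw [hch.dist_up y hr.le]; linarith)
      hzd.le).1 m ?_ z (mem_ball_self (by positivity))
    intro b hb
    refine hvm b (ball_subset_ball ?_ hb)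
    rw [div_mul_eq_mul_div]; gcongr
  have hFx : 0 < F x := (hch.mem x (mem_ball.2 (by linarith))).1 hx
  have hFx2 : F x < L * r := (hch.F_le x).trans_lt (by gcongr)
  set p := x - F x • e with hp
  have hpx : dist p x = F x := hch.dist_down x hFx.le
  have hpy := dist_triangle p x y
  have hsub : ball p (2 * L * r) ⊆ ball y (4 * L * r) := by
    intro z hz; rw [mem_ball] at *; linarith [dist_triangle z p y]
  have hsub2 : ball p (2 * L * r) ⊆ ball y T := hsub.trans (ball_subset_ball (by linarith))
  have hsubD : Ω ∩ ball p (2 * L * r) ⊆ D := inter_subset_inter_right _ hsub2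
  have hDo' : IsOpen (Ω ∩ ball p (2 * L * r)) := hV.opn.inter isOpen_ball
  set B := 2 * (C1 / c) / c * U with hB
  have hB0 : 0 ≤ B := by positivity
  have hw : Sp V (Ω ∩ ball p (2 * L * r)) (fun x => B * v x + m * (-u x)) :=
    ((hv.mono hsubD).smul hB0).add hV hDo' inter_subset_left ((hu'.mono hsubD).smul hm)
  have hbd : LBd Ω (ball p (2 * L * r)) (fun x => B * v x + m * (-u x)) := by
    have h1 : LBd Ω (ball p (2 * L * r)) (fun x => B * v x) :=
      LBd.of_nonneg (fun z hz hz' => mul_nonneg hB0 (hv0 z hz (hsub2 hz'))) isOpen_ball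
    have h2 := h1.add ((hvan.mono hsub2).neg_LBd m)
    refine fun ξ hξ hS ε hε => ?_
    filter_upwards [h2 ξ hξ hS ε hε] with z hz
    linarith
  have k := HL (2 * L * r) p e F (hch.restrict (by positivity) (hch.foot x) (by linarith))
    (2 * L * r) (by positivity) le_rfl _ hw hbd (m * (C1 / c * U)) (by positivity) ?_ ?_ (F x) hFx
    (by linarith)
  · rw [hp, sub_add_cancel] at k
    linarith
  · intro z hz hzp
    have h1 := mul_nonneg hB0 (hv0 z hz (hsub2 hzp))
    have h2 := mul_le_mul_of_nonneg_left (hub z hz (hsub hzp)) hm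
    linarith
  · intro z hz hzp
    have hzb : β * r ≤ F z := by nlinarith
    have h1 := mul_le_mul_of_nonneg_left (hvb z hzb (hsub hzp)) hB0
    have hzD := hDm z (lt_of_lt_of_le (by positivity) hzb) (hsub2 hzp)
    have h2 := mul_le_mul_of_nonneg_left (hub z hzD.1 (hsub hzp)) hm
    have e1 : B * (c * m) = 2 * (m * (C1 / c * U)) := by rw [hB]; field_simp
    linarith

/-- Sphere lemma -/
lemma sphere_cmp (hN : 0 < N) (hV : Pot Ω a V) (L : ℝ) (hL : 1 ≤ L) : ∃ C : ℝ, 1 ≤ C ∧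
    ∀ (R : ℝ) (y e : ES N) (F : ES N → ℝ) (_ : Chart Ω L R y e F) (r : ℝ) (_ : 0 < r)
      (_ : 96 * L ^ 2 * r ≤ R) (u v : ES N → ℝ) (S : Set (ES N))
      (_ : S = ball y (96 * L ^ 2 * r) \ closedBall y (r / (1000 * L ^ 3)))
      (_ : Sp V (Ω ∩ S) u) (_ : Sp V (Ω ∩ S) (fun x => -u x))
      (_ : ∀ x ∈ Ω, x ∈ S → 0 ≤ u x) (_ : Van Ω S u)
      (_ : Sp V (Ω ∩ S) v) (_ : ∀ x ∈ Ω, x ∈ S → 0 ≤ v x) (m : ℝ) (_ : 0 ≤ m)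
      (_ : ∀ x ∈ ball (y + r • e) (r / (32 * L)), m ≤ v x),
      ∀ x ∈ Ω, r ≤ dist x y → dist x y ≤ 2 * r → m * u x ≤ C * u (y + r • e) * v x := by
  have hL0 : 0 < L := by linarith
  obtain ⟨C1, hC1, HB⟩ := bhp hN hV L hL
  have hL2 : 1 ≤ L ^ 2 := one_le_pow₀ hL
  have hL3 : 1 ≤ L ^ 3 := one_le_pow₀ hL
  set ε : ℝ := 1 / (384 * L ^ 2) with hε
  have hε0 : 0 < ε := by positivity
  have hεL : 96 * L ^ 2 * ε = 1 / 4 := by rw [hε]; field_simp; norm_num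
  have hε1 : ε ≤ 1 / 384 := by nlinarith
  obtain ⟨c, hc0, hc1, HX⟩ := conn hV L hL 3 ε (by norm_num) hε0 (by linarith)
  refine ⟨C1 / c / c, ?_, ?_⟩
  · rw [le_div_iff₀ hc0, le_div_iff₀ hc0]; nlinarith
  intro R y e F hch r hr hrR u v S hS hu hu' hu0 hvan hv hv0 m hm hvm x hx hxr hx2
  have hSo : IsOpen S := by rw [hS]; exact isOpen_ball.sdiff isClosed_closedBall
  set D := Ω ∩ S with hD
  have hDo : IsOpen D := hV.opn.inter hSo
  have hLr : r ≤ L * r := by nlinarith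
  have hLr2 : L * r ≤ L ^ 2 * r := by rw [pow_two]; nlinarith
  have hSm : ∀ z, r / (1000 * L ^ 3) < dist z y → dist z y < 96 * L ^ 2 * r → z ∈ S := by
    intro z h1 h2; rw [hS]; exact ⟨h2, fun h => by rw [mem_closedBall] at h; linarith⟩
  have hc3 : r / (1000 * L ^ 3) ≤ r / 1000 := by
    rw [mul_comm, ← div_div]
    apply div_le_div_of_nonneg_right _ (by norm_num)
    exact div_le_self hr.le hL3
  have hDm : ∀ z, ε / 2 * r ≤ F z → dist z y < 4 * L * 3 * r → z ∈ D := by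
    intro z h1 h2
    refine ⟨(hch.mem z (mem_ball.2 (by linarith))).2 (lt_of_lt_of_le (by positivity) h1), ?_⟩
    refine hSm z ?_ (by linarith)
    have h3 := h1.trans (hch.F_le z)
    have : r / (1000 * L ^ 3) * L < ε / 2 * r := by
      rw [hε, show 1 / (384 * L ^ 2) / 2 * r = r / (768 * L ^ 2) by field_simp; norm_num,
        show r / (1000 * L ^ 3) * L = r / (1000 * L ^ 2) by field_simp]
      apply div_lt_div_of_pos_left hr (by positivity)
      nlinarith
    nlinarith
  have hFA : F (y + r • e) = r := by rw [hch.lin, hch.zero]; ring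
  have hAd : dist (y + r • e) y = r := hch.dist_up y hr.le
  have hεr : ε * r ≤ r := by nlinarith
  have hAD : y + r • e ∈ D := hDm _ (by rw [hFA]; linarith) (by rw [hAd]; linarith)
  set U := u (y + r • e) with hU
  have hU0 : 0 ≤ U := hu0 _ hAD.1 hAD.2
  have hub : ∀ z, ε * r ≤ F z → dist z y ≤ 3 * r → u z ≤ U / c := by
    intro z h1 h2
    have := (HX R y e F hch D inter_subset_left hDo u hu (fun z hz => hu0 z hz.1 hz.2) r hr hDm
      z (y + r • e) h1 (by linarith) h2 (by linarith)).2 hu'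
    rw [le_div_iff₀ hc0]; linarith
  have hvb : ∀ z, ε * r ≤ F z → dist z y ≤ 3 * r → ∀ b ∈ ball z (ε / (32 * L) * r), c * m ≤ v b := by
    intro z h1 h2
    refine (HX R y e F hch D inter_subset_left hDo v hv (fun z hz => hv0 z hz.1 hz.2) r hr hDm
      (y + r • e) z (by linarith) h1 (by linarith) h2).1 m ?_
    intro b hb
    refine hvm b (ball_subset_ball ?_ hb)
    rw [div_mul_eq_mul_div]; gcongr
  have hxS : x ∈ S := hSm x (by linarith) (by linarith)
  have hux := hu0 x hx hxS
  have hvx := hv0 x hx hxS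
  have fin : ∀ C', 1 ≤ C' → c * m * u x ≤ C' * (U / c) * v x → m * u x ≤ C' / c / c * U * v x := by
    intro C' _ h
    have e1 : C' / c / c * U * v x = (C' * (U / c) * v x) / c := by field_simp
    rw [e1, le_div_iff₀ hc0]; linarith
  rcases le_or_gt (ε * r) (F x) with hF | hF
  · have h1 := hub x hF (by linarith)
    have h2 := hvb x hF (by linarith) x (mem_ball_self (by positivity))
    refine fin C1 hC1 ?_
    calc c * m * u x ≤ v x * (U / c) := mul_le_mul h2 h1 hux hvx
      _ = 1 * (U / c) * v x := by ring
      _ ≤ C1 * (U / c) * v x := by gcongr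
  · have hFx : 0 < F x := (hch.mem x (mem_ball.2 (by linarith))).1 hx
    set p := x - F x • e with hp
    have hpx : dist p x = F x := hch.dist_down x hFx.le
    have hpy := dist_triangle p x y
    have hpy' := dist_triangle x p y
    rw [dist_comm x p] at hpy'
    have hrad : 96 * L ^ 2 * (ε * r) = 1 / 4 * r := by rw [← hεL]; ring
    have hεr' : ε * r ≤ 1 / 384 * r := by gcongr
    have hsubS : ball p (96 * L ^ 2 * (ε * r)) ⊆ S := by
      intro z hz
      rw [mem_ball, hrad] at hz
      have h1 := dist_triangle z p y
      have h2 := dist_triangle p z y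
      rw [dist_comm p z] at h2
      exact hSm z (by linarith) (by linarith)
    have hsub : Ω ∩ ball p (96 * L ^ 2 * (ε * r)) ⊆ D := inter_subset_inter_right _ hsubS
    have hB1 : F (p + (ε * r) • e) = ε * r := by rw [hch.lin, hp, hch.foot]; ring
    have hB2 : dist (p + (ε * r) • e) y ≤ 3 * r := by
      have h1 := dist_triangle (p + (ε * r) • e) p y
      rw [hch.dist_up p (by positivity)] at h1
      linarith
    have k := HB (96 * L ^ 2 * (ε * r)) p e F (hch.restrict (by positivity) (hch.foot x)
      (by rw [hrad]; linarith)) (ε * r) (by positivity) le_rfl u v (hu.mono hsub) (hu'.mono hsub)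
      (fun z hz hz' => hu0 z hz (hsubS hz')) (hvan.mono hsubS) (hv.mono hsub)
      (fun z hz hz' => hv0 z hz (hsubS hz')) (c * m) (by positivity) (by
        intro b hb
        refine hvb _ hB1.ge hB2 b ?_
        rwa [div_mul_eq_mul_div ε (32 * L) r]) x hx (by rw [dist_comm, hpx]; exact hF)
    refine fin C1 hC1 (k.trans ?_)
    have := hub _ hB1.ge hB2
    gcongr

end


section

/-! ## Section 4: global geometry -/
variable {N : ℕ} {Ω : Set (ES N)} {a : ℝ} {V : ES N → ℝ}

structure Geo (Ω : Set (ES N)) (L R : ℝ) (e : ES N → ES N) (F : ES N → ES N → ℝ) : Prop where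
  L1 : 1 ≤ L
  R0 : 0 < R
  opn : IsOpen Ω
  bdd : Bornology.IsBounded Ω
  conn : IsPreconnected Ω
  ch : ∀ y ∈ frontier Ω, Chart Ω L R y (e y) (F y)

lemma Chart.of_lip {z : ES N} {g : ES N ≃ₗᵢ[ℝ] ES N} {i : Fin N} {f : ES N → ℝ} {K : ℝ≥0} {ε L : ℝ}
    (ho : IsOpen Ω) (hz : z ∈ frontier Ω) (hε : 0 < ε) (hf : LipschitzWith K f)
    (hfi : ∀ x w : ES N, (∀ j, j ≠ i → x j = w j) → f x = f w)
    (h : ∀ x ∈ ball z ε, (x ∈ Ω ↔ f (g x) < g x i)) (hL : K + 1 ≤ L) :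
    Chart Ω L ε z (g.symm (EuclideanSpace.single i 1)) (fun x => g x i - f (g x)) := by
  have hlip : ∀ x x', |(g x i - f (g x)) - (g x' i - f (g x'))| ≤ L * dist x x' := by
    intro x x'
    have h1 : |g x i - g x' i| ≤ dist x x' := by
      have := PiLp.norm_apply_le (p := 2) (g x - g x') i
      rw [← dist_eq_norm, g.dist_map] at this
      simpa [Real.norm_eq_abs] using this
    have h2 : |f (g x) - f (g x')| ≤ K * dist x x' := by
      have := hf.dist_le_mul (g x) (g x')
      rwa [g.dist_map, Real.dist_eq] at this
    have h3 : (K + 1) * dist x x' ≤ L * dist x x' := by gcongr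
    rw [abs_le] at *
    constructor <;> linarith [h1.1, h1.2, h2.1, h2.2]
  have hFc : Continuous (fun x => g x i - f (g x)) := by
    have hL0 : 0 ≤ L := by have := K.2; linarith
    refine (LipschitzWith.of_dist_le_mul (K := ⟨L, hL0⟩) fun x y => ?_).continuous
    rw [Real.dist_eq]; exact hlip x y
  have hmem : ∀ x ∈ ball z ε, (x ∈ Ω ↔ 0 < g x i - f (g x)) := fun x hx => by
    rw [h x hx, sub_pos]
  refine ⟨by have := K.2; linarith, hε, ?_, ?_, hlip, ?_, hmem⟩
  · simp
  · intro x τ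
    simp only [map_add, map_smul, LinearIsometryEquiv.apply_symm_apply]
    rw [hfi (g x + τ • EuclideanSpace.single i 1) (g x) (fun j hj => by simp [hj])]
    simp; ring
  · refine le_antisymm ?_ ?_
    · by_contra hc
      push Not at hc
      have := (hmem z (mem_ball_self hε)).2 hc
      exact hz.2 (by rwa [ho.interior_eq])
    · by_contra hc
      push Not at hc
      have h1 := hFc.continuousAt.eventually (gt_mem_nhds hc)
      have h2 : ∀ᶠ x in 𝓝 z, x ∈ ball z ε := isOpen_ball.mem_nhds (mem_ball_self hε)
      have h3 := mem_closure_iff_frequently.1 hz.1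
      obtain ⟨x, hx, hx1, hx2⟩ := (h3.and_eventually (h1.and h2)).exists
      have := (hmem x hx2).1 hx
      linarith

lemma Chart.mono_L {L L' R : ℝ} {p e : ES N} {F : ES N → ℝ} (h : Chart Ω L R p e F) (hL : L ≤ L') :
    Chart Ω L' R p e F :=
  ⟨h.L1.trans hL, h.R0, h.he, h.lin, fun x x' => (h.lip x x').trans (by gcongr), h.zero, h.mem⟩

lemma Chart.mono_R {L R R' : ℝ} {p e : ES N} {F : ES N → ℝ} (h : Chart Ω L R p e F) (h0 : 0 < R')
    (hR : R' ≤ R) : Chart Ω L R' p e F := h.restrict h0 h.zero (by simpa using hR)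

lemma exists_geo (hΩ : IsLipschitzDomain Ω) (hbd : Bornology.IsBounded Ω) :
    ∃ L R e F, Geo Ω L R e F := by
  obtain ⟨ho, hcon, hch⟩ := hΩ
  have hcomp : IsCompact (frontier Ω) :=
    Metric.isCompact_of_isClosed_isBounded isClosed_frontier
      (hbd.closure.subset frontier_subset_closure)
  have key : ∃ L R : ℝ, 1 ≤ L ∧ 0 < R ∧ ∀ y ∈ frontier Ω, y ∈ frontier Ω → ∃ e F, Chart Ω L R y e F := by
    refine hcomp.induction_on (p := fun s => ∃ L R : ℝ, 1 ≤ L ∧ 0 < R ∧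
      ∀ y ∈ s, y ∈ frontier Ω → ∃ e F, Chart Ω L R y e F) ⟨1, 1, le_rfl, one_pos, by simp⟩ ?_ ?_ ?_
    · rintro s t hst ⟨L, R, h1, h2, h3⟩
      exact ⟨L, R, h1, h2, fun y hy => h3 y (hst hy)⟩
    · rintro s t ⟨L, R, h1, h2, h3⟩ ⟨L', R', h1', h2', h3'⟩
      refine ⟨max L L', min R R', le_max_of_le_left h1, lt_min h2 h2', fun y hy hyf => ?_⟩
      rcases hy with hy | hy
      · obtain ⟨e, F, h⟩ := h3 y hy hyf
        exact ⟨e, F, (h.mono_L (le_max_left _ _)).mono_R (lt_min h2 h2') (min_le_left _ _)⟩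
      · obtain ⟨e, F, h⟩ := h3' y hy hyf
        exact ⟨e, F, (h.mono_L (le_max_right _ _)).mono_R (lt_min h2 h2') (min_le_right _ _)⟩
    · intro z hz
      obtain ⟨g, i, f, K, ε, hε, hf, hfi, h⟩ := hch z hz
      have hc := Chart.of_lip ho hz hε hf hfi h le_rfl
      refine ⟨ball z (ε / 2), mem_nhdsWithin_of_mem_nhds (ball_mem_nhds z (by positivity)),
        K + 1, ε / 2, by have := K.2; linarith, by positivity, fun y hy hyf => ?_⟩
      rw [mem_ball] at hy
      exact ⟨_, _, hc.restrict (by positivity) (hc.frontier_zero ho hyf (by linarith)) (by linarith)⟩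
  obtain ⟨L, R, h1, h2, h3⟩ := key
  have h4 : ∀ y, ∃ (e : ES N) (F : ES N → ℝ), y ∈ frontier Ω → Chart Ω L R y e F := by
    intro y
    by_cases hy : y ∈ frontier Ω
    · obtain ⟨e, F, h⟩ := h3 y hy hy; exact ⟨e, F, fun _ => h⟩
    · exact ⟨0, 0, fun h => absurd h hy⟩
  choose e F h5 using h4
  exact ⟨L, R, e, F, h1, h2, ho, hbd, hcon.isPreconnected, h5⟩

lemma compl_nonempty (hN : 0 < N) (hbd : Bornology.IsBounded Ω) : (Ωᶜ).Nonempty := by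
  rw [nonempty_compl]
  rintro rfl
  have : Nonempty (Fin N) := ⟨⟨0, hN⟩⟩
  exact NormedSpace.unbounded_univ ℝ (ES N) hbd

lemma ball_sub_of_le_dista {x : ES N} {s : ℝ} (h : s ≤ dista Ω x) : ball x s ⊆ Ω := by
  intro y hy
  by_contra hc
  have h1 : infDist x Ωᶜ ≤ dist x y := infDist_le_dist_of_mem hc
  rw [mem_ball, dist_comm] at hy
  unfold dista at h; linarith

lemma le_dista_of_ball_sub (hne : (Ωᶜ).Nonempty) {x : ES N} {s : ℝ} (h : ball x s ⊆ Ω) :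
    s ≤ dista Ω x := by
  unfold dista
  rw [le_infDist hne]
  intro y hy
  by_contra hc
  push Not at hc
  exact hy (h (by rwa [mem_ball, dist_comm]))

lemma dista_le_dist {x y : ES N} (hy : y ∉ Ω) : dista Ω x ≤ dist x y := infDist_le_dist_of_mem hy

lemma not_mem_of_frontier (ho : IsOpen Ω) {y : ES N} (hy : y ∈ frontier Ω) : y ∉ Ω := fun h =>
  hy.2 (by rwa [ho.interior_eq])

lemma pot_of_VClass (hN : 0 < N) (ho : IsOpen Ω) (hbd : Bornology.IsBounded Ω) (h : VClass Ω a V) :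
    Pot Ω a V := by
  refine ⟨ho, h.1, fun x hx => (h.2 x hx).1, ?_⟩
  intro x T hT hb y hy
  have hyΩ : y ∈ Ω := hb (ball_subset_ball (by linarith) hy)
  have h1 : T ≤ dista Ω y := le_dista_of_ball_sub (compl_nonempty hN hbd) (fun z hz => hb (by
    rw [mem_ball] at *; linarith [dist_triangle z y x]))
  have h2 : T ^ 2 ≤ dista Ω y ^ 2 := by gcongr
  exact (mul_le_mul_of_nonneg_left h2 (h.2 y hyΩ).1).trans (h.2 y hyΩ).2

lemma pot_zero (ho : IsOpen Ω) (ha : 0 ≤ a) : Pot Ω a (fun _ => 0) :=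
  ⟨ho, measurable_const, fun _ _ => le_rfl, fun x T _ _ y _ => by simpa using ha⟩

/-- Harnack on `Ω` relative to a base point. -/
lemma harnack_glob (hN : 0 < N) (hV : Pot Ω a V) (hbd : Bornology.IsBounded Ω) (hcon : IsPreconnected Ω)
    {x₀ : ES N} (hx₀ : x₀ ∈ Ω) (η : ℝ) (hη : 0 < η) : ∃ c : ℝ, 0 < c ∧ c ≤ 1 ∧
    ∀ x, η ≤ dista Ω x → ∀ w : ES N → ℝ, Sp V Ω w → Sp V Ω (fun x => -w x) → (∀ x ∈ Ω, 0 ≤ w x) →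
      c * w x₀ ≤ w x ∧ c * w x ≤ w x₀ := by
  obtain ⟨c, hc0, hc1, H⟩ := wh_step N a
  set P : ES N → ℝ → Prop := fun x b => ∀ w : ES N → ℝ, Sp V Ω w → Sp V Ω (fun x => -w x) →
      (∀ x ∈ Ω, 0 ≤ w x) → b * w x₀ ≤ w x ∧ b * w x ≤ w x₀ with hP
  have loc : ∀ x ∈ Ω, ∃ t > 0, ball x t ⊆ Ω ∧ ∀ z ∈ ball x t, ∀ w : ES N → ℝ, Sp V Ω w →
      Sp V Ω (fun x => -w x) → (∀ x ∈ Ω, 0 ≤ w x) → c * w x ≤ w z ∧ c * w z ≤ w x := by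
    intro x hx
    obtain ⟨T, hT, hTb⟩ := Metric.isOpen_iff.1 hV.opn x hx
    refine ⟨T / 32, by positivity, (ball_subset_ball (by linarith)).trans hTb, ?_⟩
    intro z hz w h1 h2 h3
    rw [mem_ball] at hz
    have b1 : ball x (16 * (T / 32)) ⊆ Ω := (ball_subset_ball (by linarith)).trans hTb
    have b2 : ball z (16 * (T / 32)) ⊆ Ω := fun b hb => hTb (by
      rw [mem_ball] at *; linarith [dist_triangle b z x])
    have b1' : ball x (8 * (T / 32)) ⊆ Ω := (ball_subset_ball (by linarith)).trans b1
    have b2' : ball z (8 * (T / 32)) ⊆ Ω := (ball_subset_ball (by linarith)).trans b2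
    exact ⟨(H Ω Ω V hV Subset.rfl hV.opn w h1 x (T / 32) (by positivity) b1 b1'
        (fun y hy => h3 y (b1' hy))).2 h2 z (by linarith),
      (H Ω Ω V hV Subset.rfl hV.opn w h1 z (T / 32) (by positivity) b2 b2'
        (fun y hy => h3 y (b2' hy))).2 h2 x (by rw [dist_comm]; linarith)⟩
  have trans : ∀ x z b, 0 < b → (∀ w : ES N → ℝ, Sp V Ω w →
      Sp V Ω (fun x => -w x) → (∀ x ∈ Ω, 0 ≤ w x) → c * w x ≤ w z ∧ c * w z ≤ w x) → P x b →
      P z (c * b) := by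
    intro x z b hb h1 h2 w k1 k2 k3
    have e1 := h1 w k1 k2 k3
    have e2 := h2 w k1 k2 k3
    constructor
    · calc c * b * w x₀ = c * (b * w x₀) := by ring
        _ ≤ c * w x := by gcongr; exact e2.1
        _ ≤ _ := e1.1
    · calc c * b * w z = b * (c * w z) := by ring
        _ ≤ b * w x := by gcongr; exact e1.2
        _ ≤ _ := e2.2
  have all : ∀ x ∈ Ω, ∃ b, 0 < b ∧ P x b := by
    by_contra hcon'
    push Not at hcon'
    obtain ⟨x1, hx1, hx1'⟩ := hcon'
    have o1 : IsOpen {x | x ∈ Ω ∧ ∃ b, 0 < b ∧ P x b} := by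
      rw [Metric.isOpen_iff]
      rintro x ⟨hx, b, hb, hb'⟩
      obtain ⟨t, ht, hts, h⟩ := loc x hx
      exact ⟨t, ht, fun z hz => ⟨hts hz, c * b, by positivity, trans x z b hb (h z hz) hb'⟩⟩
    have o2 : IsOpen {x | x ∈ Ω ∧ ¬ ∃ b, 0 < b ∧ P x b} := by
      rw [Metric.isOpen_iff]
      rintro x ⟨hx, hb⟩
      obtain ⟨t, ht, hts, h⟩ := loc x hx
      refine ⟨t, ht, fun z hz => ⟨hts hz, ?_⟩⟩
      rintro ⟨b, hb1, hb2⟩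
      exact hb ⟨c * b, by positivity, trans z x b hb1 (fun w k1 k2 k3 => (h z hz w k1 k2 k3).symm) hb2⟩
    obtain ⟨z, _, hz1, hz2⟩ := hcon _ _ o1 o2 (fun x hx => by
        by_cases h : ∃ b, 0 < b ∧ P x b
        · exact Or.inl ⟨hx, h⟩
        · exact Or.inr ⟨hx, h⟩)
      ⟨x₀, hx₀, hx₀, 1, one_pos, fun w _ _ _ => by simp⟩
      ⟨x1, hx1, hx1, by push Not; exact hx1'⟩
    exact hz2.2 hz1.2
  have hTc : IsCompact {x : ES N | η ≤ dista Ω x} := by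
    refine Metric.isCompact_of_isClosed_isBounded ?_ (hbd.subset ?_)
    · exact isClosed_le continuous_const (continuous_infDist_pt _)
    · intro x hx
      exact ball_sub_of_le_dista (Ω := Ω) (show η ≤ dista Ω x from hx) (mem_ball_self hη)
  have key : ∃ b : ℝ, 0 < b ∧ b ≤ 1 ∧ ∀ x ∈ {x : ES N | η ≤ dista Ω x}, P x b := by
    refine hTc.induction_on (p := fun s => ∃ b : ℝ, 0 < b ∧ b ≤ 1 ∧ ∀ x ∈ s, x ∈ Ω → P x b)
      ⟨1, one_pos, le_rfl, by simp⟩ ?_ ?_ ?_ |>.imp ?_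
    · rintro s t hst ⟨b, h1, h2, h3⟩; exact ⟨b, h1, h2, fun x hx => h3 x (hst hx)⟩
    · rintro s t ⟨b, h1, h2, h3⟩ ⟨b', h1', h2', h3'⟩
      have pm : ∀ x ∈ Ω, ∀ b b' : ℝ, b' ≤ b → P x b → P x b' := by
        intro x hx b b' hbb h w k1 k2 k3
        have := h w k1 k2 k3
        have w0 := k3 x₀ hx₀
        have wx := k3 x hx
        exact ⟨le_trans (by gcongr) this.1, le_trans (by gcongr) this.2⟩
      refine ⟨min b b', lt_min h1 h1', (min_le_left _ _).trans h2, fun x hx hxΩ => ?_⟩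
      rcases hx with hx | hx
      · exact pm x hxΩ b _ (min_le_left _ _) (h3 x hx hxΩ)
      · exact pm x hxΩ b' _ (min_le_right _ _) (h3' x hx hxΩ)
    · intro x hx
      have hxΩ : x ∈ Ω := ball_sub_of_le_dista (Ω := Ω) (show η ≤ dista Ω x from hx) (mem_ball_self hη)
      obtain ⟨b, hb, hPb⟩ := all x hxΩ
      have hPb' : P x (min b 1) := by
        intro w k1 k2 k3
        have := hPb w k1 k2 k3
        have w0 := k3 x₀ hx₀
        have wx := k3 x hxΩ
        exact ⟨le_trans (by gcongr; exact min_le_left _ _) this.1,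
          le_trans (by gcongr; exact min_le_left _ _) this.2⟩
      obtain ⟨t, ht, hts, h⟩ := loc x hxΩ
      have hm : 0 < min b 1 := lt_min hb one_pos
      exact ⟨ball x t, mem_nhdsWithin_of_mem_nhds (ball_mem_nhds x ht), c * min b 1, by positivity,
        mul_le_one₀ hc1 hm.le (min_le_right _ _), fun z hz _ => trans x z _ hm (h z hz) hPb'⟩
    · rintro b ⟨h1, h2, h3⟩
      exact ⟨h1, h2, fun x hx => h3 x hx (ball_sub_of_le_dista (Ω := Ω)
        (show η ≤ dista Ω x from hx) (mem_ball_self hη))⟩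
  obtain ⟨b, h1, h2, h3⟩ := key
  exact ⟨b, h1, h2, fun x hx => h3 x hx⟩

end


section
variable {N : ℕ} {Ω : Set (ES N)} {a : ℝ} {V : ES N → ℝ} {L R : ℝ} {e : ES N → ES N}
  {F : ES N → ES N → ℝ}

def Sol (V : ES N → ℝ) (D : Set (ES N)) (u : ES N → ℝ) : Prop := Sp V D u ∧ Sp V D (fun x => -u x)

lemma Sol.mono {D D' : Set (ES N)} {u : ES N → ℝ} (h : Sol V D u) (hD : D' ⊆ D) : Sol V D' u :=
  ⟨h.1.mono hD, h.2.mono hD⟩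

lemma Sol.add {D : Set (ES N)} (hV : Pot Ω a V) (hD : IsOpen D) (hDΩ : D ⊆ Ω) {u v : ES N → ℝ}
    (h : Sol V D u) (h' : Sol V D v) : Sol V D (fun x => u x + v x) :=
  ⟨h.1.add hV hD hDΩ h'.1, (h.2.add hV hD hDΩ h'.2).congr fun x _ => by ring⟩

lemma Sol.smul {D : Set (ES N)} {u : ES N → ℝ} (h : Sol V D u) (c : ℝ) :
    Sol V D (fun x => c * u x) := by
  rcases le_total 0 c with hc | hc
  · exact ⟨h.1.smul hc, (h.2.smul hc).congr fun x _ => by ring⟩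
  · exact ⟨(h.2.smul (neg_nonneg.2 hc)).congr fun x _ => by ring,
      (h.1.smul (neg_nonneg.2 hc)).congr fun x _ => by ring⟩

lemma Sol.congr {D : Set (ES N)} {u v : ES N → ℝ} (h : Sol V D u) (he : ∀ x ∈ D, u x = v x) :
    Sol V D v := ⟨h.1.congr he, h.2.congr fun x hx => by rw [he x hx]⟩

lemma Van.add {S : Set (ES N)} {u v : ES N → ℝ} (h : Van Ω S u) (h' : Van Ω S v) :
    Van Ω S (fun x => u x + v x) := fun ξ h1 h2 => by
  have := (h ξ h1 h2).add (h' ξ h1 h2)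
  rwa [add_zero] at this

lemma Van.smul {S : Set (ES N)} {u : ES N → ℝ} (h : Van Ω S u) (c : ℝ) :
    Van Ω S (fun x => c * u x) := fun ξ h1 h2 => by
  have := (h ξ h1 h2).const_mul c
  rwa [mul_zero] at this

structure Ker (Ω : Set (ES N)) (W : ES N → ℝ) (x₀ : ES N) (k : ES N → ES N → ℝ) : Prop where
  sol : ∀ y ∈ frontier Ω, Sol W Ω (k y)
  pos : ∀ y ∈ frontier Ω, ∀ x ∈ Ω, 0 < k y x
  one : ∀ y ∈ frontier Ω, k y x₀ = 1
  van : ∀ y ∈ frontier Ω, Van Ω {y}ᶜ (k y)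

lemma Ker.of {x₀ : ES N} {k : ES N → ES N → ℝ} (h : ∀ y ∈ frontier Ω, IsMartinKernel Ω V x₀ y (k y)) :
    Ker Ω V x₀ k where
  sol y hy := Sp.of_harm (h y hy).1 Subset.rfl
  pos y hy := (h y hy).2.1
  one y hy := (h y hy).2.2.1
  van y hy ξ hξ hne := (h y hy).2.2.2 ξ hξ hne

/-- generic maximum principle outside balls: nonnegativity near the removed set -/
lemma outer (hN : 0 < N) (hV : Pot Ω a V) (hG : Geo Ω L R e F) : ∃ C : ℝ, 1 ≤ C ∧
    ∀ y ∈ frontier Ω, ∀ (r : ℝ) (_ : 0 < r) (_ : 96 * L ^ 2 * r ≤ R) (u v : ES N → ℝ)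
      (S : Set (ES N)) (_ : S = (closedBall y (r / (1000 * L ^ 3)))ᶜ)
      (_ : Sol V (Ω ∩ S) u) (_ : ∀ x ∈ Ω, x ∈ S → 0 ≤ u x) (_ : Van Ω S u)
      (_ : Sp V (Ω ∩ S) v) (_ : ∀ x ∈ Ω, x ∈ S → 0 ≤ v x) (m : ℝ) (_ : 0 ≤ m)
      (_ : ∀ x ∈ ball (y + r • e y) (r / (32 * L)), m ≤ v x),
      ∀ x ∈ Ω, r ≤ dist x y → m * u x ≤ C * u (y + r • e y) * v x := by
  obtain ⟨C, hC, H⟩ := sphere_cmp hN hV L hG.L1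
  refine ⟨C, hC, ?_⟩
  intro y hy r hr hrR u v S hS hu hu0 huv hv hv0 m hm hmv
  have hL0 : 0 < L := by linarith [hG.L1]
  have hch := hG.ch y hy
  set S' := ball y (96 * L ^ 2 * r) \ closedBall y (r / (1000 * L ^ 3)) with hS'
  have hss : S' ⊆ S := by rw [hS]; exact fun x hx => hx.2
  have hss2 : Ω ∩ S' ⊆ Ω ∩ S := inter_subset_inter_right _ hss
  have hL3 : 1 ≤ L ^ 3 := one_le_pow₀ hG.L1
  have hL2 : 1 ≤ L ^ 2 := one_le_pow₀ hG.L1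
  have near := H R y (e y) (F y) hch r hr hrR u v S' rfl (hu.1.mono hss2) (hu.2.mono hss2)
    (fun x hx hx' => hu0 x hx (hss hx')) (huv.mono hss) (hv.mono hss2)
    (fun x hx hx' => hv0 x hx (hss hx')) m hm hmv
  have hrS : ∀ x, r ≤ dist x y → x ∈ S := by
    intro x hx
    rw [hS, mem_compl_iff, mem_closedBall, not_le]
    refine lt_of_lt_of_le ?_ hx
    rw [div_lt_iff₀ (by positivity)]; nlinarith
  have hAΩ : y + r • e y ∈ Ω := by
    rw [hch.mem _ (by rw [mem_ball, hch.dist_up y hr.le]; nlinarith), hch.lin, hch.zero]; linarith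
  have hA0 : 0 ≤ u (y + r • e y) := hu0 _ hAΩ (hrS _ (by rw [hch.dist_up y hr.le]))
  have hC0 : 0 ≤ C * u (y + r • e y) := by positivity
  intro x hx hxr
  rcases le_or_gt (dist x y) (2 * r) with h | h
  · exact near x hx hxr h
  set T : Set (ES N) := (closedBall y r)ᶜ with hT
  have hTo : IsOpen T := isClosed_closedBall.isOpen_compl
  have hTS : T ⊆ S := fun z hz => hrS z (by
    rw [hT, mem_compl_iff, mem_closedBall, not_le] at hz; exact hz.le)
  have hD : Ω ∩ T ⊆ Ω ∩ S := inter_subset_inter_right _ hTS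
  have hDo : IsOpen (Ω ∩ T) := hG.opn.inter hTo
  have hSo : IsOpen S := by rw [hS]; exact isClosed_closedBall.isOpen_compl
  have hw : Sp V (Ω ∩ T) (fun x => C * u (y + r • e y) * v x + -(m * u x)) :=
    ((hv.mono hD).smul hC0).add hV hDo inter_subset_left (((hu.2.mono hD).smul hm).congr
      fun x _ => by ring)
  have hLB : LBd Ω S (fun x => C * u (y + r • e y) * v x + -(m * u x)) :=
    (LBd.of_nonneg (fun x hx hxS => mul_nonneg hC0 (hv0 x hx hxS)) hSo).add (huv.neg_LBd m)
  have := max_principle hN hV inter_subset_left hDo (hG.bdd.subset inter_subset_left) hw (by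
    intro ξ hξ ε hε
    rcases lt_or_ge (dist ξ y) (2 * r) with h | h
    · filter_upwards [self_mem_nhdsWithin, mem_nhdsWithin_of_mem_nhds (isOpen_ball.mem_nhds h)]
        with z hz hz'
      have h1 := hz.2
      rw [hT, mem_compl_iff, mem_closedBall, not_le] at h1
      have := near z hz.1 h1.le (le_of_lt hz')
      linarith
    · have hξT : ξ ∈ T := by rw [hT, mem_compl_iff, mem_closedBall, not_le]; linarith
      exact (hLB ξ (frontier_inter_open hTo hξ hξT) (hTS hξT) ε hε).filter_mono
        (nhdsWithin_mono _ inter_subset_left)) x ⟨hx, by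
          rw [hT, mem_compl_iff, mem_closedBall, not_le]; linarith⟩
  linarith

lemma Geo.A_mem (hG : Geo Ω L R e F) {y : ES N} (hy : y ∈ frontier Ω) {r : ℝ} (hr : 0 < r)
    (hrR : r < R) : y + r • e y ∈ Ω := by
  have hch := hG.ch y hy
  rw [hch.mem _ (by rw [mem_ball, hch.dist_up y hr.le]; exact hrR), hch.lin, hch.zero]; linarith

lemma Geo.A_ball (hG : Geo Ω L R e F) {y : ES N} (hy : y ∈ frontier Ω) {r : ℝ} (hr : 0 < r)
    (hrR : 2 * r ≤ R) : ball (y + r • e y) (r / L) ⊆ Ω := by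
  have hch := hG.ch y hy
  have hL := hG.L1
  refine hch.ball_sub ?_ ?_
  · rw [hch.lin, hch.zero, mul_div_cancel₀ _ hch.L0.ne']; linarith
  · rw [hch.dist_up y hr.le]
    have : r / L ≤ r := div_le_self hr.le hL
    linarith

lemma Geo.A_dist (hG : Geo Ω L R e F) {y : ES N} (hy : y ∈ frontier Ω) {r : ℝ} (hr : 0 < r) :
    dist (y + r • e y) y = r := (hG.ch y hy).dist_up y hr.le

/-- Harnack on the corkscrew ball -/
lemma corks (hV : Pot Ω a V) (hG : Geo Ω L R e F) : ∃ c : ℝ, 0 < c ∧ c ≤ 1 ∧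
    ∀ y ∈ frontier Ω, ∀ (r : ℝ) (_ : 0 < r) (_ : 96 * L ^ 2 * r ≤ R) (D : Set (ES N)) (_ : IsOpen D)
      (_ : D ⊆ Ω) (_ : ball (y + r • e y) (r / (4 * L)) ⊆ D) (v : ES N → ℝ)
      (_ : Sol V D v) (_ : ∀ x ∈ D, 0 ≤ v x),
      ∀ x ∈ ball (y + r • e y) (r / (32 * L)), c * v (y + r • e y) ≤ v x := by
  obtain ⟨c, hc0, hc1, H⟩ := wh_step N a
  refine ⟨c, hc0, hc1, ?_⟩
  intro y hy r hr hrR D hDo hDΩ hb v hv hv0 x hx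
  have hL0 : 0 < L := by linarith [hG.L1]
  have hL2 : 1 ≤ L ^ 2 := one_le_pow₀ hG.L1
  have e1 : 16 * (r / (32 * L)) ≤ r / L := by
    rw [← mul_div_assoc, div_le_div_iff₀ (by positivity) (by positivity)]; nlinarith [mul_pos hr hL0]
  have e2 : 8 * (r / (32 * L)) = r / (4 * L) := by field_simp; norm_num
  refine (H Ω D V hV hDΩ hDo v hv.1 (y + r • e y) (r / (32 * L)) (by positivity)
    ((ball_subset_ball e1).trans (hG.A_ball hy hr (by nlinarith))) (by rwa [e2])
    (fun z hz => hv0 z (hb (by rwa [← e2])))).2 hv.2 x ?_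
  rw [mem_ball] at hx
  have : 0 < r / (32 * L) := by positivity
  linarith

lemma outer2 (hN : 0 < N) (hV : Pot Ω a V) (hG : Geo Ω L R e F) : ∃ C : ℝ, 1 ≤ C ∧
    ∀ y ∈ frontier Ω, ∀ (r : ℝ) (_ : 0 < r) (_ : 96 * L ^ 2 * r ≤ R) (u v : ES N → ℝ)
      (S : Set (ES N)) (_ : S = (closedBall y (r / (1000 * L ^ 3)))ᶜ)
      (_ : Sol V (Ω ∩ S) u) (_ : ∀ x ∈ Ω, x ∈ S → 0 ≤ u x) (_ : Van Ω S u)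
      (_ : Sol V (Ω ∩ S) v) (_ : ∀ x ∈ Ω, x ∈ S → 0 ≤ v x),
      ∀ x ∈ Ω, r ≤ dist x y → v (y + r • e y) * u x ≤ C * u (y + r • e y) * v x := by
  obtain ⟨C, hC, H⟩ := outer hN hV hG
  obtain ⟨c, hc0, hc1, H2⟩ := corks hV hG
  refine ⟨C / c, by rw [le_div_iff₀ hc0]; linarith, ?_⟩
  intro y hy r hr hrR u v S hS hu hu0 huv hv hv0 x hx hxr
  have hSo : IsOpen S := by rw [hS]; exact isClosed_closedBall.isOpen_compl
  have hL0 : 0 < L := by linarith [hG.L1]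
  have hL1 := hG.L1
  have hL3 : 1 ≤ L ^ 3 := one_le_pow₀ hG.L1
  have hL2 : 1 ≤ L ^ 2 := one_le_pow₀ hG.L1
  have hrS : ∀ x, r / 2 ≤ dist x y → x ∈ S := by
    intro x hx
    rw [hS, mem_compl_iff, mem_closedBall, not_le]
    refine lt_of_lt_of_le ?_ hx
    rw [div_lt_iff₀ (by positivity)]; nlinarith
  have hAd := hG.A_dist hy hr
  have hA0 : 0 ≤ v (y + r • e y) := hv0 _ (hG.A_mem hy hr (by nlinarith)) (hrS _ (by linarith))
  have e1 : r / (4 * L) ≤ r / L := by gcongr; linarith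
  have e2 : r / (4 * L) ≤ r / 4 := by gcongr; linarith
  have h := H y hy r hr hrR u v S hS hu hu0 huv hv.1 hv0 (c * v (y + r • e y)) (by positivity)
    (H2 y hy r hr hrR (Ω ∩ S) (hG.opn.inter hSo) inter_subset_left (fun z hz =>
      ⟨hG.A_ball hy hr (by nlinarith) (ball_subset_ball e1 hz), hrS z (by
        rw [mem_ball] at hz
        have := dist_triangle (y + r • e y) z y
        rw [dist_comm _ z] at this
        linarith)⟩) v hv (fun z hz => hv0 z hz.1 hz.2)) x hx hxr
  have : v (y + r • e y) * u x = (c * v (y + r • e y) * u x) / c := by field_simp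
  rw [this]
  calc _ ≤ C * u (y + r • e y) * v x / c := by gcongr
    _ = _ := by ring

variable {x₀ : ES N} {k : ES N → ES N → ℝ}

lemma Ker.sol' (hk : Ker Ω V x₀ k) {y : ES N} (hy : y ∈ frontier Ω) {S : Set (ES N)} :
    Sol V (Ω ∩ S) (k y) := (hk.sol y hy).mono inter_subset_left

lemma dist_ge_dista (hG : Geo Ω L R e F) {x y : ES N} (hy : y ∈ frontier Ω) : dista Ω x ≤ dist x y :=
  dista_le_dist (not_mem_of_frontier hG.opn hy)

/-- (5.3) -/
lemma k_cmp (hN : 0 < N) (hV : Pot Ω a V) (hG : Geo Ω L R e F) (hx₀ : x₀ ∈ Ω)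
    (hk : Ker Ω V x₀ k) : ∃ C : ℝ, 1 ≤ C ∧
    ∀ y ∈ frontier Ω, ∀ (r : ℝ) (_ : 0 < r) (_ : 96 * L ^ 2 * r ≤ R) (_ : r ≤ dista Ω x₀),
      ∀ z ∈ frontier Ω, ∀ z' ∈ frontier Ω, dist z y ≤ r / (1000 * L ^ 3) →
        dist z' y ≤ r / (1000 * L ^ 3) → ∀ x ∈ Ω, r ≤ dist x y → k z x ≤ C * k z' x := by
  obtain ⟨C, hC, H⟩ := outer2 hN hV hG
  refine ⟨C * C, by nlinarith, ?_⟩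
  intro y hy r hr hrR hrx z hz z' hz' hzy hzy' x hx hxr
  have hL2 : 1 ≤ L ^ 2 := one_le_pow₀ hG.L1
  have hv : ∀ z ∈ frontier Ω, dist z y ≤ r / (1000 * L ^ 3) →
      Van Ω (closedBall y (r / (1000 * L ^ 3)))ᶜ (k z) := fun z hz hd =>
    (hk.van z hz).mono fun p hp hpz => hp (by rw [mem_singleton_iff.1 hpz]; exact hd)
  have h1 : ∀ z ∈ frontier Ω, ∀ z' ∈ frontier Ω, dist z y ≤ r / (1000 * L ^ 3) →
        dist z' y ≤ r / (1000 * L ^ 3) → ∀ x ∈ Ω, r ≤ dist x y →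
        k z' (y + r • e y) * k z x ≤ C * k z (y + r • e y) * k z' x := by
    intro z hz z' hz' hzy hzy'
    exact H y hy r hr hrR (k z) (k z') _ rfl (hk.sol' hz) (fun x hx _ => (hk.pos z hz x hx).le)
      (hv z hz hzy) (hk.sol' hz') (fun x hx _ => (hk.pos z' hz' x hx).le)
  have h2 := h1 z' hz' z hz hzy' hzy x₀ hx₀ (hrx.trans (dist_ge_dista hG hy))
  rw [hk.one z hz, hk.one z' hz', mul_one, mul_one] at h2
  have h3 := h1 z hz z' hz' hzy hzy' x hx hxr
  have hA := hk.pos z' hz' _ (hG.A_mem hy hr (by nlinarith))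
  have hp := hk.pos z' hz' x hx
  have : k z' (y + r • e y) * k z x ≤ k z' (y + r • e y) * (C * C * k z' x) := by
    calc _ ≤ C * k z (y + r • e y) * k z' x := h3
      _ ≤ C * (C * k z' (y + r • e y)) * k z' x := by gcongr
      _ = _ := by ring
  exact le_of_mul_le_mul_left this hA

/-- (5.2) -/
lemma k_cmp0 (hN : 0 < N) (hV : Pot Ω a V) (hG : Geo Ω L R e F) (hx₀ : x₀ ∈ Ω) (ha : 0 ≤ a)
    {k0 : ES N → ES N → ℝ} (hk : Ker Ω V x₀ k) (hk0 : Ker Ω (fun _ => 0) x₀ k0) : ∃ C : ℝ, 1 ≤ C ∧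
    ∀ y ∈ frontier Ω, ∀ (r : ℝ) (_ : 0 < r) (_ : 96 * L ^ 2 * r ≤ R) (_ : r ≤ dista Ω x₀),
      k0 y (y + r • e y) ≤ C * k y (y + r • e y) := by
  obtain ⟨C, hC, H⟩ := outer hN hV hG
  have hV0 : Pot Ω a (fun _ => 0) := pot_zero hG.opn ha
  obtain ⟨c, hc0, hc1, H2⟩ := corks hV0 hG
  refine ⟨C / c, by rw [le_div_iff₀ hc0]; linarith, ?_⟩
  intro y hy r hr hrR hrx
  have hL0 : 0 < L := by linarith [hG.L1]
  have hL1 := hG.L1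
  have hL3 : 1 ≤ L ^ 3 := one_le_pow₀ hG.L1
  have hL2 : 1 ≤ L ^ 2 := one_le_pow₀ hG.L1
  have e1 : r / (4 * L) ≤ r / L := by gcongr; linarith
  have hA := hk0.pos y hy _ (hG.A_mem hy hr (by nlinarith))
  have hsp : Sp V Ω (k0 y) := (hk0.sol y hy).1.change hV0 hV hG.opn Subset.rfl (fun x hx => by
    rw [zero_mul]; exact mul_nonneg (hV.nn x hx) (hk0.pos y hy x hx).le)
  have h := H y hy r hr hrR (k y) (k0 y) _ rfl (hk.sol' hy) (fun x hx _ => (hk.pos y hy x hx).le)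
    ((hk.van y hy).mono fun p hp hpz => hp (by
      rw [mem_singleton_iff.1 hpz]; exact mem_closedBall_self (by positivity)))
    (hsp.mono inter_subset_left) (fun x hx _ => (hk0.pos y hy x hx).le) (c * k0 y (y + r • e y))
    (by positivity) (H2 y hy r hr hrR Ω hG.opn Subset.rfl
      ((ball_subset_ball e1).trans (hG.A_ball hy hr (by nlinarith))) _ (hk0.sol y hy)
      (fun x hx => (hk0.pos y hy x hx).le)) x₀ hx₀ (hrx.trans (dist_ge_dista hG hy))
  rw [hk.one y hy, hk0.one y hy, mul_one, mul_one] at h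
  rw [div_mul_eq_mul_div, le_div_iff₀ hc0]
  linarith

end


section
variable {N : ℕ} {Ω : Set (ES N)} {a : ℝ} {V : ES N → ℝ} {L R : ℝ} {e : ES N → ES N}
  {F : ES N → ES N → ℝ} {x₀ : ES N} {k : ES N → ES N → ℝ}

lemma osc (hN : 0 < N) (hV : Pot Ω a V) (hG : Geo Ω L R e F) (hx₀ : x₀ ∈ Ω)
    (hk : Ker Ω V x₀ k) : ∃ C q : ℝ, 1 ≤ C ∧ 0 < q ∧ q < 1 ∧
    ∀ y ∈ frontier Ω, ∀ z ∈ frontier Ω, ∀ (ρ : ℝ) (_ : 0 < ρ) (_ : dist z y ≤ ρ / (1000 * L ^ 3))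
      (j : ℕ) (_ : 96 * L ^ 2 * ((1000 * L ^ 3) ^ j * ρ) ≤ R) (_ : (1000 * L ^ 3) ^ j * ρ ≤ dista Ω x₀),
      ∀ x ∈ Ω, (1000 * L ^ 3) ^ j * ρ ≤ dist x y → |k z x - k y x| ≤ C * q ^ j * k y x := by
  obtain ⟨C, hC, H⟩ := outer2 hN hV hG
  obtain ⟨C1, hC1, H1⟩ := k_cmp hN hV hG hx₀ hk
  have hC0 : 0 < C := by linarith
  have hq : 1 / (2 * C) ≤ 1 / 2 := by rw [div_le_div_iff₀ (by positivity) (by positivity)]; linarith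
  have hq' : 0 < 1 / (2 * C) := by positivity
  refine ⟨C1, 1 - 1 / (2 * C), hC1, by linarith, by linarith, ?_⟩
  intro y hy z hz ρ hρ hzy j
  set Λ : ℝ := 1000 * L ^ 3 with hΛ
  have hL0 : 0 < L := by linarith [hG.L1]
  have hL3 : 1 ≤ L ^ 3 := one_le_pow₀ hG.L1
  have hL2 : 1 ≤ L ^ 2 := one_le_pow₀ hG.L1
  have hΛ1 : 1 ≤ Λ := by rw [hΛ]; linarith
  have hpu := hk.pos z hz
  have hpv := hk.pos y hy
  have key : 96 * L ^ 2 * (Λ ^ j * ρ) ≤ R → Λ ^ j * ρ ≤ dista Ω x₀ → ∃ m M : ℝ,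
      M - m ≤ C1 * (1 - 1 / (2 * C)) ^ j ∧ ∀ x ∈ Ω, Λ ^ j * ρ ≤ dist x y →
        m * k y x ≤ k z x ∧ k z x ≤ M * k y x := by
    induction j with
    | zero =>
      intro h1 h2
      simp only [pow_zero, one_mul, mul_one] at h1 h2 ⊢
      refine ⟨0, C1, by linarith, fun x hx hxr => ⟨?_, ?_⟩⟩
      · rw [zero_mul]; exact (hpu x hx).le
      · exact H1 y hy ρ hρ h1 h2 z hz y hy hzy (by rw [dist_self]; positivity) x hx hxr
    | succ j ih =>
      intro h1 h2
      have hle : Λ ^ j * ρ ≤ Λ ^ (j + 1) * ρ := by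
        gcongr
        omega
      obtain ⟨m, M, hmM, hx⟩ := ih (by nlinarith) (hle.trans h2)
      set r := Λ ^ (j + 1) * ρ with hr
      have hr0 : 0 < r := by positivity
      have hrΛ : r / Λ = Λ ^ j * ρ := by
        rw [hr, pow_succ]; field_simp
      set S : Set (ES N) := (closedBall y (r / Λ))ᶜ with hS
      have hSo : IsOpen S := isClosed_closedBall.isOpen_compl
      have hDo : IsOpen (Ω ∩ S) := hG.opn.inter hSo
      have hSx : ∀ x ∈ S, Λ ^ j * ρ ≤ dist x y := by
        intro x hx
        rw [hS, mem_compl_iff, mem_closedBall, not_le, hrΛ] at hx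
        exact hx.le
      have hzS : ∀ p ∈ S, p ≠ z := by
        rintro p hp rfl
        refine hp ?_
        rw [mem_closedBall, hrΛ]
        refine hzy.trans ?_
        rw [div_le_iff₀ (by linarith)]
        have : 1 ≤ Λ ^ j * Λ := by rw [← pow_succ]; exact one_le_pow₀ hΛ1
        nlinarith
      have hyS : ∀ p ∈ S, p ≠ y := by
        rintro p hp rfl
        exact hp (mem_closedBall_self (by positivity))
      have vu : Van Ω S (k z) := (hk.van z hz).mono hzS
      have vv : Van Ω S (k y) := (hk.van y hy).mono hyS
      have su : Sol V (Ω ∩ S) (k z) := hk.sol' hz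
      have sv : Sol V (Ω ∩ S) (k y) := hk.sol' hy
      have hAS : y + r • e y ∈ S := by
        rw [hS, mem_compl_iff, mem_closedBall, not_le, hG.A_dist hy hr0, div_lt_iff₀ (by linarith)]
        nlinarith
      have hAΩ : y + r • e y ∈ Ω := hG.A_mem hy hr0 (by nlinarith)
      have hvA := hpv _ hAΩ
      have step : ∀ w : ES N → ℝ, Sol V (Ω ∩ S) w → (∀ x ∈ Ω, x ∈ S → 0 ≤ w x) →
          (M - m) / 2 * k y (y + r • e y) ≤ w (y + r • e y) →
          ∀ x ∈ Ω, r ≤ dist x y → (M - m) * (1 / (2 * C)) * k y x ≤ w x := by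
        intro w hw hw0 hwA x hxΩ hxr
        have h := H y hy r hr0 h1 (k y) w S rfl sv (fun x hx _ => (hpv x hx).le) vv hw hw0 x hxΩ hxr
        have hv := hpv x hxΩ
        have h3 : (M - m) / 2 * k y (y + r • e y) * k y x ≤ C * k y (y + r • e y) * w x :=
          (mul_le_mul_of_nonneg_right hwA hv.le).trans h
        have h4 : k y (y + r • e y) * ((M - m) / 2 * k y x) ≤ k y (y + r • e y) * (C * w x) := by
          linarith
        have h5 := le_of_mul_le_mul_left h4 hvA
        have : (M - m) * (1 / (2 * C)) * k y x = ((M - m) / 2 * k y x) / C := by field_simp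
        rw [this, div_le_iff₀ hC0]; linarith
      have hnew : (M - m) * (1 - 1 / (2 * C)) ≤ C1 * (1 - 1 / (2 * C)) ^ (j + 1) := by
        rw [pow_succ, ← mul_assoc]
        exact mul_le_mul_of_nonneg_right hmM (by linarith)
      rcases le_total ((M - m) / 2 * k y (y + r • e y)) (M * k y (y + r • e y) - k z (y + r • e y))
        with hh | hh
      · have h6 := step (fun x => M * k y x + -1 * k z x)
          ((sv.smul M).add hV hDo inter_subset_left (su.smul (-1)))
          (fun x hxΩ hxS => by linarith [(hx x hxΩ (hSx x hxS)).2]) (by linarith)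
        refine ⟨m, M - (M - m) * (1 / (2 * C)), by linarith, fun x hxΩ hxr => ⟨?_, ?_⟩⟩
        · exact (hx x hxΩ (hle.trans hxr)).1
        · have := h6 x hxΩ hxr
          linarith
      · have h6 := step (fun x => k z x + -m * k y x)
          (su.add hV hDo inter_subset_left (sv.smul (-m)))
          (fun x hxΩ hxS => by linarith [(hx x hxΩ (hSx x hxS)).1]) (by linarith)
        refine ⟨m + (M - m) * (1 / (2 * C)), M, by linarith, fun x hxΩ hxr => ⟨?_, ?_⟩⟩
        · have := h6 x hxΩ hxr
          linarith
        · exact (hx x hxΩ (hle.trans hxr)).2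
  intro h1 h2 x hx hxr
  obtain ⟨m, M, hmM, hb⟩ := key h1 h2
  have h0 := hb x₀ hx₀ (h2.trans (dist_ge_dista hG hy))
  rw [hk.one y hy, hk.one z hz, mul_one, mul_one] at h0
  have h3 := hb x hx hxr
  have hv := (hpv x hx).le
  have h4 : (M - m) * k y x ≤ C1 * (1 - 1 / (2 * C)) ^ j * k y x := mul_le_mul_of_nonneg_right hmM hv
  rw [abs_le]
  constructor
  · nlinarith
  · nlinarith

lemma dista_pos (hN : 0 < N) (hG : Geo Ω L R e F) {x : ES N} (hx : x ∈ Ω) : 0 < dista Ω x := by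
  obtain ⟨s, hs, hb⟩ := Metric.isOpen_iff.1 hG.opn x hx
  exact hs.trans_le (le_dista_of_ball_sub (compl_nonempty hN hG.bdd) hb)

lemma k_cont (hN : 0 < N) (hV : Pot Ω a V) (hG : Geo Ω L R e F) (hx₀ : x₀ ∈ Ω)
    (hk : Ker Ω V x₀ k) : ContinuousOn (fun p : ES N × ES N => k p.1 p.2) (frontier Ω ×ˢ Ω) := by
  obtain ⟨C, q, hC, hq0, hq1, H⟩ := osc hN hV hG hx₀ hk
  rintro ⟨y, x⟩ ⟨hy, hx⟩
  simp only at hy hx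
  have hL0 : 0 < L := by linarith [hG.L1]
  have hΛ : 0 < 1000 * L ^ 3 := by positivity
  have hL2 : 1 ≤ L ^ 2 := one_le_pow₀ hG.L1
  have hdx := dista_pos hN hG hx
  have hdx0 := dista_pos hN hG hx₀
  set r := min (min (R / (96 * L ^ 2)) (dista Ω x₀)) (dista Ω x / 2) with hr
  have hr0 : 0 < r := by have := hG.R0; rw [hr]; positivity
  have hr1 : r ≤ R / (96 * L ^ 2) := (min_le_left _ _).trans (min_le_left _ _)
  have hr2 : r ≤ dista Ω x₀ := (min_le_left _ _).trans (min_le_right _ _)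
  have hr3 : r ≤ dista Ω x / 2 := min_le_right _ _
  rw [le_div_iff₀ (by positivity)] at hr1
  rw [ContinuousWithinAt, Metric.tendsto_nhds]
  intro ε hε
  have hcx : ContinuousAt (k y) x := (hk.sol y hy).1.1.continuousAt (hG.opn.mem_nhds hx)
  have hkx := hk.pos y hy x hx
  obtain ⟨j, hj⟩ := exists_pow_lt_of_lt_one (show 0 < ε / 2 / (C * (2 * k y x)) by positivity) hq1
  set ρ := r / (1000 * L ^ 3) ^ j with hρ
  have hρ0 : 0 < ρ := by positivity
  have hρr : (1000 * L ^ 3) ^ j * ρ = r := by rw [hρ]; field_simp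
  have ev1 : ∀ᶠ p : ES N × ES N in 𝓝 (y, x), dist p.1 y < ρ / (1000 * L ^ 3) :=
    (continuous_fst.continuousAt (x := (y, x))) (ball_mem_nhds y (by positivity))
  have ev2 : ∀ᶠ p : ES N × ES N in 𝓝 (y, x), dist p.2 x < r :=
    (continuous_snd.continuousAt (x := (y, x))) (ball_mem_nhds x hr0)
  have ev3 : ∀ᶠ p : ES N × ES N in 𝓝 (y, x), |k y p.2 - k y x| < min (ε / 2) (k y x) := by
    have : Tendsto (fun p : ES N × ES N => k y p.2) (𝓝 (y, x)) (𝓝 (k y x)) :=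
      hcx.tendsto.comp continuous_snd.continuousAt
    have h := (Metric.tendsto_nhds.1 this) (min (ε / 2) (k y x)) (by positivity)
    simpa only [Real.dist_eq] using h
  filter_upwards [self_mem_nhdsWithin, mem_nhdsWithin_of_mem_nhds ev1,
    mem_nhdsWithin_of_mem_nhds ev2, mem_nhdsWithin_of_mem_nhds ev3]
  rintro ⟨z, x'⟩ ⟨hz, hx'⟩ h1 h2 h3
  simp only [mem_setOf_eq] at hz hx' h1 h2 h3 ⊢
  have h4 := H y hy z hz ρ hρ0 h1.le j (by rw [hρr]; linarith) (by rwa [hρr]) x' hx' (by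
    rw [hρr]
    have := dist_triangle x x' y
    rw [dist_comm x x'] at this
    linarith [dist_ge_dista (x := x) hG hy])
  have h5 := lt_min_iff.1 h3
  have h6 : k y x' ≤ 2 * k y x := by linarith [(abs_lt.1 h5.2).2]
  rw [lt_div_iff₀ (by positivity)] at hj
  have h7 : C * q ^ j * k y x' ≤ C * q ^ j * (2 * k y x) := by gcongr
  rw [Real.dist_eq]
  have h8 := abs_add_le (k z x' - k y x') (k y x' - k y x)
  rw [sub_add_sub_cancel] at h8
  linarith [h5.1]

/-- kernel potential -/
def pot (k : ES N → ES N → ℝ) (θ : Measure (ES N)) (x : ES N) : ℝ := ∫ z, k z x ∂θ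

lemma frontier_compact (hG : Geo Ω L R e F) : IsCompact (frontier Ω) :=
  isCompact_of_isClosed_isBounded isClosed_frontier
    (hG.bdd.closure.subset frontier_subset_closure)

lemma restr_fr {θ : Measure (ES N)} (h : θ (frontier Ω)ᶜ = 0) : θ.restrict (frontier Ω) = θ :=
  Measure.restrict_eq_self_of_ae_mem (mem_ae_iff.2 h)

section
variable {Ω' : Set (ES N)} {θ : Measure (ES N)} [IsFiniteMeasure θ] {f : ES N × ES N → ℝ}
lemma fr_int (hG : Geo Ω L R e F) (hθ : θ (frontier Ω)ᶜ = 0)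
    {g : ES N → ℝ} (hg : ContinuousOn g (frontier Ω)) : Integrable g θ := by
  rw [← restr_fr hθ]
  exact hg.integrableOn_compact (frontier_compact hG)
end

lemma k_int {θ : Measure (ES N)} [IsFiniteMeasure θ]
    (hc : ContinuousOn (fun p : ES N × ES N => k p.1 p.2) (frontier Ω ×ˢ Ω)) (hG : Geo Ω L R e F)
    (hθ : θ (frontier Ω)ᶜ = 0) {x : ES N} (hx : x ∈ Ω) : Integrable (fun z => k z x) θ :=
  fr_int hG hθ (hc.comp (by fun_prop : Continuous fun z : ES N => (z, x)).continuousOn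
    fun z hz => ⟨hz, hx⟩)

lemma pot_cont {θ : Measure (ES N)} [IsFiniteMeasure θ]
    (hc : ContinuousOn (fun p : ES N × ES N => k p.1 p.2) (frontier Ω ×ˢ Ω)) (hG : Geo Ω L R e F)
    (hθ : θ (frontier Ω)ᶜ = 0) : ContinuousOn (pot k θ) Ω := by
  intro x hx
  obtain ⟨s, hs, hb⟩ := Metric.nhds_basis_closedBall.mem_iff.1 (hG.opn.mem_nhds hx)
  obtain ⟨B, hB⟩ := ((frontier_compact hG).prod (isCompact_closedBall x s)).exists_bound_of_continuousOn
    (hc.mono (prod_mono_right hb))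
  refine ContinuousAt.continuousWithinAt ?_
  refine continuousAt_of_dominated (bound := fun _ => B) ?_ ?_ (integrable_const _) ?_
  · filter_upwards [closedBall_mem_nhds x hs] with x' hx'
    exact (k_int hc hG hθ (hb hx')).aestronglyMeasurable
  · filter_upwards [closedBall_mem_nhds x hs] with x' hx'
    filter_upwards [mem_ae_iff.2 hθ] with z hz
    exact hB (z, x') ⟨hz, hx'⟩
  · filter_upwards [mem_ae_iff.2 hθ] with z hz
    exact (hc.comp (by fun_prop : Continuous fun x : ES N => (z, x)).continuousOn
      (fun x hx => ⟨hz, hx⟩) : ContinuousOn (fun x => k z x) Ω).continuousAt (hG.opn.mem_nhds hx)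

lemma pot_swap {θ : Measure (ES N)} [IsFiniteMeasure θ]
    (hc : ContinuousOn (fun p : ES N × ES N => k p.1 p.2) (frontier Ω ×ˢ Ω)) (hG : Geo Ω L R e F)
    (hθ : θ (frontier Ω)ᶜ = 0) {T : Set (ES N)} (hT : IsCompact T) (hTΩ : T ⊆ Ω) {g : ES N → ℝ}
    (hgm : Measurable g) {B : ℝ} (hgB : ∀ x ∈ T, |g x| ≤ B) (hg0 : ∀ x, x ∉ T → g x = 0) :
    ∫ x, g x * pot k θ x = ∫ z, (∫ x, g x * k z x) ∂θ := by
  have h1 : ∀ f : ES N → ℝ, ∫ x, g x * f x = ∫ x in T, g x * f x := fun f =>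
    (setIntegral_eq_integral_of_forall_compl_eq_zero fun x hx => by rw [hg0 x hx, zero_mul]).symm
  simp only [h1, pot]
  have hT0 : volume T < ⊤ := hT.measure_lt_top
  have : IsFiniteMeasure (volume.restrict T) := ⟨by rwa [Measure.restrict_apply_univ]⟩
  have hk : Integrable (fun p : ES N × ES N => k p.1 p.2) (θ.prod (volume.restrict T)) := by
    rw [← restr_fr hθ, Measure.prod_restrict]
    exact (hc.mono (prod_mono_right hTΩ)).integrableOn_compact ((frontier_compact hG).prod hT)
  have hgk : Integrable (fun p : ES N × ES N => g p.2 * k p.1 p.2) (θ.prod (volume.restrict T)) := by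
    refine hk.bdd_mul (c := B) (hgm.comp measurable_snd).aestronglyMeasurable ?_
    have : ∀ᵐ p ∂(θ.prod (volume.restrict T)), p.2 ∈ T :=
      Measure.quasiMeasurePreserving_snd.ae (ae_restrict_mem hT.measurableSet)
    filter_upwards [this] with p hp
    exact hgB _ hp
  rw [integral_integral_swap hgk]
  refine integral_congr_ae (ae_of_all _ fun x => ?_)
  simp only
  rw [integral_const_mul]

lemma Sol.eq {D : Set (ES N)} {u : ES N → ℝ} (h : Sol V D u) {φ : ES N → ℝ} (hφ : IsTestFun D φ)
    (h0 : ∀ x, 0 ≤ φ x) : ∫ x, u x * lap φ x = ∫ x, V x * u x * φ x := by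
  refine le_antisymm (h.1.2 φ hφ h0) ?_
  have := h.2.2 φ hφ h0
  simp only [neg_mul, mul_neg, integral_neg] at this
  linarith

lemma pot_sol (hV : Pot Ω a V) {θ : Measure (ES N)} [IsFiniteMeasure θ]
    (hc : ContinuousOn (fun p : ES N × ES N => k p.1 p.2) (frontier Ω ×ˢ Ω)) (hG : Geo Ω L R e F)
    (hk : Ker Ω V x₀ k) (hθ : θ (frontier Ω)ᶜ = 0) : Sol V Ω (pot k θ) := by
  have key : ∀ φ, IsTestFun Ω φ → (∀ x, 0 ≤ φ x) →
      ∫ x, pot k θ x * lap φ x = ∫ x, V x * pot k θ x * φ x := by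
    intro φ hφ h0
    have e1 : ∀ x, pot k θ x * lap φ x = lap φ x * pot k θ x := fun x => mul_comm _ _
    have e2 : ∀ x, V x * pot k θ x * φ x = (V x * φ x) * pot k θ x := fun x => by ring
    simp only [e1, e2]
    have hT : IsCompact (tsupport φ) := hφ.2.1
    have hTΩ : tsupport φ ⊆ Ω := hφ.2.2
    obtain ⟨B1, hB1⟩ := hT.exists_bound_of_continuousOn (lap_cont hφ.1).continuousOn
    obtain ⟨B2, hB2⟩ := hV.bdd hT hTΩ
    obtain ⟨B3, hB3⟩ := hT.exists_bound_of_continuousOn hφ.1.continuous.continuousOn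
    rw [pot_swap hc hG hθ hT hTΩ (lap_cont hφ.1).measurable hB1 (fun x hx => by
        by_contra hne
        exact hx (lap_tsupport φ (subset_tsupport _ hne))),
      pot_swap hc hG hθ hT hTΩ (g := fun x => V x * φ x)
        (hV.meas.mul hφ.1.continuous.measurable) (B := B2 * B3) (by
        intro x hx
        rw [abs_mul]
        exact mul_le_mul (hB2 x hx) (hB3 x hx) (abs_nonneg _) ((abs_nonneg _).trans (hB2 x hx)))
        (fun x hx => by rw [image_eq_zero_of_notMem_tsupport hx, mul_zero])]
    refine integral_congr_ae ?_
    filter_upwards [mem_ae_iff.2 hθ] with z hz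
    have := (hk.sol z hz).eq hφ h0
    calc _ = ∫ x, k z x * lap φ x := by congr 1; ext x; ring
      _ = _ := this
      _ = _ := by congr 1; ext x; ring
  refine ⟨⟨pot_cont hc hG hθ, fun φ hφ h0 => (key φ hφ h0).le⟩,
    ⟨(pot_cont hc hG hθ).neg, fun φ hφ h0 => ?_⟩⟩
  simp only [neg_mul, mul_neg, integral_neg]
  rw [key φ hφ h0]

lemma pot_nonneg (hk : Ker Ω V x₀ k) {θ : Measure (ES N)} (hθ : θ (frontier Ω)ᶜ = 0) {x : ES N}
    (hx : x ∈ Ω) : 0 ≤ pot k θ x := by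
  refine integral_nonneg_of_ae ?_
  filter_upwards [mem_ae_iff.2 hθ] with z hz
  exact (hk.pos z hz x hx).le

lemma pot_x₀ (hk : Ker Ω V x₀ k) {θ : Measure (ES N)} (hθ : θ (frontier Ω)ᶜ = 0) :
    pot k θ x₀ = θ.real univ := by
  have : pot k θ x₀ = ∫ z, (1:ℝ) ∂θ := integral_congr_ae (by
    filter_upwards [mem_ae_iff.2 hθ] with z hz
    exact hk.one z hz)
  rw [this, integral_const, smul_eq_mul, mul_one]

end


section
variable {N : ℕ} {Ω : Set (ES N)} {a : ℝ} {V : ES N → ℝ} {L R : ℝ} {e : ES N → ES N}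
  {F : ES N → ES N → ℝ} {x₀ : ES N} {k : ES N → ES N → ℝ}

structure Env (Ω : Set (ES N)) (a : ℝ) (V : ES N → ℝ) (L R : ℝ) (e : ES N → ES N)
    (F : ES N → ES N → ℝ) (x₀ : ES N) (k : ES N → ES N → ℝ) : Prop where
  hN : 0 < N
  hV : Pot Ω a V
  hG : Geo Ω L R e F
  hx₀ : x₀ ∈ Ω
  hk : Ker Ω V x₀ k

namespace Env

lemma hc (E : Env Ω a V L R e F x₀ k) : ContinuousOn (fun p : ES N × ES N => k p.1 p.2) (frontier Ω ×ˢ Ω) :=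
  k_cont E.hN E.hV E.hG E.hx₀ E.hk

lemma L0 (E : Env Ω a V L R e F x₀ k) : 0 < L := by linarith [E.hG.L1]

lemma L2 (E : Env Ω a V L R e F x₀ k) : 1 ≤ L ^ 2 := one_le_pow₀ E.hG.L1

lemma LL2 (E : Env Ω a V L R e F x₀ k) : L ≤ L ^ 2 := by nlinarith [E.hG.L1]

lemma A_dista (E : Env Ω a V L R e F x₀ k) {y : ES N} (hy : y ∈ frontier Ω) {r : ℝ} (hr : 0 < r) (hrR : 96 * L ^ 2 * r ≤ R) :
    r / L ≤ dista Ω (y + r • e y) :=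
  le_dista_of_ball_sub (compl_nonempty E.hN E.hG.bdd)
    (E.hG.A_ball hy hr (by nlinarith [E.L2]))

lemma A_mem (E : Env Ω a V L R e F x₀ k) {y : ES N} (hy : y ∈ frontier Ω) {r : ℝ} (hr : 0 < r) (hrR : 96 * L ^ 2 * r ≤ R) :
    y + r • e y ∈ Ω := E.hG.A_mem hy hr (by nlinarith [E.L2])

lemma F_A (E : Env Ω a V L R e F x₀ k) {y : ES N} (hy : y ∈ frontier Ω) {r : ℝ} : F y (y + r • e y) = r := by
  rw [(E.hG.ch y hy).lin, (E.hG.ch y hy).zero, zero_add]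

lemma dista_le_F (E : Env Ω a V L R e F x₀ k) {y x : ES N} (hy : y ∈ frontier Ω) (hx : x ∈ Ω) (hd : (L + 1) * dist x y < R) :
    dista Ω x ≤ F y x := by
  have hch := E.hG.ch y hy
  have hL := E.L0
  have h1 := hch.F_le x
  have hxb : dist x y < R := by nlinarith [dist_nonneg (x := x) (y := y)]
  have h0 : 0 < F y x := (hch.mem x hxb).1 hx
  have hp : dist (x - F y x • e y) x = F y x := hch.dist_down x h0.le
  have hfr := hch.mem_frontier E.hG.opn (hch.foot x) (by
    have := dist_triangle (x - F y x • e y) x y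
    nlinarith)
  have := dist_ge_dista (x := x) E.hG hfr
  rwa [dist_comm, hp] at this

/-- Harnack between two points at comparable scale near `y` for positive global solutions -/
lemma conn' (E : Env Ω a V L R e F x₀ k) (M ε : ℝ) (hM : 1 ≤ M) (hε0 : 0 < ε) (hε1 : ε ≤ 1) : ∃ C : ℝ, 1 ≤ C ∧
    ∀ y ∈ frontier Ω, ∀ (r : ℝ) (_ : 0 < r) (_ : 4 * L * M * r ≤ R) (w : ES N → ℝ) (_ : Sol V Ω w)
      (_ : ∀ x ∈ Ω, 0 ≤ w x) (x x' : ES N) (_ : ε * r ≤ F y x) (_ : ε * r ≤ F y x')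
      (_ : dist x y ≤ M * r) (_ : dist x' y ≤ M * r), w x ≤ C * w x' := by
  obtain ⟨c, hc0, hc1, H⟩ := conn E.hV L E.hG.L1 M ε hM hε0 hε1
  refine ⟨1 / c, by rw [le_div_iff₀ hc0]; linarith, ?_⟩
  intro y hy r hr hrR w hw hw0 x x' h1 h2 h3 h4
  have h := (H R y (e y) (F y) (E.hG.ch y hy) Ω Subset.rfl E.hG.opn w hw.1 hw0 r hr (by
    intro x hx hxd
    rw [(E.hG.ch y hy).mem x (by rw [mem_ball]; linarith)]
    have : 0 < ε / 2 * r := by positivity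
    linarith) x x' h1 h2 h3 h4).2 hw.2
  rw [div_mul_eq_mul_div, le_div_iff₀ hc0]; linarith

lemma glob (E : Env Ω a V L R e F x₀ k) (η : ℝ) (hη : 0 < η) : ∃ C : ℝ, 1 ≤ C ∧ ∀ x ∈ Ω, η ≤ dista Ω x →
    ∀ w : ES N → ℝ, Sol V Ω w → (∀ x ∈ Ω, 0 ≤ w x) → w x₀ ≤ C * w x ∧ w x ≤ C * w x₀ := by
  obtain ⟨c, hc0, hc1, H⟩ := harnack_glob E.hN E.hV E.hG.bdd E.hG.conn E.hx₀ η hη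
  refine ⟨1 / c, by rw [le_div_iff₀ hc0]; linarith, ?_⟩
  intro x _ hxη w hw hw0
  have h := H x hxη w hw.1 hw.2 hw0
  constructor <;> (rw [div_mul_eq_mul_div, le_div_iff₀ hc0]; linarith)

lemma kn (E : Env Ω a V L R e F x₀ k) {z : ES N} (hz : z ∈ frontier Ω) : ∀ x ∈ Ω, 0 ≤ k z x := fun x hx => (E.hk.pos z hz x hx).le

lemma globk (E : Env Ω a V L R e F x₀ k) (η : ℝ) (hη : 0 < η) : ∃ C : ℝ, 1 ≤ C ∧ ∀ x ∈ Ω, η ≤ dista Ω x →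
    ∀ z ∈ frontier Ω, 1 ≤ C * k z x ∧ k z x ≤ C := by
  obtain ⟨C, hC, H⟩ := E.glob η hη
  refine ⟨C, hC, fun x hx hd z hz => ?_⟩
  have := H x hx hd (k z) (E.hk.sol z hz) (E.kn hz)
  rwa [E.hk.one z hz, mul_one] at this

lemma lem2a (E : Env Ω a V L R e F x₀ k) (B : ℝ) (hB : 1 ≤ B) : ∃ C : ℝ, 1 ≤ C ∧
    ∀ y ∈ frontier Ω, ∀ (s : ℝ) (_ : 0 < s) (_ : 96 * L ^ 2 * s ≤ R), ∀ z ∈ frontier Ω,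
      ∀ z' ∈ frontier Ω, dist z y ≤ B * s → dist z' y ≤ B * s →
        k z (y + s • e y) ≤ C * k z' (y + s • e y) := by
  have hL0 := E.L0
  have hL2 := E.L2
  have hL3 : 1 ≤ L ^ 3 := one_le_pow₀ E.hG.L1
  have hR := E.hG.R0
  have hδ := dista_pos E.hN E.hG E.hx₀
  set Λ : ℝ := 1000 * L ^ 3 with hΛ
  have hΛ1 : 1 ≤ Λ := by linarith
  have hBΛ : 1 ≤ B * Λ := by nlinarith
  set s0 : ℝ := min (R / (96 * L ^ 2)) (dista Ω x₀) / (B * Λ) with hs0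
  have hs00 : 0 < s0 := by positivity
  obtain ⟨C1, hC1, H1⟩ := k_cmp E.hN E.hV E.hG E.hx₀ E.hk
  obtain ⟨C2, hC2, H2⟩ := E.conn' (B * Λ) 1 hBΛ one_pos le_rfl
  obtain ⟨C3, hC3, H3⟩ := E.globk (s0 / L) (by positivity)
  refine ⟨C2 * (C1 * C2) + C3 * C3, by nlinarith [mul_pos (show 0 < C2 by linarith) (show 0 < C1 by linarith)], ?_⟩
  intro y hy s hs hsR z hz z' hz' hzy hzy'
  have hAΩ := E.A_mem hy hs hsR
  have hp := E.kn hz' _ hAΩ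
  have hCC : 0 ≤ C2 * (C1 * C2) := by positivity
  rcases le_or_gt s s0 with hss | hss
  · set r := B * Λ * s with hr
    have hr0 : 0 < r := by positivity
    have hrm : r ≤ min (R / (96 * L ^ 2)) (dista Ω x₀) := by
      rw [hs0, le_div_iff₀ (by positivity)] at hss; linarith
    have hr1 : 96 * L ^ 2 * r ≤ R := by
      have := hrm.trans (min_le_left _ _)
      rw [le_div_iff₀ (by positivity)] at this; linarith
    have hrB : r / Λ = B * s := by rw [hr]; field_simp
    have k1 := H1 y hy r hr0 hr1 (hrm.trans (min_le_right _ _)) z hz z' hz' (by rw [hrB]; exact hzy)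
      (by rw [hrB]; exact hzy') _ (E.A_mem hy hr0 hr1) (E.hG.A_dist hy hr0).ge
    have hsr : s ≤ r := by rw [hr]; nlinarith
    have h4 : 4 * L * (B * Λ) * s ≤ R := by
      have : 4 * L * r ≤ 96 * L ^ 2 * r := by nlinarith [E.LL2]
      rw [hr] at this hr1; linarith
    have hA1 : dist (y + s • e y) y ≤ B * Λ * s := by rw [E.hG.A_dist hy hs]; exact hsr
    have hA2 : dist (y + r • e y) y ≤ B * Λ * s := by rw [E.hG.A_dist hy hr0]
    have hF1 : 1 * s ≤ F y (y + s • e y) := by rw [E.F_A hy, one_mul]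
    have hF2 : 1 * s ≤ F y (y + r • e y) := by rw [E.F_A hy, one_mul]; exact hsr
    have k2 := H2 y hy s hs h4 (k z) (E.hk.sol z hz) (E.kn hz) _ _ hF1 hF2 hA1 hA2
    have k3 := H2 y hy s hs h4 (k z') (E.hk.sol z' hz') (E.kn hz') _ _ hF2 hF1 hA2 hA1
    calc k z (y + s • e y) ≤ C2 * k z (y + r • e y) := k2
      _ ≤ C2 * (C1 * k z' (y + r • e y)) := by gcongr
      _ ≤ C2 * (C1 * (C2 * k z' (y + s • e y))) := by gcongr
      _ = C2 * (C1 * C2) * k z' (y + s • e y) := by ring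
      _ ≤ _ := by gcongr; nlinarith
  · have hd : s0 / L ≤ dista Ω (y + s • e y) := le_trans (by gcongr) (E.A_dista hy hs hsR)
    have k1 := (H3 _ hAΩ hd z hz).2
    have k2 := (H3 _ hAΩ hd z' hz').1
    calc k z (y + s • e y) ≤ C3 * 1 := by linarith
      _ ≤ C3 * (C3 * k z' (y + s • e y)) := by gcongr
      _ = C3 * C3 * k z' (y + s • e y) := by ring
      _ ≤ _ := by gcongr; linarith

lemma diam (E : Env Ω a V L R e F x₀ k) : ∃ Δ : ℝ, 1 ≤ Δ ∧ ∀ y ∈ closure Ω, ∀ z ∈ closure Ω, dist y z ≤ Δ := by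
  obtain ⟨C, hC⟩ := Metric.isBounded_iff.1 E.hG.bdd.closure
  exact ⟨max C 1, le_max_right _ _, fun y hy z hz => (hC hy hz).trans (le_max_left _ _)⟩

set_option maxHeartbeats 1000000 in
lemma lem2 (E : Env Ω a V L R e F x₀ k) (κ M : ℝ) (hκ : 1 ≤ κ) (hM : 0 ≤ M) : ∃ C ρ₀ : ℝ, 1 ≤ C ∧ 0 < ρ₀ ∧
    ∀ y ∈ frontier Ω, ∀ x ∈ Ω, dist x y ≤ κ * dista Ω x → dist x y < ρ₀ → ∀ z ∈ frontier Ω,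
      ∀ z' ∈ frontier Ω, dist z' y ≤ 2 * dist z y + M * dist x y → k z x ≤ C * k z' x := by
  have hL0 := E.L0
  have hL1 := E.hG.L1
  have hL2 := E.L2
  have hLL := E.LL2
  have hR := E.hG.R0
  obtain ⟨Δ, hΔ1, hΔ⟩ := E.diam
  set s1 : ℝ := R / (96 * L ^ 2) with hs1
  have hs10 : 0 < s1 := by positivity
  set B : ℝ := (2 + M) * (96 * L ^ 2 + Δ / s1) with hB
  have hB1 : (2 + M) * (96 * L ^ 2) ≤ B := by rw [hB]; gcongr; linarith [show 0 ≤ Δ / s1 by positivity]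
  have hB2 : (2 + M) * (Δ / s1) ≤ B := by rw [hB]; gcongr; nlinarith
  have hB3 : 1 ≤ B := by nlinarith
  obtain ⟨C1, hC1, H1⟩ := E.lem2a B hB3
  obtain ⟨C2, hC2, H2⟩ := E.conn' 1 (1 / κ) le_rfl (by positivity)
    (by rw [div_le_one (by linarith)]; exact hκ)
  obtain ⟨C3, hC3, H3⟩ := bhp E.hN E.hV L E.hG.L1
  obtain ⟨c, hc0, hc1, H4⟩ := corks E.hV E.hG
  have hD : 0 ≤ C3 * C1 / c := by positivity
  have hD' : 1 ≤ C2 * (C1 * C2) := by nlinarith [mul_pos (show 0 < C2 by linarith) (show 0 < C1 by linarith)]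
  refine ⟨C3 * C1 / c + C2 * (C1 * C2), s1, by linarith, hs10, ?_⟩
  intro y hy x hx hxy hxρ z hz z' hz' hzz
  set ρ := dist x y with hρ
  have hxΩ := dista_pos E.hN E.hG hx
  have hρ0 : 0 < ρ := hxΩ.trans_le (dist_ge_dista E.hG hy)
  have hp := E.kn hz' x hx
  have hs1R : 96 * L ^ 2 * s1 = R := by rw [hs1]; field_simp
  rcases lt_or_ge (96 * L ^ 2 * ρ) (dist z y) with hd | hd
  · set d := dist z y with hd'
    have hd0 : 0 < d := lt_of_le_of_lt (by positivity) hd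
    set s := min (d / (96 * L ^ 2)) s1 with hs
    have hρs : ρ < s := lt_min (by rw [lt_div_iff₀ (by positivity)]; linarith) hxρ
    have hs0 : 0 < s := by linarith
    have hsR : 96 * L ^ 2 * s ≤ R := by
      rw [← hs1R]; gcongr; exact min_le_right _ _
    have hsd : 96 * L ^ 2 * s ≤ d := by
      have := min_le_left (d / (96 * L ^ 2)) s1
      rw [← hs, le_div_iff₀ (by positivity)] at this; linarith
    have hΔd : d ≤ Δ := hΔ z (frontier_subset_closure hz) y (frontier_subset_closure hy)
    have hdB : (2 + M) * d ≤ B * s := by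
      rcases min_choice (d / (96 * L ^ 2)) s1 with h | h
      · have : 96 * L ^ 2 * s = d := by rw [hs, h]; field_simp
        rw [← this]; calc _ = (2 + M) * (96 * L ^ 2) * s := by ring
          _ ≤ _ := by gcongr
      · have h' : s = s1 := h
        calc (2 + M) * d ≤ (2 + M) * Δ := by gcongr
          _ = (2 + M) * (Δ / s1) * s := by rw [h']; field_simp
          _ ≤ _ := by gcongr
    have hρd : ρ ≤ d := by nlinarith
    have hm1 : M * ρ ≤ M * d := by gcongr
    have hm2 : 0 ≤ M * d := by positivity
    have hz'B : dist z' y ≤ B * s := by linarith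
    have hzB : d ≤ B * s := by linarith
    have k1 := H1 y hy s hs0 hsR z hz z' hz' hzB hz'B
    have hAΩ := E.A_mem hy hs0 hsR
    have hA := E.hk.pos z' hz' _ hAΩ
    have e1 : s / (4 * L) ≤ s / L := by gcongr; linarith
    have k2 := H3 R y (e y) (F y) (E.hG.ch y hy) s hs0 hsR (k z) (k z') (E.hk.sol' hz).1
      (E.hk.sol' hz).2 (fun x hx _ => E.kn hz x hx) ((E.hk.van z hz).mono (by
        rintro p hp rfl
        rw [mem_ball] at hp
        linarith)) (E.hk.sol' hz').1 (fun x hx _ => E.kn hz' x hx) (c * k z' (y + s • e y))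
      (by positivity) (H4 y hy s hs0 hsR Ω E.hG.opn Subset.rfl
        ((ball_subset_ball e1).trans (E.hG.A_ball hy hs0 (by nlinarith))) _ (E.hk.sol z' hz')
        (E.kn hz')) x hx hρs
    have k3 : k z' (y + s • e y) * (c * k z x) ≤ k z' (y + s • e y) * (C3 * C1 * k z' x) := by
      calc _ = c * k z' (y + s • e y) * k z x := by ring
        _ ≤ C3 * k z (y + s • e y) * k z' x := k2
        _ ≤ C3 * (C1 * k z' (y + s • e y)) * k z' x := by gcongr
        _ = _ := by ring
    have k4 := le_of_mul_le_mul_left k3 hA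
    calc k z x ≤ C3 * C1 / c * k z' x := by
          rw [div_mul_eq_mul_div, le_div_iff₀ hc0]; linarith
      _ ≤ _ := by gcongr; linarith
  · have hρR : 96 * L ^ 2 * ρ ≤ R := by rw [← hs1R]; gcongr
    have hB4 : (2 + M) * (96 * L ^ 2) * ρ ≤ B * ρ := by gcongr
    have hm1 : M * ρ * 1 ≤ M * ρ * (96 * L ^ 2) := by gcongr; linarith
    have hm2 : 0 ≤ 96 * L ^ 2 * ρ := by positivity
    have hm3 : 0 ≤ M * ρ := by positivity
    have k1 := H1 y hy ρ hρ0 hρR z hz z' hz' (by linarith) (by linarith)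
    have h4 : 4 * L * 1 * ρ ≤ R := by nlinarith
    have hF : 1 / κ * ρ ≤ F y x := by
      have := E.dista_le_F hy hx (by rw [← hρ]; nlinarith)
      rw [div_mul_eq_mul_div, one_mul, div_le_iff₀ (by linarith)]
      nlinarith
    have hF2 : 1 / κ * ρ ≤ F y (y + ρ • e y) := by
      rw [E.F_A hy, div_mul_eq_mul_div, one_mul]; exact div_le_self hρ0.le hκ
    have hA2 : dist (y + ρ • e y) y ≤ 1 * ρ := by rw [E.hG.A_dist hy hρ0, one_mul]
    have hA1 : dist x y ≤ 1 * ρ := by rw [one_mul]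
    have k2 := H2 y hy ρ hρ0 h4 (k z) (E.hk.sol z hz) (E.kn hz) _ _ hF hF2 hA1 hA2
    have k3 := H2 y hy ρ hρ0 h4 (k z') (E.hk.sol z' hz') (E.kn hz') _ _ hF2 hF hA2 hA1
    calc k z x ≤ C2 * k z (y + ρ • e y) := k2
      _ ≤ C2 * (C1 * k z' (y + ρ • e y)) := by gcongr
      _ ≤ C2 * (C1 * (C2 * k z' x)) := by gcongr
      _ = C2 * (C1 * C2) * k z' x := by ring
      _ ≤ _ := by gcongr; linarith

/-- Carleson plus boundary decay -/
lemma cdecay (E : Env Ω a V L R e F x₀ k) : ∃ C q : ℝ, 1 ≤ C ∧ 0 < q ∧ q < 1 ∧ ∀ y ∈ frontier Ω, ∀ (r : ℝ) (_ : 0 < r)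
      (_ : 24 * L * r ≤ R) (u : ES N → ℝ) (_ : Sol V (Ω ∩ ball y (24 * L * r)) u)
      (_ : ∀ x ∈ Ω, dist x y < 24 * L * r → 0 ≤ u x) (_ : Van Ω (ball y (24 * L * r)) u) (J : ℕ),
      ∀ x ∈ Ω, dist x y < r / 8 ^ J → u x ≤ q ^ J * (C * u (y + r • e y)) := by
  obtain ⟨C, hC, H⟩ := carleson E.hN E.hV L E.hG.L1
  obtain ⟨η, hη0, hη1, H2⟩ := bdecay E.hN E.hV L E.hG.L1
  refine ⟨C, 1 - η, hC, by linarith, by linarith, ?_⟩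
  intro y hy r hr hrR u hu hu0 huv J
  have hL1 := E.hG.L1
  have hss : ball y r ⊆ ball y (24 * L * r) := ball_subset_ball (by nlinarith)
  have hA := E.hG.A_mem hy hr (by nlinarith)
  have hA0 := hu0 _ hA (by rw [E.hG.A_dist hy hr]; nlinarith)
  exact H2 R y (e y) (F y) (E.hG.ch y hy) r hr (by nlinarith) u
    (hu.2.mono (inter_subset_inter_right _ hss)) (huv.mono hss) (C * u (y + r • e y)) (by positivity)
    (H R y (e y) (F y) (E.hG.ch y hy) r hr hrR u hu.1 hu.2 hu0 huv) J

lemma UV (E : Env Ω a V L R e F x₀ k) {ξ : ES N} (hξ : ξ ∈ frontier Ω) {ρ ε : ℝ} (hρ : 0 < ρ) (hε : 0 < ε) :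
    ∀ᶠ x in 𝓝[Ω] ξ, ∀ z ∈ frontier Ω, ρ ≤ dist z ξ → k z x ≤ ε := by
  obtain ⟨C, q, hC, hq0, hq1, H⟩ := E.cdecay
  have hL0 := E.L0
  have hR := E.hG.R0
  have hL2 := E.L2
  have hLL := E.LL2
  set r := min ρ R / (96 * L ^ 2) with hr
  have hr0 : 0 < r := by positivity
  have hrm : 96 * L ^ 2 * r = min ρ R := by rw [hr]; field_simp
  have hrρ : 96 * L ^ 2 * r ≤ ρ := hrm.trans_le (min_le_left _ _)
  have hrR : 96 * L ^ 2 * r ≤ R := hrm.trans_le (min_le_right _ _)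
  have h24 : 24 * L * r ≤ 96 * L ^ 2 * r := by nlinarith
  obtain ⟨C1, hC1, H1⟩ := E.globk (r / L) (by positivity)
  obtain ⟨J, hJ⟩ := exists_pow_lt_of_lt_one (show 0 < ε / (C * C1) by positivity) hq1
  filter_upwards [self_mem_nhdsWithin, mem_nhdsWithin_of_mem_nhds
    (ball_mem_nhds ξ (show 0 < r / 8 ^ J by positivity))] with x hx hxb z hz hzρ
  have k1 := H ξ hξ r hr0 (h24.trans hrR) (k z) (E.hk.sol' hz) (fun x hx _ => E.kn hz x hx)
    ((E.hk.van z hz).mono (by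
        rintro p hp rfl
        rw [mem_ball] at hp
        linarith)) J x hx hxb
  have k2 := (H1 _ (E.A_mem hξ hr0 hrR) (E.A_dista hξ hr0 hrR) z hz).2
  rw [lt_div_iff₀ (by positivity)] at hJ
  calc k z x ≤ q ^ J * (C * k z (ξ + r • e ξ)) := k1
    _ ≤ q ^ J * (C * C1) := by gcongr
    _ ≤ ε := hJ.le

end Env

end


section
variable {N : ℕ} {Ω : Set (ES N)} {a : ℝ} {V : ES N → ℝ} {L R : ℝ} {e : ES N → ES N}
  {F : ES N → ES N → ℝ} {x₀ : ES N} {k : ES N → ES N → ℝ}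

lemma Sol.sum {ι : Type*} {D : Set (ES N)} (hV : Pot Ω a V) (hD : IsOpen D) (hDΩ : D ⊆ Ω)
    (T : Finset ι) (w : ι → ES N → ℝ) (h : ∀ i ∈ T, Sol V D (w i)) :
    Sol V D (fun x => ∑ i ∈ T, w i x) := by
  classical
  induction T using Finset.induction_on with
  | empty =>
    simp only [Finset.sum_empty]
    exact ⟨Sp.const hV hDΩ le_rfl, (Sp.const hV hDΩ le_rfl).congr fun x _ => by rw [neg_zero]⟩
  | insert i T hi ih =>
    refine ((h i (Finset.mem_insert_self i T)).add hV hD hDΩ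
      (ih fun j hj => h j (Finset.mem_insert_of_mem hj))).congr fun x _ => ?_
    rw [Finset.sum_insert hi]

lemma Van.sum {ι : Type*} {S : Set (ES N)} (T : Finset ι) (w : ι → ES N → ℝ)
    (h : ∀ i ∈ T, Van Ω S (w i)) : Van Ω S (fun x => ∑ i ∈ T, w i x) := fun ξ h1 h2 => by
  have := tendsto_finset_sum T fun i hi => h i hi ξ h1 h2
  rwa [Finset.sum_const_zero] at this

namespace Env

/-- propagation of lower bounds from a small ball to the corkscrew balls at scales `ρ`, `2ρ` -/
lemma prop (E : Env Ω a V L R e F x₀ k) (κ b : ℝ) (hκ : 1 ≤ κ) (hb : 0 < b) : ∃ c : ℝ, 0 < c ∧ c ≤ 1 ∧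
    ∀ y ∈ frontier Ω, ∀ x ∈ Ω, dist x y ≤ κ * dista Ω x → 192 * L ^ 2 * dist x y ≤ R →
    ∀ s : ES N → ℝ, Sp V Ω s → (∀ x ∈ Ω, 0 ≤ s x) → ∀ m, (∀ x' ∈ ball x (b * dist x y), m ≤ s x') →
      ∀ r, dist x y ≤ r → r ≤ 2 * dist x y → ∀ x' ∈ ball (y + r • e y) (r / (32 * L)), c * m ≤ s x' := by
  have hL0 := E.L0
  have hL1 := E.hG.L1
  have hL2 := E.L2
  have hLL := E.LL2
  set ε := min (1 / κ) (min b 1 / 2) with hε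
  have hκ0 : 0 < κ := by linarith
  have hε0 : 0 < ε := by positivity
  have hε1 : ε ≤ 1 / κ := min_le_left _ _
  have hε3 : ε ≤ 1 / 2 := (min_le_right _ _).trans (by linarith [min_le_right b 1])
  have hε2 : ε ≤ b := (min_le_right _ _).trans (by linarith [min_le_left b 1])
  obtain ⟨c, hc0, hc1, H⟩ := conn E.hV L hL1 3 ε (by norm_num) hε0 (by linarith)
  refine ⟨c, hc0, hc1, ?_⟩
  intro y hy x hx hxy hxR s hs hs0 m hm r hr1 hr2 x' hx'
  set ρ := dist x y with hρ
  have hρ0 : 0 < ρ := (dista_pos E.hN E.hG hx).trans_le (dist_ge_dista E.hG hy)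
  have hch := E.hG.ch y hy
  have hr0 : 0 < r := by linarith
  have hrL : r / (32 * L) ≤ r / 32 := by gcongr; linarith
  rw [mem_ball] at hx'
  have hF' : r / 2 ≤ F y x' := by
    have h1 := hch.F_ge (y + r • e y) x'
    rw [E.F_A hy] at h1
    have h2 : L * dist x' (y + r • e y) ≤ L * (r / (32 * L)) := by gcongr
    have h3 : L * (r / (32 * L)) = r / 32 := by field_simp
    linarith
  have hF : ε * ρ ≤ F y x := by
    have := E.dista_le_F hy hx (by rw [← hρ]; nlinarith)
    have h1 : ε * ρ ≤ 1 / κ * ρ := by gcongr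
    rw [div_mul_eq_mul_div, one_mul] at h1
    have h2 : ρ / κ ≤ dista Ω x := by rw [div_le_iff₀ hκ0]; linarith
    linarith
  have hεb : ε / (32 * L) * ρ ≤ b * ρ := by
    gcongr
    refine (div_le_self hε0.le (by linarith)).trans hε2
  refine (H R y (e y) (F y) hch Ω Subset.rfl E.hG.opn s hs hs0 ρ hρ0 ?_ x x' hF ?_ ?_ ?_).1 m
    (fun z hz => hm z (ball_subset_ball hεb hz)) x' (mem_ball_self (by positivity))
  · intro z hz hzd
    rw [hch.mem z (by rw [mem_ball]; nlinarith)]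
    have : 0 < ε / 2 * ρ := by positivity
    linarith
  · nlinarith
  · rw [← hρ]; linarith
  · have := dist_triangle x' (y + r • e y) y
    rw [E.hG.A_dist hy hr0] at this
    linarith

lemma lemII (E : Env Ω a V L R e F x₀ k) (κ b : ℝ) (hκ : 1 ≤ κ) (hb : 0 < b) : ∃ c : ℝ, 0 < c ∧ c ≤ 1 ∧
    ∀ (T : Finset (ES N)) (X : ES N → ES N) (W : ES N → ℝ), (∀ y ∈ T, y ∈ frontier Ω) →
    (∀ y ∈ T, 0 ≤ W y) → (∀ y ∈ T, X y ∈ Ω) → (∀ y ∈ T, dist (X y) y ≤ κ * dista Ω (X y)) →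
    (∀ y ∈ T, 192 * L ^ 2 * dist (X y) y ≤ R) →
    (∀ y ∈ T, ∀ z ∈ T, z ≠ y → 192 * L ^ 2 * dist (X y) y ≤ dist z y) →
    ∀ s : ES N → ℝ, Sp V Ω s → (∀ x ∈ Ω, 0 ≤ s x) → ∀ l : ℝ, 0 ≤ l →
    (∀ y ∈ T, ∀ x' ∈ ball (X y) (b * dist (X y) y), l * ∑ z ∈ T, W z * k z (X y) ≤ s x') →
    ∀ x ∈ Ω, (∀ y ∈ T, dist (X y) y < dist x y) → c * l * ∑ z ∈ T, W z * k z x ≤ s x := by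
  classical
  have hL0 := E.L0
  have hL1 := E.hG.L1
  have hL2 := E.L2
  have hLL := E.LL2
  have hκ0 : 0 < κ := by linarith
  obtain ⟨c, hc0, hc1, Hp⟩ := E.prop κ b hκ hb
  obtain ⟨C1, hC1, H1⟩ := outer E.hN E.hV E.hG
  obtain ⟨C2, hC2, H2⟩ := E.conn' 2 (1 / κ) (by norm_num) (by positivity)
    (by rw [div_le_one hκ0]; exact hκ)
  obtain ⟨C3, hC3, H3⟩ := bhp E.hN E.hV L E.hG.L1
  have hQ : 0 < C1 * C2 + C3 * C2 := by positivity
  have hQ1 : 1 ≤ C1 * C2 + C3 * C2 := by nlinarith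
  refine ⟨c / (C1 * C2 + C3 * C2), by positivity, by rw [div_le_one hQ]; linarith, ?_⟩
  intro T X W hT hW hXΩ hXκ hXR hsep s hs hs0 l hl hsl
  set H : ES N → ℝ := fun x => ∑ z ∈ T, W z * k z x with hH
  have hHsol : Sol V Ω H := Sol.sum E.hV E.hG.opn Subset.rfl T (fun z x => W z * k z x)
    fun z hz => (E.hk.sol z (hT z hz)).smul (W z)
  have hterm : ∀ z ∈ T, ∀ x ∈ Ω, 0 ≤ W z * k z x := fun z hz x hx =>
    mul_nonneg (hW z hz) (E.kn (hT z hz) x hx)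
  have hH0 : ∀ x ∈ Ω, 0 ≤ H x := fun x hx => Finset.sum_nonneg fun z hz => hterm z hz x hx
  -- local estimate
  have near : ∀ y ∈ T, ∀ x ∈ Ω, dist (X y) y ≤ dist x y → dist x y < 2 * dist (X y) y →
      c / (C1 * C2 + C3 * C2) * l * H x ≤ s x := by
    intro y hyT x hx hx1 hx2
    have hy := hT y hyT
    set ρ := dist (X y) y with hρ
    have hρ0 : 0 < ρ := (dista_pos E.hN E.hG (hXΩ y hyT)).trans_le (dist_ge_dista E.hG hy)
    have hR := hXR y hyT
    rw [← hρ] at hR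
    have hm0 : 0 ≤ l * H (X y) := mul_nonneg hl (hH0 _ (hXΩ y hyT))
    have hpr := Hp y hy (X y) (hXΩ y hyT) (hXκ y hyT) hR s hs hs0 (l * H (X y)) (hsl y hyT)
    have hp1 := hpr ρ le_rfl (by linarith)
    have hp2 := hpr (2 * ρ) (by linarith) le_rfl
    set H' : ES N → ℝ := fun x => ∑ z ∈ T.erase y, W z * k z x with hH'
    have hsplit : ∀ x, H x = W y * k y x + H' x := fun x =>
      (Finset.add_sum_erase T (fun z => W z * k z x) hyT).symm
    have hH'sol : Sol V Ω H' := Sol.sum E.hV E.hG.opn Subset.rfl (T.erase y) (fun z x => W z * k z x)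
      fun z hz => (E.hk.sol z (hT z (Finset.mem_of_mem_erase hz))).smul (W z)
    have hH'0 : ∀ x ∈ Ω, 0 ≤ H' x := fun x hx => Finset.sum_nonneg fun z hz =>
      hterm z (Finset.mem_of_mem_erase hz) x hx
    have hF : 1 / κ * ρ ≤ F y (X y) := by
      have := E.dista_le_F hy (hXΩ y hyT) (by rw [← hρ]; nlinarith)
      have h2 := hXκ y hyT
      rw [div_mul_eq_mul_div, one_mul, div_le_iff₀ hκ0]
      nlinarith
    have hκρ : 1 / κ * ρ ≤ ρ := by
      rw [div_mul_eq_mul_div, one_mul]; exact div_le_self hρ0.le hκ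
    have h4 : 4 * L * 2 * ρ ≤ R := by nlinarith
    have h96 : 96 * L ^ 2 * ρ ≤ R := by
      have : 0 ≤ L ^ 2 * ρ := by positivity
      linarith
    have k1 := H1 y hy ρ hρ0 h96 (k y) s _ rfl (E.hk.sol' hy) (fun x hx _ => E.kn hy x hx)
      ((E.hk.van y hy).mono fun p hp hpz => hp (by
        rw [mem_singleton_iff.1 hpz]; exact mem_closedBall_self (by positivity)))
      (hs.mono inter_subset_left) (fun x hx _ => hs0 x hx) (c * (l * H (X y))) (by positivity)
      hp1 x hx hx1
    have k2 := H2 y hy ρ hρ0 h4 (k y) (E.hk.sol y hy) (E.kn hy) (y + ρ • e y) (X y)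
      (by rw [E.F_A hy]; exact hκρ) hF (by rw [E.hG.A_dist hy hρ0]; linarith) (by linarith)
    have k3 := H3 R y (e y) (F y) (E.hG.ch y hy) (2 * ρ) (by linarith) (by linarith) H' s
      (hH'sol.1.mono inter_subset_left) (hH'sol.2.mono inter_subset_left) (fun x hx _ => hH'0 x hx)
      (Van.sum (T.erase y) (fun z x => W z * k z x) fun z hz =>
        ((E.hk.van z (hT z (Finset.mem_of_mem_erase hz))).mono (by
          rintro p hp rfl
          rw [mem_ball] at hp
          have := hsep y hyT p (Finset.mem_of_mem_erase hz) (Finset.ne_of_mem_erase hz)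
          linarith)).smul (W z))
      (hs.mono inter_subset_left) (fun x hx _ => hs0 x hx) (c * (l * H (X y))) (by positivity)
      hp2 x hx hx2
    have k4 := H2 y hy ρ hρ0 h4 H' hH'sol hH'0 (y + (2 * ρ) • e y) (X y)
      (by rw [E.F_A hy]; linarith) hF (by rw [E.hG.A_dist hy (by linarith)]) (by linarith)
    have hsx := hs0 x hx
    have hWX : W y * k y (X y) ≤ H (X y) := by
      rw [hsplit]; linarith [hH'0 (X y) (hXΩ y hyT)]
    have hHX : H' (X y) ≤ H (X y) := by
      rw [hsplit]; linarith [hterm y hyT (X y) (hXΩ y hyT)]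
    have hWy := hW y hyT
    have k5 : c * (l * H (X y)) * (W y * k y x) ≤ C1 * C2 * H (X y) * s x := by
      calc _ = W y * (c * (l * H (X y)) * k y x) := by ring
        _ ≤ W y * (C1 * k y (y + ρ • e y) * s x) := by gcongr
        _ ≤ W y * (C1 * (C2 * k y (X y)) * s x) := by gcongr
        _ = C1 * C2 * (W y * k y (X y)) * s x := by ring
        _ ≤ _ := by gcongr
    have k6 : c * (l * H (X y)) * H' x ≤ C3 * C2 * H (X y) * s x := by
      calc _ ≤ C3 * H' (y + (2 * ρ) • e y) * s x := k3
        _ ≤ C3 * (C2 * H' (X y)) * s x := by gcongr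
        _ ≤ C3 * (C2 * H (X y)) * s x := by gcongr
        _ = _ := by ring
    have k7 : H (X y) * (c * l * H x) ≤ H (X y) * ((C1 * C2 + C3 * C2) * s x) := by
      rw [hsplit x]; linarith
    rw [div_mul_eq_mul_div, div_mul_eq_mul_div, div_le_iff₀ hQ]
    rcases (hH0 _ (hXΩ y hyT)).lt_or_eq with h | h
    · linarith [le_of_mul_le_mul_left k7 h]
    · have hz : ∀ z ∈ T, W z = 0 := by
        intro z hz
        have := (Finset.sum_eq_zero_iff_of_nonneg fun z hz => hterm z hz (X y) (hXΩ y hyT)).1 h.symm z hz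
        rcases mul_eq_zero.1 this with h | h
        · exact h
        · exact absurd h (E.hk.pos z (hT z hz) _ (hXΩ y hyT)).ne'
      have : H x = 0 := Finset.sum_eq_zero fun z hz' => by rw [hz z hz', zero_mul]
      rw [this, mul_zero]; positivity
  intro x hx hxT
  set c0 := c / (C1 * C2 + C3 * C2) with hc0'
  have hc00 : 0 ≤ c0 * l := by positivity
  set S : Set (ES N) := (⋃ y ∈ T, closedBall y (dist (X y) y))ᶜ with hS
  have hSo : IsOpen S := (T.finite_toSet.isClosed_biUnion fun y _ => isClosed_closedBall).isOpen_compl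
  have hSm : ∀ z, z ∈ S ↔ ∀ y ∈ T, dist (X y) y < dist z y := by
    intro z
    simp only [hS, mem_compl_iff, mem_iUnion, mem_closedBall, not_exists, not_le]
  have hDo : IsOpen (Ω ∩ S) := E.hG.opn.inter hSo
  have hw : Sp V (Ω ∩ S) (fun x => s x + -(c0 * l * H x)) :=
    (hs.mono inter_subset_left).add E.hV hDo inter_subset_left
      (((hHsol.2.mono inter_subset_left).smul hc00).congr fun x _ => by ring)
  have hvanH : Van Ω S H := Van.sum T (fun z x => W z * k z x) fun z hz =>
    ((E.hk.van z (hT z hz)).mono (by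
      rintro p hp rfl
      have := (hSm p).1 hp p hz
      rw [dist_self] at this
      linarith [dist_nonneg (x := X p) (y := p)])).smul (W z)
  have hLB : LBd Ω S (fun x => s x + -(c0 * l * H x)) :=
    (LBd.of_nonneg (fun x hx _ => hs0 x hx) hSo).add (hvanH.neg_LBd (c0 * l))
  have := max_principle E.hN E.hV inter_subset_left hDo (E.hG.bdd.subset inter_subset_left) hw (by
    intro ξ hξ ε hε
    by_cases h : ∃ y ∈ T, dist ξ y < 2 * dist (X y) y
    · obtain ⟨y, hyT, hy⟩ := h
      filter_upwards [self_mem_nhdsWithin, mem_nhdsWithin_of_mem_nhds (isOpen_ball.mem_nhds hy)]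
        with z hz hz'
      have := near y hyT z hz.1 ((hSm z).1 hz.2 y hyT).le hz'
      linarith
    · push Not at h
      have hξS : ξ ∈ S := (hSm ξ).2 fun y hyT => by
        have h1 := h y hyT
        have : 0 < dist (X y) y := (dista_pos E.hN E.hG (hXΩ y hyT)).trans_le
          (dist_ge_dista E.hG (hT y hyT))
        linarith
      exact (hLB ξ (frontier_inter_open hSo hξ hξS) hξS ε hε).filter_mono
        (nhdsWithin_mono _ inter_subset_left)) x ⟨hx, (hSm x).2 hxT⟩
  linarith

end Env

end


section
variable {N : ℕ} {Ω : Set (ES N)} {a : ℝ} {V : ES N → ℝ} {L R : ℝ} {e : ES N → ES N}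
  {F : ES N → ES N → ℝ} {x₀ : ES N} {k : ES N → ES N → ℝ}

namespace Env

lemma ki (E : Env Ω a V L R e F x₀ k) {θ : Measure (ES N)} [IsFiniteMeasure θ] (hθ : θ (frontier Ω)ᶜ = 0) {x : ES N} (hx : x ∈ Ω) :
    Integrable (fun z => k z x) θ := k_int E.hc E.hG hθ hx

lemma lemIIIa (E : Env Ω a V L R e F x₀ k) (κ b : ℝ) (hκ : 1 ≤ κ) (hb : 0 < b) : ∃ c η₀ : ℝ, 0 < c ∧ 0 < η₀ ∧
    ∀ (θ : Measure (ES N)) [IsFiniteMeasure θ], θ (frontier Ω)ᶜ = 0 →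
    ∀ (T : Finset (ES N)) (X : ES N → ES N), (∀ y ∈ T, y ∈ frontier Ω) →
    (∀ y ∈ T, X y ∈ Ω) → (∀ y ∈ T, dist (X y) y ≤ κ * dista Ω (X y)) →
    (∀ y ∈ T, dist (X y) y < η₀) →
    ((T : Set (ES N)).PairwiseDisjoint fun y => closedBall y (192 * L ^ 2 * dist (X y) y)) →
    ∀ s : ES N → ℝ, Sp V Ω s → (∀ x ∈ Ω, 0 ≤ s x) → ∀ l : ℝ, 0 ≤ l →
    (∀ y ∈ T, ∀ x' ∈ ball (X y) (b * dist (X y) y), l * pot k θ (X y) ≤ s x') →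
    ∀ x ∈ Ω, (∀ y ∈ T, dist (X y) y < dist x y) →
    c * l * ∑ z ∈ T, θ.real (closedBall z (192 * L ^ 2 * dist (X z) z)) * k z x ≤ s x := by
  classical
  have hL0 := E.L0
  have hR := E.hG.R0
  obtain ⟨c, hc0, hc1, H⟩ := E.lemII κ b hκ hb
  obtain ⟨C, ρ₀, hC, hρ₀, H2⟩ := E.lem2 κ (192 * L ^ 2) hκ (by positivity)
  have hM0 : 0 < 192 * L ^ 2 := by positivity
  refine ⟨c / C, min ρ₀ (R / (192 * L ^ 2)), by positivity, lt_min hρ₀ (by positivity), ?_⟩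
  intro θ _ hθ T X hT hXΩ hXκ hη hdj s hs hs0 l hl hsl x hx hxT
  set M := 192 * L ^ 2 with hM
  have hsep : ∀ y ∈ T, ∀ z ∈ T, z ≠ y → M * dist (X y) y < dist z y := by
    intro y hy z hz hne
    by_contra hcon
    push Not at hcon
    exact Set.disjoint_left.1 (hdj hy hz hne.symm) (mem_closedBall.2 hcon)
      (mem_closedBall_self (by positivity))
  have key : ∀ y ∈ T, ∑ z ∈ T, θ.real (closedBall z (M * dist (X z) z)) * k z (X y)
      ≤ C * pot k θ (X y) := by
    intro y hy
    have hi := E.ki hθ (hXΩ y hy)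
    have h1 : ∀ z ∈ T, θ.real (closedBall z (M * dist (X z) z)) * k z (X y) ≤
        ∫ z' in closedBall z (M * dist (X z) z), C * k z' (X y) ∂θ := by
      intro z hz
      have : θ.real (closedBall z (M * dist (X z) z)) * k z (X y) =
          ∫ z' in closedBall z (M * dist (X z) z), k z (X y) ∂θ := by
        rw [setIntegral_const, smul_eq_mul]
      rw [this]
      refine integral_mono_ae (integrable_const _) (hi.const_mul C).integrableOn ?_
      have h2 : ∀ᵐ z' ∂(θ.restrict (closedBall z (M * dist (X z) z))), z' ∈ frontier Ω :=
        ae_restrict_of_ae (mem_ae_iff.2 hθ)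
      filter_upwards [h2, ae_restrict_mem measurableSet_closedBall] with z' hz' hzb
      refine H2 y (hT y hy) (X y) (hXΩ y hy) (hXκ y hy) ((hη y hy).trans_le (min_le_left _ _))
        z (hT z hz) z' hz' ?_
      rw [mem_closedBall] at hzb
      by_cases hzy : z = y
      · subst hzy
        linarith [dist_nonneg (x := z) (y := z)]
      · have h3 := hsep z hz y hy (fun h => hzy h.symm)
        rw [dist_comm y z] at h3
        have h4 := dist_triangle z' z y
        have : 0 ≤ M * dist (X y) y := by positivity
        linarith
    calc _ ≤ ∑ z ∈ T, ∫ z' in closedBall z (M * dist (X z) z), C * k z' (X y) ∂θ :=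
          Finset.sum_le_sum h1
      _ = ∫ z' in ⋃ z ∈ T, closedBall z (M * dist (X z) z), C * k z' (X y) ∂θ :=
          (integral_biUnion_finset T (fun z _ => measurableSet_closedBall) hdj
            (fun z _ => (hi.const_mul C).integrableOn)).symm
      _ ≤ ∫ z', C * k z' (X y) ∂θ := setIntegral_le_integral (hi.const_mul C) (by
          filter_upwards [mem_ae_iff.2 hθ] with z hz
          have := E.kn hz _ (hXΩ y hy)
          simp only [Pi.zero_apply]
          positivity)
      _ = _ := integral_const_mul _ _
  have := H T X (fun z => θ.real (closedBall z (M * dist (X z) z))) hT (fun _ _ => measureReal_nonneg)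
    hXΩ hXκ (fun y hy => by
      have := (hη y hy).le.trans (min_le_right _ _)
      rw [le_div_iff₀ hM0] at this
      linarith) (fun y hy z hz hne => (hsep y hy z hz hne).le) s hs hs0 (l / C) (by positivity)
    (fun y hy x' hx' => by
      refine le_trans ?_ (hsl y hy x' hx')
      have := key y hy
      calc _ ≤ l / C * (C * pot k θ (X y)) := by gcongr
        _ = _ := by field_simp) x hx hxT
  calc _ = c * (l / C) * ∑ z ∈ T, θ.real (closedBall z (M * dist (X z) z)) * k z x := by ring
    _ ≤ _ := this

lemma lemIII (E : Env Ω a V L R e F x₀ k) (κ b : ℝ) (hκ : 1 ≤ κ) (hb : 0 < b) : ∃ c : ℝ, 0 < c ∧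
    ∀ (θ : Measure (ES N)) [IsFiniteMeasure θ], θ (frontier Ω)ᶜ = 0 →
    ∀ s : ES N → ℝ, Sp V Ω s → (∀ x ∈ Ω, 0 ≤ s x) → ∀ l : ℝ, 0 ≤ l →
    ∀ A : Set (ES N), A ⊆ frontier Ω → (∀ y ∈ A, ∀ ε > 0, ∃ x ∈ Ω, dist x y < ε ∧
      dist x y ≤ κ * dista Ω x ∧ ∀ x' ∈ ball x (b * dist x y), l * pot k θ x ≤ s x') →
    ∀ x ∈ Ω, c * l * pot k (θ.restrict A) x ≤ s x := by
  classical
  have hL0 := E.L0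
  have hM0 : 0 < 192 * L ^ 2 := by have := E.L0; positivity
  obtain ⟨c, η₀, hc0, hη₀, H⟩ := E.lemIIIa κ b hκ hb
  refine ⟨c, hc0, ?_⟩
  intro θ _ hθ s hs hs0 l hl A hA hAx x hx
  set M := 192 * L ^ 2 with hM
  have hi := E.ki hθ hx
  have hdx := dista_pos E.hN E.hG hx
  have hkx : ContinuousOn (fun z => k z x) (frontier Ω) :=
    E.hc.comp (by fun_prop : Continuous fun z : ES N => (z, x)).continuousOn fun z hz => ⟨hz, hx⟩
  have huc := (frontier_compact E.hG).uniformContinuousOn_of_continuous hkx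
  have hpos : ∀ y ∈ A, ∀ x ∈ Ω, 0 < dist x y := fun y hy x hx =>
    (dista_pos E.hN E.hG hx).trans_le (dist_ge_dista E.hG (hA hy))
  suffices h : ∀ ε > 0, c * l * pot k (θ.restrict A) x ≤ s x + c * l * (ε * θ.real univ) by
    refine le_of_forall_pos_le_add fun δ hδ => ?_
    have hQ : 0 < c * l * θ.real univ + 1 := by positivity
    refine (h (δ / (c * l * θ.real univ + 1)) (by positivity)).trans ?_
    have : c * l * (δ / (c * l * θ.real univ + 1) * θ.real univ) =
      δ * (c * l * θ.real univ / (c * l * θ.real univ + 1)) := by ring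
    rw [this]
    have h2 : c * l * θ.real univ / (c * l * θ.real univ + 1) ≤ 1 := by
      rw [div_le_one hQ]; linarith
    nlinarith
  intro ε hε
  obtain ⟨δ, hδ, hδu⟩ := Metric.uniformContinuousOn_iff.1 huc ε hε
  set η := min (min η₀ (dista Ω x)) (δ / M) with hη
  have hη0 : 0 < η := by rw [hη]; positivity
  -- choose points
  set f : ES N → Set ℝ := fun y => {r | ∃ x ∈ Ω, r = M * dist x y ∧
      dist x y ≤ κ * dista Ω x ∧ ∀ x' ∈ ball x (b * dist x y), l * pot k θ x ≤ s x'} with hf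
  obtain ⟨t, r, htc, htA, htr, htcov, htd⟩ := Besicovitch.exists_disjoint_closedBall_covering_ae θ f A
    (by
      intro y hy d hd
      obtain ⟨x, hx, hxd, hx1, hx2⟩ := hAx y hy (d / M) (by positivity)
      refine ⟨M * dist x y, ⟨x, hx, rfl, hx1, hx2⟩, ?_, ?_⟩
      · exact mul_pos hM0 (hpos y hy x hx)
      · rw [lt_div_iff₀ hM0] at hxd; linarith)
    (fun _ => M * η) (fun _ _ => by positivity)
  have hX : ∀ y, ∃ x, y ∈ t → x ∈ Ω ∧ r y = M * dist x y ∧ dist x y ≤ κ * dista Ω x ∧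
      ∀ x' ∈ ball x (b * dist x y), l * pot k θ x ≤ s x' := by
    intro y
    by_cases hy : y ∈ t
    · obtain ⟨x, hx, h⟩ := (htr y hy).1
      exact ⟨x, fun _ => ⟨hx, h⟩⟩
    · exact ⟨y, fun h => absurd h hy⟩
  choose X hX using hX
  have hXη : ∀ y ∈ t, dist (X y) y < η := by
    intro y hy
    have h1 := (htr y hy).2.2
    rw [(hX y hy).2.1] at h1
    exact lt_of_mul_lt_mul_left h1 hM0.le
  have fin : ∀ T : Finset (ES N), (∀ y ∈ T, y ∈ t) →
      c * l * ∑ y ∈ T, ∫ z in closedBall y (r y), k z x ∂θ ≤ s x + c * l * (ε * θ.real univ) := by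
    intro T hT
    have hdjT : (T : Set (ES N)).PairwiseDisjoint fun y => closedBall y (M * dist (X y) y) := by
      intro y hy z hz hne
      have := htd (hT y hy) (hT z hz) hne
      simp only [Function.onFun] at this ⊢
      rwa [(hX y (hT y hy)).2.1, (hX z (hT z hz)).2.1] at this
    have h1 := H θ hθ T X (fun y hy => hA (htA (hT y hy))) (fun y hy => (hX y (hT y hy)).1)
      (fun y hy => (hX y (hT y hy)).2.2.1)
      (fun y hy => (hXη y (hT y hy)).trans_le ((min_le_left _ _).trans (min_le_left _ _)))
      hdjT s hs hs0 l hl (fun y hy => (hX y (hT y hy)).2.2.2) x hx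
      (fun y hy => (hXη y (hT y hy)).trans_le (((min_le_left _ _).trans (min_le_right _ _)).trans
        (dist_ge_dista E.hG (hA (htA (hT y hy))))))
    have h2 : ∑ y ∈ T, ∫ z in closedBall y (r y), k z x ∂θ ≤
        ∑ y ∈ T, θ.real (closedBall y (M * dist (X y) y)) * k y x + ε * θ.real univ := by
      have h3 : ∀ y ∈ T, ∫ z in closedBall y (r y), k z x ∂θ ≤
          θ.real (closedBall y (M * dist (X y) y)) * k y x +
          ε * θ.real (closedBall y (M * dist (X y) y)) := by
        intro y hy
        rw [(hX y (hT y hy)).2.1]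
        have : θ.real (closedBall y (M * dist (X y) y)) * k y x +
            ε * θ.real (closedBall y (M * dist (X y) y)) =
            ∫ z' in closedBall y (M * dist (X y) y), (k y x + ε) ∂θ := by
          rw [setIntegral_const, smul_eq_mul]; ring
        rw [this]
        refine integral_mono_ae hi.integrableOn (integrable_const _) ?_
        have h2 : ∀ᵐ z' ∂(θ.restrict (closedBall y (M * dist (X y) y))), z' ∈ frontier Ω :=
          ae_restrict_of_ae (mem_ae_iff.2 hθ)
        filter_upwards [h2, ae_restrict_mem measurableSet_closedBall] with z' hz' hzb
        have h5 := (hXη y (hT y hy)).trans_le (min_le_right _ _)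
        rw [lt_div_iff₀ hM0] at h5
        have h4 := hδu z' hz' y (hA (htA (hT y hy))) (by
          rw [mem_closedBall] at hzb; linarith)
        rw [Real.dist_eq] at h4
        linarith [le_abs_self (k z' x - k y x)]
      refine (Finset.sum_le_sum h3).trans ?_
      rw [Finset.sum_add_distrib, ← Finset.mul_sum]
      have : ∑ y ∈ T, θ.real (closedBall y (M * dist (X y) y)) ≤ θ.real univ := by
        rw [← measureReal_biUnion_finset hdjT (fun y _ => measurableSet_closedBall)]
        exact measureReal_mono (subset_univ _)
      gcongr
    have := mul_le_mul_of_nonneg_left h2 (by positivity : 0 ≤ c * l)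
    rw [mul_add] at this
    linarith
  have := htc.to_subtype
  have hsum := hasSum_integral_iUnion (μ := θ) (f := fun z => k z x)
    (s := fun y : t => closedBall (y : ES N) (r y))
    (fun _ => measurableSet_closedBall) (fun y z hne => htd y.2 z.2 (fun h => hne (Subtype.ext h)))
    hi.integrableOn
  have h1 : c * l * ∫ z in ⋃ y : t, closedBall (y : ES N) (r y), k z x ∂θ ≤
      s x + c * l * (ε * θ.real univ) := by
    refine hasSum_le_of_sum_le (hsum.mul_left (c * l)) fun S => ?_
    rw [← Finset.mul_sum]
    have := fin (S.map (Function.Embedding.subtype _)) (by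
      intro y hy
      rw [Finset.mem_map] at hy
      obtain ⟨z, _, rfl⟩ := hy
      exact z.2)
    rw [Finset.sum_map] at this
    exact this
  refine le_trans ?_ h1
  have hle : θ.restrict A ≤ θ.restrict (⋃ y : t, closedBall (y : ES N) (r y)) := by
    refine Measure.restrict_mono_ae ?_
    rw [ae_le_set]
    rw [iUnion_subtype]
    exact htcov
  have : pot k (θ.restrict A) x ≤ ∫ z in ⋃ y : t, closedBall (y : ES N) (r y), k z x ∂θ := by
    refine integral_mono_measure hle ?_ hi.integrableOn
    refine ae_restrict_of_ae ?_
    filter_upwards [mem_ae_iff.2 hθ] with z hz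
    exact E.kn hz x hx
  gcongr

end Env

end


section
variable {N : ℕ} {Ω : Set (ES N)} {a : ℝ} {V : ES N → ℝ} {L R : ℝ} {e : ES N → ES N}
  {F : ES N → ES N → ℝ} {x₀ : ES N} {k : ES N → ES N → ℝ}

lemma frq_nt {y : ES N} {κ : ℝ} {P : ES N → Prop} (h : ∃ᶠ x in 𝓝[ntRegion Ω y κ] y, P x) :
    ∀ ε > 0, ∃ x ∈ Ω, dist x y < ε ∧ dist x y ≤ κ * dista Ω x ∧ P x := by
  intro ε hε
  have h1 : ∀ᶠ x in 𝓝[ntRegion Ω y κ] y, dist x y < ε :=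
    mem_nhdsWithin_of_mem_nhds (ball_mem_nhds y hε)
  obtain ⟨x, hx, hd, hm⟩ := (h.and_eventually (h1.and self_mem_nhdsWithin)).exists
  exact ⟨x, hm.1, hd, hm.2, hx⟩

lemma measure_zero_of_real_le {θ : Measure (ES N)} [IsFiniteMeasure θ] {A : Set (ES N)} {B : ℝ}
    (h : ∀ l > 0, l * θ.real A ≤ B) : θ A = 0 := by
  rw [← measureReal_eq_zero_iff]
  by_contra hne
  have hp : 0 < θ.real A := lt_of_le_of_ne measureReal_nonneg (Ne.symm hne)
  have h1 := h ((|B| + 1) / θ.real A) (by positivity)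
  rw [div_mul_cancel₀ _ hp.ne'] at h1
  linarith [le_abs_self B]

lemma pot_wd {θ : Measure (ES N)} {f : ES N → ℝ}
    (hf : Integrable f θ) (hf0 : ∀ᵐ z ∂θ, 0 ≤ f z) (x : ES N) :
    pot k (θ.withDensity fun z => ENNReal.ofReal (f z)) x = ∫ z, f z * k z x ∂θ := by
  unfold pot
  rw [integral_withDensity_eq_integral_toReal_smul₀ hf.aemeasurable.ennreal_ofReal
    (ae_of_all _ fun _ => ENNReal.ofReal_lt_top)]
  refine integral_congr_ae ?_
  filter_upwards [hf0] with z hz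
  rw [ENNReal.toReal_ofReal hz, smul_eq_mul]

namespace Env

lemma harn (E : Env Ω a V L R e F x₀ k) (κ : ℝ) (hκ : 1 ≤ κ) : ∃ c b : ℝ, 0 < c ∧ c ≤ 1 ∧ 0 < b ∧ ∀ y ∈ frontier Ω, ∀ x ∈ Ω,
    dist x y ≤ κ * dista Ω x → ∀ w, Sol V Ω w → (∀ x ∈ Ω, 0 ≤ w x) →
    ∀ x' ∈ ball x (b * dist x y), c * w x ≤ w x' := by
  obtain ⟨c, hc0, hc1, H⟩ := wh_step N a
  have hκ0 : 0 < κ := by linarith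
  refine ⟨c, 1 / (16 * κ), hc0, hc1, by positivity, ?_⟩
  intro y hy x hx hxκ w hw hw0 x' hx'
  have hρ : 0 < dist x y := (dista_pos E.hN E.hG hx).trans_le (dist_ge_dista E.hG hy)
  have hb : ball x (16 * (1 / (16 * κ) * dist x y)) ⊆ Ω := by
    refine ball_sub_of_le_dista ?_
    have : 16 * (1 / (16 * κ) * dist x y) = dist x y / κ := by field_simp
    rw [this, div_le_iff₀ hκ0]; linarith
  have ht : 0 < 1 / (16 * κ) * dist x y := by positivity
  have hb' : ball x (8 * (1 / (16 * κ) * dist x y)) ⊆ Ω :=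
    (ball_subset_ball (by linarith)).trans hb
  refine (H Ω Ω V E.hV Subset.rfl E.hG.opn w hw.1 x _ ht hb hb' (fun z hz => hw0 z (hb' hz))).2 hw.2 x' ?_
  rw [mem_ball] at hx'
  linarith

lemma lemIV (E : Env Ω a V L R e F x₀ k) (κ : ℝ) (hκ : 1 ≤ κ) : ∃ C : ℝ, 0 < C ∧
    ∀ (θ ν : Measure (ES N)) [IsFiniteMeasure θ] [IsFiniteMeasure ν], θ (frontier Ω)ᶜ = 0 →
    ν (frontier Ω)ᶜ = 0 → ∀ l : ℝ, 0 ≤ l → ∀ A : Set (ES N), A ⊆ frontier Ω →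
    (∀ y ∈ A, ∃ᶠ x in 𝓝[ntRegion Ω y κ] y, l * pot k θ x ≤ pot k ν x) →
    l * θ.real A ≤ C * ν.real univ := by
  obtain ⟨c1, b, hc1, _, hb, H1⟩ := E.harn κ hκ
  obtain ⟨c, hc, H⟩ := E.lemIII κ b hκ hb
  refine ⟨1 / (c * c1), by positivity, ?_⟩
  intro θ ν _ _ hθ hν l hl A hA hfr
  have hn : ∀ x ∈ Ω, 0 ≤ pot k ν x := fun x hx => pot_nonneg E.hk hν hx
  have hs := pot_sol E.hV E.hc E.hG E.hk hν
  have := H θ hθ (pot k ν) hs.1 hn (c1 * l) (by positivity) A hA (fun y hy ε hε => by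
    obtain ⟨x, hx, hd, hxκ, hP⟩ := frq_nt (hfr y hy) ε hε
    refine ⟨x, hx, hd, hxκ, fun x' hx' => ?_⟩
    refine le_trans ?_ (H1 y (hA hy) x hx hxκ _ hs hn x' hx')
    rw [mul_assoc]
    gcongr) x₀ E.hx₀
  rw [pot_x₀ E.hk hν, pot_x₀ E.hk (by
    exact nonpos_iff_eq_zero.1 ((Measure.restrict_apply_le A _).trans hθ.le))] at this
  rw [measureReal_restrict_apply_univ] at this
  rw [div_mul_eq_mul_div, le_div_iff₀ (by positivity)]
  linarith

lemma lemA0 (E : Env Ω a V L R e F x₀ k) (κ : ℝ) (hκ : 1 ≤ κ) (θ : Measure (ES N)) [IsFiniteMeasure θ] (hθ : θ (frontier Ω)ᶜ = 0) :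
    ∀ᵐ y ∂θ, ∃ m : ℝ, 0 < m ∧ ∀ᶠ x in 𝓝[ntRegion Ω y κ] y, m ≤ pot k θ x := by
  obtain ⟨c, hc, H⟩ := E.lemIII κ 1 hκ one_pos
  set A : Set (ES N) := {y | y ∈ frontier Ω ∧ ∀ m : ℝ, 0 < m → ∃ᶠ x in 𝓝[ntRegion Ω y κ] y, pot k θ x < m}
  have hA : θ A = 0 := by
    refine measure_zero_of_real_le (B := 1 / c) fun l hl => ?_
    have := H θ hθ (fun _ => 1) (Sp.const E.hV Subset.rfl zero_le_one) (fun _ _ => zero_le_one) l hl.le A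
      (fun y hy => hy.1) (fun y hy ε hε => by
        obtain ⟨x, hx, hd, hxκ, hP⟩ := frq_nt (hy.2 (1 / l) (by positivity)) ε hε
        refine ⟨x, hx, hd, hxκ, fun x' hx' => ?_⟩
        rw [lt_div_iff₀ hl] at hP
        linarith) x₀ E.hx₀
    rw [pot_x₀ E.hk (by
      exact nonpos_iff_eq_zero.1 ((Measure.restrict_apply_le A _).trans hθ.le))] at this
    rw [measureReal_restrict_apply_univ] at this
    rw [le_div_iff₀ hc]
    linarith
  filter_upwards [mem_ae_iff.2 hθ, measure_eq_zero_iff_ae_notMem.1 hA] with y hy hyA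
  by_contra hcon
  push Not at hcon
  exact hyA ⟨hy, fun m hm => (hcon m hm).mono fun x hx => hx⟩

lemma fk_int (E : Env Ω a V L R e F x₀ k) {θ : Measure (ES N)} [IsFiniteMeasure θ] (hθ : θ (frontier Ω)ᶜ = 0) {f : ES N → ℝ}
    (hf : Integrable f θ) {x : ES N} (hx : x ∈ Ω) : Integrable (fun z => f z * k z x) θ := by
  have hkx : ContinuousOn (fun z => k z x) (frontier Ω) :=
    E.hc.comp (by fun_prop : Continuous fun z : ES N => (z, x)).continuousOn fun z hz => ⟨hz, hx⟩
  obtain ⟨B, hB⟩ := (frontier_compact E.hG).exists_bound_of_continuousOn hkx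
  refine hf.mul_bdd (c := B) (E.ki hθ hx).aestronglyMeasurable ?_
  filter_upwards [mem_ae_iff.2 hθ] with z hz
  exact hB z hz

lemma contA (E : Env Ω a V L R e F x₀ k) {θ : Measure (ES N)} [IsFiniteMeasure θ] (hθ : θ (frontier Ω)ᶜ = 0)
    (g : BoundedContinuousFunction (ES N) ℝ) {κ : ℝ} {y : ES N} (hy : y ∈ frontier Ω) {m : ℝ} (hm : 0 < m)
    (h : ∀ᶠ x in 𝓝[ntRegion Ω y κ] y, m ≤ pot k θ x) {l : ℝ} (hl : 0 < l) :
    ∀ᶠ x in 𝓝[ntRegion Ω y κ] y, |(∫ z, g z * k z x ∂θ) - g y * pot k θ x| < l * pot k θ x := by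
  obtain ⟨ρ, hρ, hgρ⟩ := Metric.continuousAt_iff.1 g.continuous.continuousAt (l / 4) (by positivity)
  set B := 2 * ‖g‖ + 1 with hB
  have hB0 : 0 < B := by positivity
  set Q := B * (θ.real univ + 1) with hQ
  have hQ0 : 0 < Q := by positivity
  have hnt : 𝓝[ntRegion Ω y κ] y ≤ 𝓝[Ω] y := nhdsWithin_mono _ fun x hx => hx.1
  filter_upwards [h, (E.UV hy hρ (show 0 < l * m / (4 * Q) by positivity)).filter_mono hnt,
    self_mem_nhdsWithin] with x hx hUV hxn
  have hxΩ := hxn.1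
  have hi := E.ki hθ hxΩ
  have hgi : Integrable g θ := g.integrable θ
  have hgk := E.fk_int hθ hgi hxΩ
  have e1 : (∫ z, g z * k z x ∂θ) - g y * pot k θ x = ∫ z, (g z - g y) * k z x ∂θ := by
    unfold pot
    rw [← integral_const_mul, ← integral_sub hgk (hi.const_mul _)]
    exact integral_congr_ae (ae_of_all _ fun z => by ring)
  rw [e1]
  have h1 : |∫ z, (g z - g y) * k z x ∂θ| ≤ ∫ z, (l / 4 * k z x + B * (l * m / (4 * Q))) ∂θ := by
    rw [← Real.norm_eq_abs]
    refine norm_integral_le_of_norm_le ((hi.const_mul _).add (integrable_const _)) ?_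
    filter_upwards [mem_ae_iff.2 hθ] with z hz
    have hk0 := E.kn hz x hxΩ
    rw [Real.norm_eq_abs, abs_mul, abs_of_nonneg hk0]
    rcases lt_or_ge (dist z y) ρ with hd | hd
    · have := hgρ hd
      rw [Real.dist_eq] at this
      have h2 : |g z - g y| * k z x ≤ l / 4 * k z x := by gcongr
      have : 0 ≤ B * (l * m / (4 * Q)) := by positivity
      linarith
    · have h3 : |g z - g y| ≤ B := by
        have h4 := g.norm_coe_le_norm z
        have h5 := g.norm_coe_le_norm y
        rw [Real.norm_eq_abs] at h4 h5
        have := abs_sub (g z) (g y)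
        linarith
      have h2 : |g z - g y| * k z x ≤ B * (l * m / (4 * Q)) := by
        gcongr
        exact hUV z hz hd
      have : 0 ≤ l / 4 * k z x := by positivity
      linarith
  rw [integral_add (hi.const_mul _) (integrable_const _), integral_const_mul, integral_const,
    smul_eq_mul] at h1
  have h6 : θ.real univ * (B * (l * m / (4 * Q))) ≤ l * m / 4 := by
    have : θ.real univ * (B * (l * m / (4 * Q))) = (B * θ.real univ / Q) * (l * m / 4) := by
      field_simp
    rw [this]
    have : B * θ.real univ / Q ≤ 1 := by rw [div_le_one hQ0, hQ]; gcongr; linarith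
    have h7 : 0 ≤ l * m / 4 := by positivity
    nlinarith
  change _ ≤ l / 4 * pot k θ x + _ at h1
  have h8 : l * m / 4 ≤ l / 4 * pot k θ x := by
    have := mul_le_mul_of_nonneg_left hx (show 0 ≤ l / 4 by positivity)
    linarith
  have : 0 < l * pot k θ x := mul_pos hl (hm.trans_le hx)
  linarith

lemma thmA1 (E : Env Ω a V L R e F x₀ k) (κ : ℝ) (hκ : 1 ≤ κ) {θ : Measure (ES N)} [IsFiniteMeasure θ] (hθ : θ (frontier Ω)ᶜ = 0)
    {f : ES N → ℝ} (hf : Integrable f θ) :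
    ∀ᵐ y ∂θ, Tendsto (fun x => (∫ z, f z * k z x ∂θ) / pot k θ x) (𝓝[ntRegion Ω y κ] y) (𝓝 (f y)) := by
  obtain ⟨C, hC, H⟩ := E.lemIV κ hκ
  have hA0 := E.lemA0 κ hκ θ hθ
  set Z : Set (ES N) := {y | y ∈ frontier Ω ∧ ∃ m : ℝ, 0 < m ∧ ∀ᶠ x in 𝓝[ntRegion Ω y κ] y, m ≤ pot k θ x}
  have hZ : ∀ᵐ y ∂θ, y ∈ Z := by
    filter_upwards [mem_ae_iff.2 hθ, hA0] with y h1 h2 using ⟨h1, h2⟩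
  have key : ∀ l : ℝ, 0 < l → θ {y | y ∈ Z ∧ ∃ᶠ x in 𝓝[ntRegion Ω y κ] y,
      3 * l * pot k θ x ≤ |(∫ z, f z * k z x ∂θ) - f y * pot k θ x|} = 0 := by
    intro l hl
    refine measure_zero_of_real_le (B := (C + 1) / l) fun j hj => ?_
    obtain ⟨g, hg, hgi⟩ := hf.exists_boundedContinuous_integral_sub_le (show 0 < 1 / j by positivity)
    have hdi : Integrable (fun z => |f z - g z|) θ := (hf.sub hgi).abs
    set ν := θ.withDensity fun z => ENNReal.ofReal |f z - g z| with hν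
    have : IsFiniteMeasure ν := isFiniteMeasure_withDensity_ofReal hdi.2
    have hνs : ν (frontier Ω)ᶜ = 0 := withDensity_absolutelyContinuous _ _ hθ
    have hνu : ν.real univ = ∫ z, |f z - g z| ∂θ := by
      rw [measureReal_def, hν, withDensity_apply _ MeasurableSet.univ, Measure.restrict_univ,
        ← ofReal_integral_eq_lintegral_ofReal hdi (ae_of_all _ fun _ => abs_nonneg _),
        ENNReal.toReal_ofReal (integral_nonneg fun _ => abs_nonneg _)]
    have hg' : ∫ z, |f z - g z| ∂θ ≤ 1 / j := by simpa [Real.norm_eq_abs] using hg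
    set A1 : Set (ES N) := {y | y ∈ Z ∧ ∃ᶠ x in 𝓝[ntRegion Ω y κ] y, l * pot k θ x ≤ pot k ν x}
    set A2 : Set (ES N) := {y | l ≤ |f y - g y|}
    have h1 := H θ ν hθ hνs l hl.le A1 (fun y hy => hy.1.1) (fun y hy => hy.2)
    have h2 := mul_meas_ge_le_integral_of_nonneg (ae_of_all _ fun z => abs_nonneg (f z - g z)) hdi l
    rw [hνu] at h1
    have hsub : {y | y ∈ Z ∧ ∃ᶠ x in 𝓝[ntRegion Ω y κ] y,
      3 * l * pot k θ x ≤ |(∫ z, f z * k z x ∂θ) - f y * pot k θ x|} ⊆ A1 ∪ A2 := by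
      rintro y ⟨hyZ, hyf⟩
      by_cases hy2 : y ∈ A2
      · exact Or.inr hy2
      refine Or.inl ⟨hyZ, ?_⟩
      obtain ⟨hy, m, hm, hm'⟩ := hyZ
      simp only [A2, mem_ofPred_eq, not_le] at hy2
      refine (hyf.and_eventually ((E.contA hθ g hy hm hm' hl).and (hm'.and self_mem_nhdsWithin))).mono ?_
      rintro x ⟨hx1, hx2, hx3, hxn⟩
      have hpw := pot_wd (k := k) hdi (ae_of_all _ fun _ => abs_nonneg _) x
      rw [hν, hpw]
      have hfk := E.fk_int hθ hf hxn.1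
      have hgk := E.fk_int hθ hgi hxn.1
      have hdk := E.fk_int hθ hdi hxn.1
      have h3 : |(∫ z, f z * k z x ∂θ) - ∫ z, g z * k z x ∂θ| ≤ ∫ z, |f z - g z| * k z x ∂θ := by
        rw [← integral_sub hfk hgk, ← Real.norm_eq_abs]
        refine norm_integral_le_of_norm_le hdk ?_
        filter_upwards [mem_ae_iff.2 hθ] with z hz
        rw [← sub_mul, Real.norm_eq_abs, abs_mul, abs_of_nonneg (E.kn hz x hxn.1)]
      have hpos : 0 < pot k θ x := hm.trans_le hx3
      have h4 : |g y * pot k θ x - f y * pot k θ x| ≤ l * pot k θ x := by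
        rw [← sub_mul, abs_mul, abs_of_pos hpos, abs_sub_comm]
        gcongr
      have h5 := abs_sub_le (∫ z, f z * k z x ∂θ) (∫ z, g z * k z x ∂θ) (f y * pot k θ x)
      have h6 := abs_sub_le (∫ z, g z * k z x ∂θ) (g y * pot k θ x) (f y * pot k θ x)
      linarith
    have h3 : θ.real {y | y ∈ Z ∧ ∃ᶠ x in 𝓝[ntRegion Ω y κ] y,
      3 * l * pot k θ x ≤ |(∫ z, f z * k z x ∂θ) - f y * pot k θ x|} ≤ θ.real A1 + θ.real A2 :=
      (measureReal_mono hsub).trans (measureReal_union_le _ _)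
    rw [le_div_iff₀ hl]
    have h4 : C * ∫ z, |f z - g z| ∂θ ≤ C * (1 / j) := by gcongr
    have h5 : l * (θ.real A1 + θ.real A2) ≤ (C + 1) * (1 / j) := by
      change l * θ.real A2 ≤ _ at h2
      linarith
    calc _ ≤ j * (θ.real A1 + θ.real A2) * l := by gcongr
      _ = j * (l * (θ.real A1 + θ.real A2)) := by ring
      _ ≤ j * ((C + 1) * (1 / j)) := by gcongr
      _ = _ := by field_simp
  have h2 : ∀ᵐ y ∂θ, ∀ n : ℕ, ¬ (y ∈ Z ∧ ∃ᶠ x in 𝓝[ntRegion Ω y κ] y,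
      3 * (1 / ((n : ℝ) + 1)) * pot k θ x ≤ |(∫ z, f z * k z x ∂θ) - f y * pot k θ x|) :=
    ae_all_iff.2 fun n => measure_eq_zero_iff_ae_notMem.1 (key (1 / ((n : ℝ) + 1)) (by positivity))
  filter_upwards [hZ, h2] with y hyZ hy
  rw [Metric.tendsto_nhds]
  intro ε hε
  obtain ⟨n, hn⟩ := exists_nat_one_div_lt (show 0 < ε / 3 by positivity)
  have h3 : ∀ᶠ x in 𝓝[ntRegion Ω y κ] y, |(∫ z, f z * k z x ∂θ) - f y * pot k θ x| <
      3 * (1 / ((n : ℝ) + 1)) * pot k θ x := by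
    by_contra hcon
    exact hy n ⟨hyZ, by simpa [Filter.not_eventually] using hcon⟩
  obtain ⟨_, m, hm, hm'⟩ := hyZ
  filter_upwards [h3, hm'] with x hx hx'
  have hpos : 0 < pot k θ x := hm.trans_le hx'
  rw [Real.dist_eq]
  have : (∫ z, f z * k z x ∂θ) / pot k θ x - f y = ((∫ z, f z * k z x ∂θ) - f y * pot k θ x) / pot k θ x := by
    field_simp
  rw [this, abs_div, abs_of_pos hpos, div_lt_iff₀ hpos]
  refine hx.trans_le ?_
  gcongr
  linarith

lemma thmA (E : Env Ω a V L R e F x₀ k) (κ : ℝ) (hκ : 1 ≤ κ) {μ θ : Measure (ES N)} [IsFiniteMeasure μ] [IsFiniteMeasure θ]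
    (hμ : μ (frontier Ω)ᶜ = 0) (hθ : θ (frontier Ω)ᶜ = 0) :
    ∀ᵐ y ∂θ, Tendsto (fun x => pot k μ x / pot k θ x) (𝓝[ntRegion Ω y κ] y)
      (𝓝 (μ.rnDeriv θ y).toReal) := by
  have hθ' : (μ + θ) (frontier Ω)ᶜ = 0 := by rw [Measure.add_apply, hμ, hθ, add_zero]
  have acμ : μ ≪ μ + θ := Measure.absolutelyContinuous_of_le (Measure.le_add_right le_rfl)
  have acθ : θ ≪ μ + θ := Measure.absolutelyContinuous_of_le (Measure.le_add_left le_rfl)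
  have h1 := acθ (E.thmA1 κ hκ hθ' (Measure.integrable_toReal_rnDeriv (μ := μ) (ν := μ + θ)))
  have h2 := acθ (E.thmA1 κ hκ hθ' (Measure.integrable_toReal_rnDeriv (μ := θ) (ν := μ + θ)))
  have i1 : μ.HaveLebesgueDecomposition (μ + θ) := Measure.haveLebesgueDecomposition_of_sigmaFinite _ _
  have i2 : θ.HaveLebesgueDecomposition (μ + θ) := Measure.haveLebesgueDecomposition_of_sigmaFinite _ _
  have pμ : ∀ x, ∫ z, (μ.rnDeriv (μ + θ) z).toReal * k z x ∂(μ + θ) = pot k μ x := fun x => by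
    unfold pot; simpa only [smul_eq_mul] using integral_rnDeriv_smul (f := fun z => k z x) acμ
  have pθ : ∀ x, ∫ z, (θ.rnDeriv (μ + θ) z).toReal * k z x ∂(μ + θ) = pot k θ x := fun x => by
    unfold pot; simpa only [smul_eq_mul] using integral_rnDeriv_smul (f := fun z => k z x) acθ
  simp only [pμ, pθ] at h1 h2
  filter_upwards [h1, h2, Measure.rnDeriv_eq_div_rnDeriv_add μ θ, Measure.rnDeriv_pos acθ,
    acθ (Measure.rnDeriv_lt_top θ (μ + θ))] with y hy1 hy2 hy3 hy4 hy5
  have hp : 0 < (θ.rnDeriv (μ + θ) y).toReal := ENNReal.toReal_pos hy4.ne' hy5.ne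
  rw [hy3]
  simp only [ENNReal.toReal_div]
  refine (hy1.div hy2 hp.ne').congr' ?_
  filter_upwards [hy2.eventually_ne hp.ne'] with x hx
  have hne : pot k (μ + θ) x ≠ 0 := by
    intro h; rw [h, div_zero] at hx; exact hx rfl
  exact div_div_div_cancel_right₀ hne _ _

end Env

end


section
variable {N : ℕ} {Ω : Set (ES N)} {a : ℝ} {V : ES N → ℝ} {L R : ℝ} {e : ES N → ES N}
  {F : ES N → ES N → ℝ} {x₀ : ES N} {k : ES N → ES N → ℝ}

/-- Good scales: a sequence whose geometric averages do not tend to zero dominates them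
infinitely often. -/
lemma seqGood (q : ℝ) (hq0 : 0 < q) (hq1 : q < 1) : ∃ Cq : ℝ, 1 ≤ Cq ∧ ∀ ε > 0, ∃ J : ℕ,
    ∀ (s : ℕ → ℝ) (D m : ℝ), (∀ n, 0 ≤ s n) → 0 ≤ D → 0 < m →
    (∀ᶠ n in atTop, m ≤ s n + (∑ i ∈ Finset.range n, q ^ i * s (n - i - 1) + q ^ n * D)) →
    ∃ᶠ n in atTop, s n + (∑ i ∈ Finset.range n, q ^ i * s (n - i - 1) + q ^ n * D) ≤ Cq * s n ∧
      ∑ i ∈ Finset.Ico J n, q ^ i * s (n - i - 1) + q ^ n * D ≤ ε * s n := by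
  set p := √q with hp
  have hp0 : 0 < p := Real.sqrt_pos.2 hq0
  have hp1 : p < 1 := by rw [hp, Real.sqrt_lt' one_pos]; simpa using hq1
  have hpq : q = p * p := (Real.mul_self_sqrt hq0.le).symm
  have hG : ∀ J n, ∑ i ∈ Finset.Ico J n, p ^ i / p ≤ p ^ J / (1 - p) / p := by
    intro J n
    rw [← Finset.sum_div]
    gcongr
    exact geom_sum_Ico_le_of_lt_one hp0.le hp1
  have hG0 : ∀ n, ∑ i ∈ Finset.range n, p ^ i / p ≤ 1 / (1 - p) / p := by
    intro n
    have := hG 0 n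
    rwa [← Finset.range_eq_Ico, pow_zero] at this
  have h1p : 0 < 1 - p := by linarith
  refine ⟨2 + 1 / (1 - p) / p, by linarith [show 0 ≤ 1 / (1 - p) / p by positivity], ?_⟩
  intro ε hε
  obtain ⟨J, hJ⟩ := exists_pow_lt_of_lt_one (show 0 < ε / 2 * p * (1 - p) by positivity) hp1
  have hJ' : p ^ J / (1 - p) / p ≤ ε / 2 := by
    rw [div_div, div_le_iff₀ (by positivity)]
    linarith [show ε / 2 * ((1 - p) * p) = ε / 2 * p * (1 - p) by ring]
  refine ⟨J, ?_⟩
  intro s D m hs hD hm hev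
  -- termwise estimate
  have term : ∀ n (T : ℝ), (∀ j < n, s j ≤ T * p ^ j) → ∀ i < n,
      q ^ i * s (n - i - 1) ≤ (p ^ i / p) * (T * p ^ n) := by
    intro n T hT i hi
    have h1 := hT (n - i - 1) (by omega)
    have h2 : p ^ n = p ^ (n - i - 1) * (p ^ i * p) := by
      rw [← pow_succ, ← pow_add]; congr 1; omega
    calc q ^ i * s (n - i - 1) ≤ q ^ i * (T * p ^ (n - i - 1)) := by gcongr
      _ = (p ^ i / p) * (T * p ^ n) := by
        rw [h2, hpq, mul_pow]; field_simp
  have hqp : ∀ n, q ^ n * D ≤ D * p ^ n := by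
    intro n
    have : p ^ n ≤ 1 := pow_le_one₀ hp0.le hp1.le
    rw [hpq, mul_pow]
    have h3 : 0 ≤ p ^ n * D := by positivity
    nlinarith
  by_cases hb : ∃ B : ℝ, ∀ n, s n ≤ B * p ^ n
  · exfalso
    obtain ⟨B, hB⟩ := hb
    have hB0 : 0 ≤ B := by have := hB 0; simp at this; linarith [hs 0]
    have hlim : Tendsto (fun n => (B + 1 / (1 - p) / p * B + D) * p ^ n) atTop (𝓝 0) := by
      simpa using (tendsto_pow_atTop_nhds_zero_of_lt_one hp0.le hp1).const_mul
        (B + 1 / (1 - p) / p * B + D)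
    have h2 := hlim.eventually_lt_const hm
    obtain ⟨n, h3, h4⟩ := (hev.and h2).exists
    have h5 : ∑ i ∈ Finset.range n, q ^ i * s (n - i - 1) ≤ 1 / (1 - p) / p * (B * p ^ n) := by
      calc _ ≤ ∑ i ∈ Finset.range n, (p ^ i / p) * (B * p ^ n) :=
            Finset.sum_le_sum fun i hi => term n B (fun j _ => hB j) i (Finset.mem_range.1 hi)
        _ = (∑ i ∈ Finset.range n, p ^ i / p) * (B * p ^ n) := by rw [Finset.sum_mul]
        _ ≤ _ := by gcongr; exact hG0 n
    linarith [hB n, hqp n,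
      show (B + 1 / (1 - p) / p * B + D) * p ^ n = B * p ^ n + 1 / (1 - p) / p * (B * p ^ n) + D * p ^ n by ring]
  · push Not at hb
    rw [frequently_atTop]
    intro n0
    classical
    set B : ℝ := 1 + D + 2 * D / ε + ∑ j ∈ Finset.range n0, s j / p ^ j with hB
    have hsum : 0 ≤ ∑ j ∈ Finset.range n0, s j / p ^ j :=
      Finset.sum_nonneg fun j _ => div_nonneg (hs j) (by positivity)
    have hB1 : 0 ≤ 2 * D / ε := by positivity
    have hex := hb B
    set n := Nat.find hex with hn
    have hn1 : B * p ^ n < s n := Nat.find_spec hex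
    have hn2 : ∀ j < n, s j ≤ B * p ^ j := fun j hj => not_lt.1 (Nat.find_min hex hj)
    have hn0 : n0 ≤ n := by
      by_contra hlt
      push Not at hlt
      have := Finset.single_le_sum (f := fun j => s j / p ^ j)
        (fun j _ => div_nonneg (hs j) (by positivity)) (Finset.mem_range.2 hlt)
      have h3 : s n / p ^ n ≤ B := by linarith
      rw [div_le_iff₀ (by positivity)] at h3
      linarith
    have hpn : 0 < p ^ n := by positivity
    have T : ∀ i < n, q ^ i * s (n - i - 1) ≤ (p ^ i / p) * s n := fun i hi =>
      (term n B hn2 i hi).trans (by gcongr)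
    have hD1 : q ^ n * D ≤ s n := by
      have : D * p ^ n ≤ B * p ^ n := by gcongr; linarith
      linarith [hqp n]
    have hD2 : q ^ n * D ≤ ε / 2 * s n := by
      have : 2 * D / ε * p ^ n ≤ B * p ^ n := by gcongr; linarith
      have h3 : D * p ^ n = ε / 2 * (2 * D / ε * p ^ n) := by field_simp
      have h4 := hqp n
      rw [h3] at h4
      refine h4.trans ?_
      gcongr
      linarith
    refine ⟨n, hn0, ?_, ?_⟩
    · have : ∑ i ∈ Finset.range n, q ^ i * s (n - i - 1) ≤ 1 / (1 - p) / p * s n := by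
        calc _ ≤ ∑ i ∈ Finset.range n, (p ^ i / p) * s n :=
              Finset.sum_le_sum fun i hi => T i (Finset.mem_range.1 hi)
          _ = (∑ i ∈ Finset.range n, p ^ i / p) * s n := by rw [Finset.sum_mul]
          _ ≤ _ := by gcongr; exacts [hs n, hG0 n]
      linarith [show (2 + 1 / (1 - p) / p) * s n = s n + 1 / (1 - p) / p * s n + s n by ring]
    · have : ∑ i ∈ Finset.Ico J n, q ^ i * s (n - i - 1) ≤ ε / 2 * s n := by
        calc _ ≤ ∑ i ∈ Finset.Ico J n, (p ^ i / p) * s n :=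
              Finset.sum_le_sum fun i hi => T i (Finset.mem_Ico.1 hi).2
          _ = (∑ i ∈ Finset.Ico J n, p ^ i / p) * s n := by rw [Finset.sum_mul]
          _ ≤ _ := by gcongr; exacts [hs n, (hG J n).trans hJ']
      linarith

end


section
variable {N : ℕ} {Ω : Set (ES N)} {a : ℝ} {V : ES N → ℝ} {L R : ℝ} {e : ES N → ES N}
  {F : ES N → ES N → ℝ} {x₀ : ES N} {k : ES N → ES N → ℝ}

/-- mass function at scale `n` -/
def phi (L : ℝ) (e : ES N → ES N) (k : ES N → ES N → ℝ) (θ : Measure (ES N)) (t0 : ℝ) (y : ES N) (n : ℕ) : ℝ :=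
  θ.real (ball y (48 * L * (t0 / 8 ^ n))) * k y (y + (t0 / 8 ^ n) • e y)

namespace Env

lemma tail0 (E : Env Ω a V L R e F x₀ k) : ∃ q t1 : ℝ, 0 < q ∧ q < 1 ∧ 0 < t1 ∧ ∀ t0, 0 < t0 → t0 ≤ t1 → ∃ C : ℝ, 1 ≤ C ∧
    768 * L ^ 2 * t0 ≤ R ∧ ∀ y ∈ frontier Ω, ∀ n : ℕ, ∀ z ∈ frontier Ω,
      (dist z y < 48 * L * (t0 / 8 ^ n) →
        k z (y + (t0 / 8 ^ n) • e y) ≤ C * k y (y + (t0 / 8 ^ n) • e y) ∧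
        k y (y + (t0 / 8 ^ n) • e y) ≤ C * k z (y + (t0 / 8 ^ n) • e y)) ∧
      (∀ i < n, 48 * L * (8 ^ i * (t0 / 8 ^ n)) ≤ dist z y →
        k z (y + (t0 / 8 ^ n) • e y) ≤ C * (q ^ i * k y (y + (t0 / 8 ^ (n - i - 1)) • e y))) ∧
      (48 * L * t0 ≤ dist z y → k z (y + (t0 / 8 ^ n) • e y) ≤ C * q ^ n) := by
  obtain ⟨C1, q, hC1, hq0, hq1, H1⟩ := E.cdecay
  obtain ⟨C2, ρ₀, hC2, hρ₀, H2⟩ := E.lem2 L (48 * L) E.hG.L1 (by linarith [E.L0])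
  obtain ⟨C3, hC3, H3⟩ := E.conn' 8 1 (by norm_num) one_pos le_rfl
  have hL0 := E.L0
  have hL1 := E.hG.L1
  have hL2 := E.L2
  have hLL := E.LL2
  have hR := E.hG.R0
  refine ⟨q, min (R / (768 * L ^ 2)) (ρ₀ / 4), hq0, hq1, by positivity, ?_⟩
  intro t0 ht0 ht1
  have h768 : 768 * L ^ 2 * t0 ≤ R := by
    have := ht1.trans (min_le_left _ _)
    rw [le_div_iff₀ (by positivity)] at this; linarith
  have hρ : t0 ≤ ρ₀ / 4 := ht1.trans (min_le_right _ _)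
  obtain ⟨C4, hC4, H4⟩ := E.globk (2 * t0 / L) (by positivity)
  have hLt : L * t0 ≤ L ^ 2 * t0 := by gcongr
  -- cork points
  have hL2t : t0 ≤ L ^ 2 * t0 := by nlinarith
  have cork : ∀ y ∈ frontier Ω, ∀ r, 0 < r → r ≤ 2 * t0 → 96 * L ^ 2 * r ≤ R := by
    intro y hy r hr hr2
    have : L ^ 2 * r ≤ L ^ 2 * (2 * t0) := by gcongr
    nlinarith
  have cmp : ∀ y ∈ frontier Ω, ∀ r, 0 < r → r ≤ 2 * t0 → ∀ z ∈ frontier Ω, ∀ z' ∈ frontier Ω,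
      dist z' y ≤ 2 * dist z y + 48 * L * r → k z (y + r • e y) ≤ C2 * k z' (y + r • e y) := by
    intro y hy r hr hr2 z hz z' hz' hd
    have hr' := cork y hy r hr hr2
    have hA := E.hG.A_dist hy hr
    refine H2 y hy _ (E.A_mem hy hr hr') ?_ ?_ z hz z' hz' ?_
    · rw [hA]
      have := E.A_dista hy hr hr'
      rw [div_le_iff₀ hL0] at this; linarith
    · rw [hA]; linarith
    · rw [hA]; exact hd
  have dec : ∀ y ∈ frontier Ω, ∀ n i : ℕ, i ≤ n → ∀ z ∈ frontier Ω,
      48 * L * (8 ^ i * (t0 / 8 ^ n)) ≤ dist z y →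
      k z (y + (t0 / 8 ^ n) • e y) ≤ q ^ i * (C1 * k z (y + (2 * (8 ^ i * (t0 / 8 ^ n))) • e y)) := by
    intro y hy n i hi z hz hd
    have ht : 0 < t0 / 8 ^ n := by positivity
    have h8 : (8:ℝ) ^ i ≤ 8 ^ n := pow_le_pow_right₀ (by norm_num) hi
    have hle : 8 ^ i * (t0 / 8 ^ n) ≤ t0 := by
      rw [← mul_div_assoc, div_le_iff₀ (by positivity)]; nlinarith
    have hlen : t0 / 8 ^ n ≤ t0 := div_le_self ht0.le (one_le_pow₀ (by norm_num))
    have hr : 0 < 2 * (8 ^ i * (t0 / 8 ^ n)) := by positivity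
    have hz' : ball y (24 * L * (2 * (8 ^ i * (t0 / 8 ^ n)))) ⊆ {z}ᶜ := by
      intro w hw hwz
      rw [mem_singleton_iff] at hwz
      rw [mem_ball, hwz] at hw
      linarith
    refine H1 y hy _ hr ?_ (k z) ((E.hk.sol z hz).mono inter_subset_left)
      (fun x hx _ => E.kn hz x hx) ((E.hk.van z hz).mono hz') i _
      (E.A_mem hy ht (cork y hy _ ht (by linarith))) ?_
    · have : L * (8 ^ i * (t0 / 8 ^ n)) ≤ L * t0 := by gcongr
      nlinarith
    · rw [E.hG.A_dist hy ht, lt_div_iff₀ (by positivity)]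
      nlinarith [show 0 < t0 / 8 ^ n * 8 ^ i by positivity]
  have hC12 : 1 ≤ C1 * C2 := by nlinarith
  have hC : C2 ≤ C1 * C2 * C3 * C4 := by
    calc C2 ≤ C1 * C2 := by nlinarith
      _ ≤ C1 * C2 * C3 := le_mul_of_one_le_right (by positivity) hC3
      _ ≤ _ := le_mul_of_one_le_right (by positivity) hC4
  refine ⟨C1 * C2 * C3 * C4, by linarith, h768, ?_⟩
  intro y hy n z hz
  have ht : 0 < t0 / 8 ^ n := by positivity
  have hlen : t0 / 8 ^ n ≤ t0 := div_le_self ht0.le (one_le_pow₀ (by norm_num))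
  have hAm := E.A_mem hy ht (cork y hy _ ht (by linarith))
  refine ⟨?_, ?_, ?_⟩
  · intro hd
    constructor
    · refine (cmp y hy _ ht (by linarith) z hz y hy ?_).trans ?_
      · rw [dist_self]; positivity
      · have := E.kn hy _ hAm
        gcongr
    · refine (cmp y hy _ ht (by linarith) y hy z hz ?_).trans ?_
      · rw [dist_self]; linarith
      · have := E.kn hz _ hAm
        gcongr
  · intro i hi hd
    have h1 := dec y hy n i hi.le z hz hd
    set r := 8 ^ i * (t0 / 8 ^ n) with hr
    have hr0 : 0 < r := by positivity
    have hr8 : t0 / 8 ^ (n - i - 1) = 8 * r := by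
      have : (8:ℝ) ^ n = 8 ^ (n - i - 1) * (8 ^ i * 8) := by
        rw [← pow_succ, ← pow_add]; congr 1; omega
      rw [hr, this]; field_simp
    have hrt : 8 * r ≤ t0 := by rw [← hr8]; exact div_le_self ht0.le (one_le_pow₀ (by norm_num))
    have h2 := cmp y hy (2 * r) (by positivity) (by linarith) z hz y hy (by rw [dist_self]; positivity)
    have h3 := H3 y hy r hr0 (by nlinarith) (k y) (E.hk.sol y hy) (E.kn hy) (y + (2 * r) • e y)
      (y + (8 * r) • e y) (by rw [E.F_A hy]; linarith) (by rw [E.F_A hy]; linarith)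
      (by rw [E.hG.A_dist hy (by positivity)]; linarith) (by rw [E.hG.A_dist hy (by positivity)])
    rw [hr8]
    have h4 := E.kn hy _ (E.A_mem hy (show 0 < 8 * r by positivity) (cork y hy _ (by positivity) (by linarith)))
    calc _ ≤ q ^ i * (C1 * (C2 * (C3 * k y (y + (8 * r) • e y)))) := by
          refine h1.trans ?_
          gcongr
          exact h2.trans (by gcongr)
      _ = (C1 * C2 * C3) * (q ^ i * k y (y + (8 * r) • e y)) := by ring
      _ ≤ _ := mul_le_mul_of_nonneg_right (le_mul_of_one_le_right (by positivity) hC4)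
        (by positivity)
  · intro hd
    have hr8 : 8 ^ n * (t0 / 8 ^ n) = t0 := by field_simp
    have h1 := dec y hy n n le_rfl z hz (by rw [hr8]; exact hd)
    rw [hr8] at h1
    have h5 := cork y hy (2 * t0) (by positivity) le_rfl
    have h2 := (H4 _ (E.A_mem hy (by positivity) h5) (E.A_dista hy (by positivity) h5) z hz).2
    calc _ ≤ q ^ n * (C1 * C4) := h1.trans (by gcongr)
      _ = (C1 * C4) * q ^ n := by ring
      _ ≤ _ := by
        gcongr
        rw [mul_assoc C1]
        refine le_mul_of_one_le_right (by positivity) (by nlinarith)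

lemma phi_nonneg (E : Env Ω a V L R e F x₀ k) {θ : Measure (ES N)} {t0 : ℝ} (ht0 : 0 < t0) (h : 768 * L ^ 2 * t0 ≤ R) {y : ES N}
    (hy : y ∈ frontier Ω) (n : ℕ) : 0 ≤ phi L e k θ t0 y n := by
  have hlen : t0 / 8 ^ n ≤ t0 := div_le_self ht0.le (one_le_pow₀ (by norm_num))
  refine mul_nonneg measureReal_nonneg (E.kn hy _ (E.A_mem hy (by positivity) ?_))
  have := E.L2
  have : L ^ 2 * (t0 / 8 ^ n) ≤ L ^ 2 * t0 := by gcongr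
  nlinarith [show 0 < L ^ 2 * t0 by positivity]

lemma tail (E : Env Ω a V L R e F x₀ k) : ∃ q t1 : ℝ, 0 < q ∧ q < 1 ∧ 0 < t1 ∧ ∀ t0, 0 < t0 → t0 ≤ t1 → ∃ C : ℝ, 1 ≤ C ∧
    768 * L ^ 2 * t0 ≤ R ∧ ∀ (θ : Measure (ES N)) [IsFiniteMeasure θ], θ (frontier Ω)ᶜ = 0 →
    ∀ y ∈ frontier Ω, ∀ n : ℕ,
      phi L e k θ t0 y n ≤ C * pot k θ (y + (t0 / 8 ^ n) • e y) ∧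
      pot k θ (y + (t0 / 8 ^ n) • e y) ≤ C * (phi L e k θ t0 y n +
        (∑ i ∈ Finset.range n, q ^ i * phi L e k θ t0 y (n - i - 1) + q ^ n * θ.real univ)) ∧
      ∀ J : ℕ, ∫ z in {z | 48 * L * (8 ^ J * (t0 / 8 ^ n)) ≤ dist z y}, k z (y + (t0 / 8 ^ n) • e y) ∂θ
        ≤ C * (∑ i ∈ Finset.Ico J n, q ^ i * phi L e k θ t0 y (n - i - 1) + q ^ n * θ.real univ) := by
  obtain ⟨q, t1, hq0, hq1, ht1, H⟩ := E.tail0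
  refine ⟨q, t1, hq0, hq1, ht1, fun t0 ht0 ht01 => ?_⟩
  obtain ⟨C, hC, h768, H⟩ := H t0 ht0 ht01
  refine ⟨C, hC, h768, ?_⟩
  intro θ _ hθ y hy n
  have hL0 := E.L0
  have hae : ∀ᵐ z ∂θ, z ∈ frontier Ω := mem_ae_iff.2 hθ
  have hcork : ∀ m : ℕ, y + (t0 / 8 ^ m) • e y ∈ Ω := by
    intro m
    have hlen : t0 / 8 ^ m ≤ t0 := div_le_self ht0.le (one_le_pow₀ (by norm_num))
    refine E.A_mem hy (by positivity) ?_
    have : L ^ 2 * (t0 / 8 ^ m) ≤ L ^ 2 * t0 := by gcongr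
    nlinarith [show 0 < L ^ 2 * t0 by positivity]
  have hAm := hcork n
  have hki := E.ki hθ hAm
  set A := y + (t0 / 8 ^ n) • e y with hA
  have ht : 0 < t0 / 8 ^ n := by positivity
  have hS : ∀ J : ℕ, MeasurableSet {z : ES N | 48 * L * (8 ^ J * (t0 / 8 ^ n)) ≤ dist z y} := fun J =>
    measurableSet_le measurable_const (measurable_id.dist measurable_const)
  have tl : ∀ J : ℕ, ∫ z in {z | 48 * L * (8 ^ J * (t0 / 8 ^ n)) ≤ dist z y}, k z A ∂θ
        ≤ C * (∑ i ∈ Finset.Ico J n, q ^ i * phi L e k θ t0 y (n - i - 1) + q ^ n * θ.real univ) := by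
    intro J
    have hintgr : ∀ i, Integrable (fun z => q ^ i *
        (ball y (48 * L * (t0 / 8 ^ (n - i - 1)))).indicator
          (fun _ => k y (y + (t0 / 8 ^ (n - i - 1)) • e y)) z) θ := fun i =>
      ((integrable_const _).indicator measurableSet_ball).const_mul _
    have hval : ∫ z, C * ((∑ i ∈ Finset.Ico J n, q ^ i *
        (ball y (48 * L * (t0 / 8 ^ (n - i - 1)))).indicator
          (fun _ => k y (y + (t0 / 8 ^ (n - i - 1)) • e y)) z) + q ^ n) ∂θ =
        C * (∑ i ∈ Finset.Ico J n, q ^ i * phi L e k θ t0 y (n - i - 1) + q ^ n * θ.real univ) := by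
      rw [integral_const_mul, integral_add (integrable_finset_sum _ fun i _ => hintgr i) (integrable_const _),
        integral_finset_sum _ fun i _ => hintgr i]
      congr 2
      · refine Finset.sum_congr rfl fun i _ => ?_
        rw [integral_const_mul, integral_indicator_const _ measurableSet_ball]
        rfl
      · rw [integral_const, smul_eq_mul, mul_comm]
    rw [← hval, ← integral_indicator (hS J)]
    refine integral_mono_ae (hki.indicator (hS J))
      (((integrable_finset_sum _ fun i _ => hintgr i).add (integrable_const _)).const_mul _) ?_
    filter_upwards [hae] with z hz
    have hnn : ∀ i, 0 ≤ q ^ i *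
        (ball y (48 * L * (t0 / 8 ^ (n - i - 1)))).indicator
          (fun _ => k y (y + (t0 / 8 ^ (n - i - 1)) • e y)) z := fun i =>
      mul_nonneg (by positivity) (indicator_nonneg (fun _ _ => E.kn hy _ (hcork _)) _)
    by_cases hzS : z ∈ {z : ES N | 48 * L * (8 ^ J * (t0 / 8 ^ n)) ≤ dist z y}
    · rw [indicator_of_mem hzS]
      have hzS' : 48 * L * (8 ^ J * (t0 / 8 ^ n)) ≤ dist z y := hzS
      by_cases hfar : 48 * L * t0 ≤ dist z y
      · refine ((H y hy n z hz).2.2 hfar).trans ?_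
        gcongr
        have := Finset.sum_nonneg fun i (_ : i ∈ Finset.Ico J n) => hnn i
        linarith
      · push Not at hfar
        -- greatest index
        have hmono : ∀ i j : ℕ, i ≤ j → 48 * L * (8 ^ i * (t0 / 8 ^ n)) ≤ 48 * L * (8 ^ j * (t0 / 8 ^ n)) := by
          intro i j hij
          have : (8:ℝ) ^ i ≤ 8 ^ j := pow_le_pow_right₀ (by norm_num) hij
          gcongr
        have hn8 : 8 ^ n * (t0 / 8 ^ n) = t0 := by field_simp
        have hlt : ∀ i, 48 * L * (8 ^ i * (t0 / 8 ^ n)) ≤ dist z y → i < n := by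
          intro i hi
          by_contra hni
          push Not at hni
          have := hmono n i hni
          rw [hn8] at this
          linarith
        classical
        set P : ℕ → Prop := fun i => 48 * L * (8 ^ i * (t0 / 8 ^ n)) ≤ dist z y with hP
        have hJn := hlt J hzS'
        set i := Nat.findGreatest P n with hi
        have hPi : P i := Nat.findGreatest_spec (P := P) hJn.le hzS'
        have hJi : J ≤ i := Nat.le_findGreatest hJn.le hzS'
        have hin := hlt i hPi
        have hPi1 : ¬ P (i + 1) := Nat.findGreatest_is_greatest (P := P) (Nat.lt_succ_self i) (by omega)
        have hb : z ∈ ball y (48 * L * (t0 / 8 ^ (n - i - 1))) := by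
          rw [mem_ball]
          have h1 : dist z y < 48 * L * (8 ^ (i + 1) * (t0 / 8 ^ n)) := not_le.1 hPi1
          have h2 : t0 / 8 ^ (n - i - 1) = 8 ^ (i + 1) * (t0 / 8 ^ n) := by
            have : (8:ℝ) ^ n = 8 ^ (n - i - 1) * 8 ^ (i + 1) := by
              rw [← pow_add]; congr 1; omega
            rw [this]; field_simp
          rw [h2]; exact h1
        refine ((H y hy n z hz).2.1 i hin hPi).trans ?_
        gcongr
        have h3 := Finset.single_le_sum (f := fun i => q ^ i *
          (ball y (48 * L * (t0 / 8 ^ (n - i - 1)))).indicator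
          (fun _ => k y (y + (t0 / 8 ^ (n - i - 1)) • e y)) z) (fun i _ => hnn i)
          (Finset.mem_Ico.2 ⟨hJi, hin⟩)
        simp only [indicator_of_mem hb] at h3
        have : 0 < q ^ n := by positivity
        linarith
    · rw [indicator_of_notMem hzS]
      have := Finset.sum_nonneg fun i (_ : i ∈ Finset.Ico J n) => hnn i
      positivity
  have hball : ∀ z ∈ frontier Ω, z ∈ ball y (48 * L * (t0 / 8 ^ n)) → k z A ≤ C * k y A ∧ k y A ≤ C * k z A :=
    fun z hz hzb => (H y hy n z hz).1 hzb
  have hsplit := integral_add_compl (measurableSet_ball (x := y) (ε := 48 * L * (t0 / 8 ^ n))) hki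
  have hcompl : (ball y (48 * L * (t0 / 8 ^ n)))ᶜ = {z | 48 * L * (8 ^ 0 * (t0 / 8 ^ n)) ≤ dist z y} := by
    ext z; simp
  have hphi : ∫ z in ball y (48 * L * (t0 / 8 ^ n)), k y A ∂θ = phi L e k θ t0 y n := by
    rw [setIntegral_const]; rfl
  have haeb : ∀ᵐ z ∂(θ.restrict (ball y (48 * L * (t0 / 8 ^ n)))), z ∈ frontier Ω := ae_restrict_of_ae hae
  refine ⟨?_, ?_, tl⟩
  · have h1 : ∫ z in ball y (48 * L * (t0 / 8 ^ n)), k y A ∂θ ≤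
        ∫ z in ball y (48 * L * (t0 / 8 ^ n)), C * k z A ∂θ := by
      refine integral_mono_ae (integrable_const _) (hki.integrableOn.const_mul _) ?_
      filter_upwards [haeb, ae_restrict_mem measurableSet_ball] with z hz hzb
      exact (hball z hz hzb).2
    rw [hphi, integral_const_mul] at h1
    refine h1.trans ?_
    have : ∫ z in ball y (48 * L * (t0 / 8 ^ n)), k z A ∂θ ≤ pot k θ A := by
      refine setIntegral_le_integral hki ?_
      filter_upwards [hae] with z hz
      exact E.kn hz _ hAm
    gcongr
  · have h1 : ∫ z in ball y (48 * L * (t0 / 8 ^ n)), k z A ∂θ ≤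
        ∫ z in ball y (48 * L * (t0 / 8 ^ n)), C * k y A ∂θ := by
      refine integral_mono_ae hki.integrableOn (integrable_const _) ?_
      filter_upwards [haeb, ae_restrict_mem measurableSet_ball] with z hz hzb
      exact (hball z hz hzb).1
    rw [integral_const_mul, hphi] at h1
    have h2 := tl 0
    rw [← hcompl, ← Finset.range_eq_Ico] at h2
    have h3 : pot k θ A = ∫ z, k z A ∂θ := rfl
    rw [h3, ← hsplit]
    linarith [mul_add C (phi L e k θ t0 y n)
      (∑ i ∈ Finset.range n, q ^ i * phi L e k θ t0 y (n - i - 1) + q ^ n * θ.real univ)]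

end Env

end


section
variable {N : ℕ} {Ω : Set (ES N)} {a : ℝ} {V : ES N → ℝ} {L R : ℝ} {e : ES N → ES N}
  {F : ES N → ES N → ℝ} {x₀ : ES N} {k h : ES N → ES N → ℝ} {c : ES N → ℝ}

/-- The two kernels together with the comparison function `c`. -/
structure Env2 (Ω : Set (ES N)) (a : ℝ) (V : ES N → ℝ) (L R : ℝ) (e : ES N → ES N)
    (F : ES N → ES N → ℝ) (x₀ : ES N) (k h : ES N → ES N → ℝ) (c : ES N → ℝ) : Prop where
  ha : 0 ≤ a
  E : Env Ω a V L R e F x₀ k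
  E0 : Env Ω a (fun _ => 0) L R e F x₀ h
  c0 : ∀ y ∈ frontier Ω, 0 ≤ c y
  c1 : ∀ y ∈ frontier Ω, c y ≤ 1
  le : ∀ y ∈ frontier Ω, ∀ x ∈ Ω, c y * k y x ≤ h y x
  great : ∀ y ∈ frontier Ω, ∀ ε > 0, ∃ x ∈ Ω, h y x < (c y + ε) * k y x

lemma lemQ (hN : 0 < N) (hV : Pot Ω a V) (ha : 0 ≤ a) (hG : Geo Ω L R e F) (κ l : ℝ) (hκ : 1 ≤ κ)
    (hl : 0 < l) :
    ∃ c1 b : ℝ, 0 < c1 ∧ 0 < b ∧ ∀ y ∈ frontier Ω, ∀ x ∈ Ω, dist x y ≤ κ * dista Ω x →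
    ∀ g u : ES N → ℝ, Sol (fun _ => 0) Ω g → Sol V Ω u → (∀ x ∈ Ω, 0 ≤ u x) → (∀ x ∈ Ω, u x ≤ g x) →
    ∀ M : ℝ, l * M ≤ g x - u x → u x ≤ M → ∀ x' ∈ ball x (b * dist x y), c1 * M ≤ g x' - u x' := by
  obtain ⟨c, hc0, hc1, H⟩ := wh_int N a
  have hτ : ∃ τ : ℝ, 0 < τ ∧ τ < 1 / 8 ∧ Real.exp (a * τ ^ 2 / 4) < 1 + l / 2 := by
    have h1 : Tendsto (fun τ : ℝ => Real.exp (a * τ ^ 2 / 4)) (𝓝[>] 0) (𝓝 1) := by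
      have : Continuous fun τ : ℝ => Real.exp (a * τ ^ 2 / 4) := by fun_prop
      have h2 := this.tendsto 0
      simp only [ne_eq, OfNat.ofNat_ne_zero, not_false_eq_true, zero_pow, mul_zero, zero_div,
        Real.exp_zero] at h2
      exact h2.mono_left nhdsWithin_le_nhds
    have h3 := h1.eventually_lt_const (show (1:ℝ) < 1 + l / 2 by linarith)
    have h4 : ∀ᶠ τ : ℝ in 𝓝[>] 0, τ ∈ Ioo (0:ℝ) (1 / 8) := Ioo_mem_nhdsGT (by norm_num)
    obtain ⟨τ, h5, h6⟩ := (h3.and h4).exists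
    exact ⟨τ, h6.1, h6.2, h5⟩
  obtain ⟨τ, hτ0, hτ8, hτ⟩ := hτ
  have hκ0 : 0 < κ := by linarith
  refine ⟨c * (l / 2), τ / κ, by positivity, by positivity, ?_⟩
  intro y hy x hx hxκ g u hg hu hu0 hug M hlM huM x' hx'
  have hd := dista_pos hN hG hx
  set d := dista Ω x with hdd
  have hV0 : Pot Ω a (fun _ => 0) := pot_zero hG.opn ha
  have hΩd : ball x d ⊆ Ω := ball_sub_of_le_dista le_rfl
  have ht : 0 < τ * (d / 2) := by positivity
  have htT : τ * (d / 2) < d / 2 := by nlinarith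
  have hbT : ball x (d / 2) ⊆ Ω := (ball_subset_ball (by linarith)).trans hΩd
  have m1 := mean_le hV0 Subset.rfl hG.opn hg.2 ht htT hbT (B := 0)
    (by intro y _ p h _ _; simp)
  have m2 := mean_le hV Subset.rfl hG.opn hu.1 ht htT hbT (B := a / (d / 2) ^ 2) (by
    intro y hyb p h hp hph
    have h1 := hV.bd x (d / 2) (by positivity) (by rw [mul_div_cancel₀ d two_ne_zero]; exact hΩd) y hyb
    have h2 : V y ≤ a / (d / 2) ^ 2 := by rw [le_div_iff₀ (by positivity)]; exact h1
    have h3 := hu0 y (hbT hyb)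
    have h4 : 0 ≤ a / (d / 2) ^ 2 := by positivity
    have h5 : 0 ≤ h := hp.trans hph
    calc V y * u y * p ≤ a / (d / 2) ^ 2 * u y * p := by gcongr
      _ ≤ _ := by gcongr)
  have he : a / (d / 2) ^ 2 * (τ * (d / 2)) ^ 2 / 4 = a * τ ^ 2 / 4 := by field_simp
  rw [he] at m2
  simp only [zero_mul, zero_div, Real.exp_zero, one_mul] at m1
  have i1 := phi_int hG.opn hg.1.1 ht htT hbT
  have i2 := phi_int hG.opn hu.1.1 ht htT hbT
  have hw : Sp V Ω (fun x => g x + -u x) :=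
    (hg.1.change hV0 hV hG.opn Subset.rfl (fun x hx => by
      rw [zero_mul]; exact mul_nonneg (hV.nn x hx) ((hu0 x hx).trans (hug x hx)))).add hV hG.opn Subset.rfl hu.2
  have m3 := H Ω Ω V hV Subset.rfl hG.opn _ hw x (τ * (d / 2)) ht
    ((ball_subset_ball (by nlinarith)).trans hΩd) ((ball_subset_ball (by nlinarith)).trans hΩd)
    (fun y hyb => by
      have := hug y (((ball_subset_ball (by nlinarith)).trans hΩd) hyb)
      linarith) x' (by
      rw [mem_ball] at hx'
      have : τ / κ * dist x y ≤ τ / κ * (κ * d) := by gcongr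
      have h3 : τ / κ * (κ * d) = τ * d := by field_simp
      linarith)
  have hC : 0 < cη N := cη_pos
  have e1 : ∫ y, (g y + -u y) * kη x (τ * (d / 2)) y =
      (∫ y, g y * kη x (τ * (d / 2)) y) - ∫ y, u y * kη x (τ * (d / 2)) y := by
    rw [← integral_sub i1 i2]; congr 1; ext y; ring
  have e2 : ∫ y, -g y * kη x (τ * (d / 2)) y = -∫ y, g y * kη x (τ * (d / 2)) y := by
    rw [← integral_neg]; congr 1; ext y; ring
  rw [e1] at m3
  rw [e2] at m1
  have hM : 0 ≤ M := (hu0 x hx).trans huM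
  have key : cη N * (l / 2 * M) ≤ (∫ y, g y * kη x (τ * (d / 2)) y) - ∫ y, u y * kη x (τ * (d / 2)) y := by
    have h1 : Real.exp (a * τ ^ 2 / 4) * (cη N * u x) ≤ (1 + l / 2) * (cη N * u x) :=
      mul_le_mul_of_nonneg_right hτ.le (mul_nonneg hC.le (hu0 x hx))
    have h2 : cη N * (l / 2 * M) ≤ cη N * (g x - (1 + l / 2) * u x) := by
      gcongr
      have : l / 2 * u x ≤ l / 2 * M := by gcongr
      linarith
    linarith [show cη N * (g x - (1 + l / 2) * u x) = cη N * g x - (1 + l / 2) * (cη N * u x) by ring,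
      show cη N * -g x = -(cη N * g x) by ring]
  have h5 : c * (cη N * (l / 2 * M)) ≤ cη N * (g x' + -u x') := (mul_le_mul_of_nonneg_left key hc0.le).trans m3
  have h6 : cη N * (c * (l / 2) * M) ≤ cη N * (g x' - u x') := by
    linarith [show c * (cη N * (l / 2 * M)) = cη N * (c * (l / 2) * M) by ring,
      show cη N * (g x' + -u x') = cη N * (g x' - u x') by ring]
  exact le_of_mul_le_mul_left h6 hC

/-- the potential part `q_θ = K_θ - ∫ c k dθ` -/
def qf (k h : ES N → ES N → ℝ) (c : ES N → ℝ) (θ : Measure (ES N)) (x : ES N) : ℝ :=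
  pot h θ x - ∫ z, c z * k z x ∂θ

namespace Env2

lemma c_meas (W : Env2 Ω a V L R e F x₀ k h c) : Measurable ((frontier Ω).indicator c) := by
  refine measurable_of_Iio fun t => ?_
  have hfr : MeasurableSet (frontier Ω) := isClosed_frontier.measurableSet
  by_cases ht : t ≤ 0
  · convert MeasurableSet.empty
    ext y
    simp only [mem_preimage, mem_Iio, mem_empty_iff_false, iff_false, not_lt]
    exact ht.trans (indicator_nonneg (fun y hy => W.c0 y hy) y)
  · push Not at ht
    have hU : ∀ x : ES N, ∃ U : Set (ES N), IsOpen U ∧ (x ∈ Ω → U ∩ frontier Ω = {y | h y x < t * k y x} ∩ frontier Ω) := by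
      intro x
      by_cases hx : x ∈ Ω
      · have hkx : ContinuousOn (fun z => t * k z x - h z x) (frontier Ω) :=
          (continuousOn_const.mul (W.E.hc.comp (by fun_prop : Continuous fun z : ES N => (z, x)).continuousOn
            fun z hz => ⟨hz, hx⟩)).sub (W.E0.hc.comp
            (by fun_prop : Continuous fun z : ES N => (z, x)).continuousOn fun z hz => ⟨hz, hx⟩)
        obtain ⟨U, hUo, hU⟩ := continuousOn_iff'.1 hkx (Ioi 0) isOpen_Ioi
        refine ⟨U, hUo, fun _ => ?_⟩
        rw [← hU]
        ext y
        simp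
      · exact ⟨∅, isOpen_empty, fun h => absurd h hx⟩
    choose U hUo hU using hU
    have : (frontier Ω).indicator c ⁻¹' Iio t = (frontier Ω)ᶜ ∪ ((⋃ x ∈ Ω, U x) ∩ frontier Ω) := by
      ext y
      by_cases hy : y ∈ frontier Ω
      · simp only [mem_preimage, indicator_of_mem hy, mem_Iio, mem_union, mem_compl_iff, hy,
          not_true_eq_false, mem_inter_iff, and_true, false_or, mem_iUnion, exists_prop]
        constructor
        · intro hct
          obtain ⟨x, hx, hlt⟩ := W.great y hy (t - c y) (by linarith)
          refine ⟨x, hx, ?_⟩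
          have : y ∈ U x ∩ frontier Ω := by
            rw [hU x hx]; exact ⟨by simpa using hlt, hy⟩
          exact this.1
        · rintro ⟨x, hx, hyU⟩
          have : y ∈ U x ∩ frontier Ω := ⟨hyU, hy⟩
          rw [hU x hx] at this
          have h1 : h y x < t * k y x := this.1
          have h2 := W.le y hy x hx
          have h3 := W.E.hk.pos y hy x hx
          exact lt_of_mul_lt_mul_right (h2.trans_lt h1) h3.le
      · simp [hy, ht]
    rw [this]
    refine hfr.compl.union (MeasurableSet.inter ?_ hfr)
    exact (isOpen_biUnion fun x _ => hUo x).measurableSet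

lemma c_int (W : Env2 Ω a V L R e F x₀ k h c) {θ : Measure (ES N)} [IsFiniteMeasure θ] (hθ : θ (frontier Ω)ᶜ = 0) : Integrable c θ := by
  have h1 : Integrable ((frontier Ω).indicator c) θ := by
    refine Integrable.mono' (integrable_const (1:ℝ)) W.c_meas.aestronglyMeasurable (ae_of_all _ fun y => ?_)
    by_cases hy : y ∈ frontier Ω
    · rw [indicator_of_mem hy, Real.norm_eq_abs, abs_of_nonneg (W.c0 y hy)]; exact W.c1 y hy
    · rw [indicator_of_notMem hy]; simp
  refine h1.congr ?_
  filter_upwards [mem_ae_iff.2 hθ] with y hy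
  exact indicator_of_mem hy c

lemma ck_le (W : Env2 Ω a V L R e F x₀ k h c) {θ : Measure (ES N)} [IsFiniteMeasure θ] (hθ : θ (frontier Ω)ᶜ = 0) {x : ES N} (hx : x ∈ Ω) :
    0 ≤ ∫ z, c z * k z x ∂θ ∧ ∫ z, c z * k z x ∂θ ≤ pot k θ x ∧ ∫ z, c z * k z x ∂θ ≤ pot h θ x := by
  have hae : ∀ᵐ z ∂θ, z ∈ frontier Ω := mem_ae_iff.2 hθ
  have hi := W.E.fk_int hθ (W.c_int hθ) hx
  refine ⟨integral_nonneg_of_ae ?_, integral_mono_ae hi (W.E.ki hθ hx) ?_,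
    integral_mono_ae hi (W.E0.ki hθ hx) ?_⟩
  · filter_upwards [hae] with z hz
    exact mul_nonneg (W.c0 z hz) (W.E.kn hz x hx)
  · filter_upwards [hae] with z hz
    exact mul_le_of_le_one_left (W.E.kn hz x hx) (W.c1 z hz)
  · filter_upwards [hae] with z hz
    exact W.le z hz x hx

lemma ck_sol (W : Env2 Ω a V L R e F x₀ k h c) {θ : Measure (ES N)} [IsFiniteMeasure θ] (hθ : θ (frontier Ω)ᶜ = 0) :
    Sol V Ω (fun x => ∫ z, c z * k z x ∂θ) := by
  have hae : ∀ᵐ z ∂θ, 0 ≤ c z := by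
    filter_upwards [mem_ae_iff.2 hθ] with z hz using W.c0 z hz
  have hci := W.c_int hθ
  haveI : IsFiniteMeasure (θ.withDensity fun z => ENNReal.ofReal (c z)) :=
    isFiniteMeasure_withDensity_ofReal hci.2
  have hs : (θ.withDensity fun z => ENNReal.ofReal (c z)) (frontier Ω)ᶜ = 0 :=
    withDensity_absolutelyContinuous _ _ hθ
  exact (pot_sol W.E.hV W.E.hc W.E.hG W.E.hk hs).congr fun x _ => pot_wd hci hae x

lemma qf_nonneg (W : Env2 Ω a V L R e F x₀ k h c) {θ : Measure (ES N)} [IsFiniteMeasure θ] (hθ : θ (frontier Ω)ᶜ = 0) {x : ES N} (hx : x ∈ Ω) :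
    0 ≤ qf k h c θ x := sub_nonneg.2 (W.ck_le hθ hx).2.2

lemma qf_sp (W : Env2 Ω a V L R e F x₀ k h c) {θ : Measure (ES N)} [IsFiniteMeasure θ] (hθ : θ (frontier Ω)ᶜ = 0) : Sp V Ω (qf k h c θ) := by
  have hg := pot_sol W.E0.hV W.E0.hc W.E0.hG W.E0.hk hθ
  refine ((hg.1.change W.E0.hV W.E.hV W.E.hG.opn Subset.rfl (fun x hx => by
      rw [zero_mul]
      exact mul_nonneg (W.E.hV.nn x hx) (pot_nonneg W.E0.hk hθ hx))).add W.E.hV W.E.hG.opn Subset.rfl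
      (W.ck_sol hθ).2).congr fun x _ => ?_
  unfold qf; ring

lemma thmQ (W : Env2 Ω a V L R e F x₀ k h c) (κ l : ℝ) (hκ : 1 ≤ κ) (hl : 0 < l) : ∃ c' : ℝ, 0 < c' ∧ ∀ (θ : Measure (ES N)) [IsFiniteMeasure θ],
    θ (frontier Ω)ᶜ = 0 → ∀ A ⊆ frontier Ω,
    (∀ y ∈ A, ∃ᶠ x in 𝓝[ntRegion Ω y κ] y, l * pot k θ x ≤ qf k h c θ x) →
    ∀ x ∈ Ω, c' * pot k (θ.restrict A) x ≤ qf k h c θ x := by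
  obtain ⟨c1, b, hc1, hb, H⟩ := lemQ W.E.hN W.E.hV W.ha W.E.hG κ l hκ hl
  obtain ⟨c2, hc2, H2⟩ := W.E.lemIII κ b hκ hb
  refine ⟨c2 * c1, by positivity, ?_⟩
  intro θ _ hθ A hA hbad
  refine H2 θ hθ _ (W.qf_sp hθ) (fun x hx => W.qf_nonneg hθ hx) c1 hc1.le A hA ?_
  intro y hy ε hε
  obtain ⟨x, hx, h1, h2, h3⟩ := frq_nt (hbad y hy) ε hε
  refine ⟨x, hx, h1, h2, ?_⟩
  exact H y (hA hy) x hx h2 _ _ (pot_sol W.E0.hV W.E0.hc W.E0.hG W.E0.hk hθ) (W.ck_sol hθ)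
    (fun x hx => (W.ck_le hθ hx).1) (fun x hx => (W.ck_le hθ hx).2.2) _ h3 (W.ck_le hθ hx).2.1

/-- the case of a Dirac mass -/
lemma dirac_case (W : Env2 Ω a V L R e F x₀ k h c) (κ l : ℝ) (hκ : 1 ≤ κ) (hl : 0 < l) {z : ES N} (hz : z ∈ frontier Ω) :
    ∀ᶠ x in 𝓝[ntRegion Ω z κ] z, h z x - c z * k z x < l * k z x := by
  by_contra hcon
  obtain ⟨c', hc', H⟩ := W.thmQ κ l hκ hl
  have hθ : Measure.dirac z (frontier Ω)ᶜ = 0 := by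
    rw [Measure.dirac_apply' _ isClosed_frontier.measurableSet.compl]
    simp [hz]
  have e1 : ∀ x, pot k (Measure.dirac z) x = k z x := fun x => by unfold pot; rw [integral_dirac]
  have e2 : ∀ x, qf k h c (Measure.dirac z) x = h z x - c z * k z x := fun x => by
    unfold qf pot; rw [integral_dirac, integral_dirac]
  have e3 : (Measure.dirac z).restrict {z} = Measure.dirac z := by
    rw [restrict_dirac]; simp
  have h1 := H (Measure.dirac z) hθ {z} (singleton_subset_iff.2 hz) (by
    intro y hy
    rw [mem_singleton_iff] at hy
    subst hy
    simp only [e1, e2]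
    rw [Filter.not_eventually] at hcon
    exact hcon.mono fun x hx => not_lt.1 hx)
  rw [e3] at h1
  obtain ⟨x, hx, hlt⟩ := W.great z hz c' hc'
  have := h1 x hx
  rw [e1, e2] at this
  linarith [add_mul (c z) c' (k z x)]

end Env2

end


section
variable {N : ℕ} {Ω : Set (ES N)} {a : ℝ} {V : ES N → ℝ} {L R : ℝ} {e : ES N → ES N}
  {F : ES N → ES N → ℝ} {x₀ : ES N} {k h : ES N → ES N → ℝ} {c : ES N → ℝ}

namespace Env

lemma cork_nt (E : Env Ω a V L R e F x₀ k) {t0 : ℝ} (ht0 : 0 < t0) (h768 : 768 * L ^ 2 * t0 ≤ R) {y : ES N} (hy : y ∈ frontier Ω) (n : ℕ) :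
    y + (t0 / 8 ^ n) • e y ∈ Ω ∧ dist (y + (t0 / 8 ^ n) • e y) y = t0 / 8 ^ n ∧
    dist (y + (t0 / 8 ^ n) • e y) y ≤ L * dista Ω (y + (t0 / 8 ^ n) • e y) := by
  have ht : 0 < t0 / 8 ^ n := by positivity
  have hlen : t0 / 8 ^ n ≤ t0 := div_le_self ht0.le (one_le_pow₀ (by norm_num))
  have hL0 := E.L0
  have hr : 96 * L ^ 2 * (t0 / 8 ^ n) ≤ R := by
    have : L ^ 2 * (t0 / 8 ^ n) ≤ L ^ 2 * t0 := by gcongr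
    nlinarith [show 0 < L ^ 2 * t0 by positivity]
  have hA := E.hG.A_dist hy ht
  refine ⟨E.A_mem hy ht hr, hA, ?_⟩
  rw [hA]
  have := E.A_dista hy ht hr
  rw [div_le_iff₀ hL0] at this; linarith

lemma cork_tendsto (E : Env Ω a V L R e F x₀ k) {t0 : ℝ} (ht0 : 0 < t0) (h768 : 768 * L ^ 2 * t0 ≤ R) {y : ES N} (hy : y ∈ frontier Ω) :
    Tendsto (fun n : ℕ => y + (t0 / 8 ^ n) • e y) atTop (𝓝[ntRegion Ω y L] y) := by
  refine tendsto_nhdsWithin_iff.2 ⟨?_, Eventually.of_forall fun n =>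
    ⟨(E.cork_nt ht0 h768 hy n).1, (E.cork_nt ht0 h768 hy n).2.2⟩⟩
  have h1 : Tendsto (fun n : ℕ => t0 / 8 ^ n) atTop (𝓝 0) := by
    have := (tendsto_pow_atTop_nhds_zero_of_lt_one (r := (1/8:ℝ)) (by norm_num) (by norm_num)).const_mul t0
    simpa [div_eq_mul_inv] using this
  have h2 := (h1.smul_const (e y)).const_add y
  simpa using h2

/-- density points of a set -/
lemma density (E : Env Ω a V L R e F x₀ k) (κ : ℝ) (hκ : 1 ≤ κ) (θ : Measure (ES N)) [IsFiniteMeasure θ] (hθ : θ (frontier Ω)ᶜ = 0)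
    (S : Set (ES N)) (hS : MeasurableSet S) :
    ∀ᵐ y ∂θ, Tendsto (fun x => pot k (θ.restrict S) x / pot k θ x) (𝓝[ntRegion Ω y κ] y)
      (𝓝 (S.indicator (fun _ => (1:ℝ)) y)) := by
  have hs : (θ.restrict S) (frontier Ω)ᶜ = 0 := Measure.absolutelyContinuous_of_le Measure.restrict_le_self hθ
  filter_upwards [E.thmA κ hκ hs hθ, Measure.rnDeriv_restrict_self θ hS] with y h1 h2
  rw [h2] at h1
  convert h1 using 2
  by_cases hy : y ∈ S
  · simp [hy]
  · simp [hy]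

end Env

namespace Env2

/-- uniformity sets -/
lemma unif (W : Env2 Ω a V L R e F x₀ k h c) (κ ε : ℝ) (hκ : 1 ≤ κ) (hε : 0 < ε) : ∃ S : ℕ → Set (ES N), (∀ m, MeasurableSet (S m)) ∧
    (∀ z ∈ frontier Ω, ∃ m, z ∈ S m) ∧ ∀ m, ∀ z ∈ S m, z ∈ frontier Ω → ∀ x ∈ Ω, dist x z < κ * dista Ω x →
      dist x z < 1 / ((m:ℝ) + 1) → h z x - c z * k z x ≤ ε * k z x := by
  set T : ℕ → ES N → ES N → Set (ES N) := fun m x x' =>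
    {z | κ * dista Ω x ≤ dist x z} ∪ {z | 1 / ((m:ℝ) + 1) ≤ dist x z} ∪
      (frontier Ω ∩ (fun z => h z x' * k z x - (h z x - ε * k z x) * k z x') ⁻¹' Ici 0) with hT
  refine ⟨fun m => ⋂ x ∈ Ω, ⋂ x' ∈ Ω, T m x x', ?_, ?_, ?_⟩
  · intro m
    refine IsClosed.measurableSet ?_
    refine isClosed_biInter fun x hx => isClosed_biInter fun x' hx' => ?_
    refine IsClosed.union (IsClosed.union ?_ ?_) ?_
    · exact isClosed_le continuous_const (by fun_prop)
    · exact isClosed_le continuous_const (by fun_prop)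
    · refine ContinuousOn.preimage_isClosed_of_isClosed ?_ isClosed_frontier isClosed_Ici
      have ck : ∀ x ∈ Ω, ContinuousOn (fun z => k z x) (frontier Ω) := fun x hx =>
        W.E.hc.comp (by fun_prop : Continuous fun z : ES N => (z, x)).continuousOn fun z hz => ⟨hz, hx⟩
      have ch : ∀ x ∈ Ω, ContinuousOn (fun z => h z x) (frontier Ω) := fun x hx =>
        W.E0.hc.comp (by fun_prop : Continuous fun z : ES N => (z, x)).continuousOn fun z hz => ⟨hz, hx⟩
      exact ((ch x' hx').mul (ck x hx)).sub (((ch x hx).sub (continuousOn_const.mul (ck x hx))).mul (ck x' hx'))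
  · intro z hz
    have h1 := W.dirac_case κ ε hκ hε hz
    rw [eventually_nhdsWithin_iff, Metric.eventually_nhds_iff] at h1
    obtain ⟨r, hr, h1⟩ := h1
    obtain ⟨m, hm⟩ := exists_nat_one_div_lt hr
    refine ⟨m, ?_⟩
    simp only [mem_iInter]
    intro x hx x' hx'
    by_cases g1 : κ * dista Ω x ≤ dist x z
    · exact Or.inl (Or.inl g1)
    by_cases g2 : 1 / ((m:ℝ) + 1) ≤ dist x z
    · exact Or.inl (Or.inr g2)
    push Not at g1 g2
    refine Or.inr ⟨hz, ?_⟩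
    have h2 := h1 (g2.trans hm) ⟨hx, g1.le⟩
    have h3 := W.le z hz x' hx'
    have h4 := W.E.kn hz x hx
    have h5 := W.E.kn hz x' hx'
    rw [mem_preimage, mem_Ici]
    have h6 : (h z x - ε * k z x) * k z x' ≤ (c z * k z x) * k z x' := by gcongr; linarith
    have h7 : (c z * k z x') * k z x ≤ h z x' * k z x := by gcongr
    linarith [show (c z * k z x) * k z x' = (c z * k z x') * k z x by ring]
  · intro m z hzm hz x hx hd1 hd2
    simp only [mem_iInter] at hzm
    by_contra hcon
    push Not at hcon
    have hkx := W.E.hk.pos z hz x hx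
    have ht : 0 < h z x / k z x - ε - c z := by
      have : (ε + c z) < h z x / k z x := by rw [lt_div_iff₀ hkx]; linarith [add_mul ε (c z) (k z x)]
      linarith
    obtain ⟨x', hx', hlt⟩ := W.great z hz _ ht
    have h8 : (c z + (h z x / k z x - ε - c z)) * k z x' * k z x = (h z x - ε * k z x) * k z x' := by
      field_simp; ring
    have h9 := mul_lt_mul_of_pos_right hlt hkx
    rw [h8] at h9
    rcases hzm x hx x' hx' with (g | g) | ⟨_, g⟩
    · exact absurd g (not_le.2 hd1)
    · exact absurd g (not_le.2 hd2)
    · rw [mem_preimage, mem_Ici] at g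
      linarith

end Env2

end


section
variable {N : ℕ} {Ω : Set (ES N)} {a : ℝ} {V : ES N → ℝ} {L R : ℝ} {e : ES N → ES N}
  {F : ES N → ES N → ℝ} {x₀ : ES N} {k h : ES N → ES N → ℝ} {c : ES N → ℝ}

namespace Env2

/-- The potential part is negligible at almost every boundary point. -/
lemma mainQ (W : Env2 Ω a V L R e F x₀ k h c) (κ l : ℝ) (hκ : 1 ≤ κ) (hl : 0 < l) {θ : Measure (ES N)} [IsFiniteMeasure θ]
    (hθ : θ (frontier Ω)ᶜ = 0) :
    ∀ᵐ y ∂θ, ∀ᶠ x in 𝓝[ntRegion Ω y κ] y, qf k h c θ x < l * pot k θ x := by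
  have hL0 := W.E.L0
  have hL1 := W.E.hG.L1
  have hfr : ∀ᵐ z ∂θ, z ∈ frontier Ω := mem_ae_iff.2 hθ
  obtain ⟨c', hc', HQ⟩ := W.thmQ κ l hκ hl
  set A : Set (ES N) := {y | y ∈ frontier Ω ∧ ∃ᶠ x in 𝓝[ntRegion Ω y κ] y, l * pot k θ x ≤ qf k h c θ x}
    with hA
  have hQ := HQ θ hθ A (fun y hy => hy.1) (fun y hy => hy.2)
  obtain ⟨q, t1, hq0, hq1, ht1, H0⟩ := W.E0.tail
  obtain ⟨q', t1', _, _, ht1', H1⟩ := W.E.tail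
  have hdx := dista_pos W.E.hN W.E.hG W.E.hx₀
  set t0 := min (min t1 t1') (dista Ω x₀) with ht0d
  have ht0 : 0 < t0 := by positivity
  obtain ⟨C0, hC0, h768, H0⟩ := H0 t0 ht0 ((min_le_left _ _).trans (min_le_left _ _))
  obtain ⟨C1, hC1, _, H1⟩ := H1 t0 ht0 ((min_le_left _ _).trans (min_le_right _ _))
  obtain ⟨C2, hC2, H2⟩ := k_cmp0 W.E.hN W.E.hV W.E.hG W.E.hx₀ W.ha W.E.hk W.E0.hk
  obtain ⟨Cq, hCq, Hs⟩ := seqGood q hq0 hq1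
  set Kc : ℝ := 1 + (C0 + C0 * Cq) * (C2 * C1) with hKc
  have hKc0 : 0 < Kc := by positivity
  set ε : ℝ := c' / (4 * Kc) with hεd
  have hε : 0 < ε := by positivity
  obtain ⟨J, HJ⟩ := Hs ε hε
  set B : ℝ := 1 + 48 * L * 8 ^ J with hB
  have hB1 : 1 ≤ B := by rw [hB]; linarith [show 0 < 48 * L * 8 ^ J by positivity]
  obtain ⟨S, hSm, hSc, hSp⟩ := W.unif (L * B) ε (by nlinarith) hε
  have hden1 := W.E.density L hL1 θ hθ (toMeasurable θ A) (measurableSet_toMeasurable _ _)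
  rw [Measure.restrict_toMeasurable (measure_ne_top θ A)] at hden1
  have hden2 : ∀ᵐ y ∂θ, ∀ m, Tendsto (fun x => pot h (θ.restrict (S m)ᶜ) x / pot h θ x)
      (𝓝[ntRegion Ω y L] y) (𝓝 ((S m)ᶜ.indicator (fun _ => (1:ℝ)) y)) :=
    ae_all_iff.2 fun m => W.E0.density L hL1 θ hθ _ (hSm m).compl
  have hlow0 := W.E0.lemA0 L hL1 θ hθ
  have hlow1 := W.E.lemA0 L hL1 θ hθ
  have key : ∀ᵐ y ∂θ, y ∉ A := by
    filter_upwards [hfr, hden1, hden2, hlow0, hlow1] with y hy d1 d2 ⟨m0, hm0, l0⟩ ⟨m1, hm1, l1⟩ hyA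
    obtain ⟨m, hm⟩ := hSc y hy
    have tnd := W.E.cork_tendsto ht0 h768 hy
    rw [indicator_of_mem (subset_toMeasurable θ A hyA)] at d1
    have d2 := d2 m
    rw [indicator_of_notMem (by simpa using hm)] at d2
    have ev1 := (d1.comp tnd).eventually_const_lt (show (1/2:ℝ) < 1 by norm_num)
    have ev2 := (d2.comp tnd).eventually_lt_const hε
    have ev3 := tnd.eventually l0
    have ev4 := tnd.eventually l1
    have tt : Tendsto (fun n : ℕ => B * (t0 / 8 ^ n)) atTop (𝓝 0) := by
      have := (tendsto_pow_atTop_nhds_zero_of_lt_one (r := (1/8:ℝ)) (by norm_num) (by norm_num)).const_mul (B * t0)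
      simpa [div_eq_mul_inv, mul_assoc] using this
    have ev5 := tt.eventually_lt_const (show (0:ℝ) < 1 / ((m:ℝ) + 1) by positivity)
    have fr := HJ (phi L e h θ t0 y) (θ.real univ) (m0 / C0) (fun n => W.E0.phi_nonneg ht0 h768 hy n)
      measureReal_nonneg (by positivity) (by
        filter_upwards [ev3] with n hn
        rw [div_le_iff₀ (by positivity)]
        linarith [(H0 θ hθ y hy n).2.1])
    obtain ⟨n, ⟨g1, g2⟩, e1, e2, e3, e4, e5⟩ :=
      (fr.and_eventually (ev1.and (ev2.and (ev3.and (ev4.and ev5))))).exists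
    simp only [Function.comp_apply] at e1 e2
    obtain ⟨hx, hxd, hxn⟩ := W.E.cork_nt ht0 h768 hy n
    obtain ⟨-, T1, T2⟩ := H0 θ hθ y hy n
    have T3 := T2 J
    obtain ⟨T4, -, -⟩ := H1 θ hθ y hy n
    have ht : 0 < t0 / 8 ^ n := by positivity
    have hlen : t0 / 8 ^ n ≤ t0 := div_le_self ht0.le (one_le_pow₀ (by norm_num))
    have T5 : phi L e h θ t0 y n ≤ C2 * phi L e k θ t0 y n := by
      have h1 := H2 y hy (t0 / 8 ^ n) ht (by
        have : L ^ 2 * (t0 / 8 ^ n) ≤ L ^ 2 * t0 := by gcongr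
        nlinarith [show 0 < L ^ 2 * t0 by positivity]) (hlen.trans (min_le_right _ _))
      have h2 := mul_le_mul_of_nonneg_left h1
        (measureReal_nonneg (μ := θ) (s := ball y (48 * L * (t0 / 8 ^ n))))
      unfold phi
      linarith [mul_left_comm (θ.real (ball y (48 * L * (t0 / 8 ^ n)))) C2 (k y (y + (t0 / 8 ^ n) • e y))]
    have hQx := hQ _ hx
    set x := y + (t0 / 8 ^ n) • e y with hxdef
    have hk0 : 0 < pot k θ x := hm1.trans_le e4
    have hh0 : 0 < pot h θ x := hm0.trans_le e3
    rw [lt_div_iff₀ hk0] at e1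
    rw [div_lt_iff₀ hh0] at e2
    -- pointwise bound
    set SJ : Set (ES N) := {z | 48 * L * (8 ^ J * (t0 / 8 ^ n)) ≤ dist z y} with hSJ
    have hSJm : MeasurableSet SJ := measurableSet_le measurable_const (measurable_id.dist measurable_const)
    have ih := W.E0.ki hθ hx
    have ik := W.E.ki hθ hx
    have ick := W.E.fk_int hθ (W.c_int hθ) hx
    have i1 := ih.indicator hSJm
    have i2 := ih.indicator (hSm m).compl
    have hq : qf k h c θ x ≤ (∫ z in SJ, h z x ∂θ) + ε * pot k θ x + pot h (θ.restrict (S m)ᶜ) x := by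
      have e6 : (∫ z in SJ, h z x ∂θ) + ε * pot k θ x + pot h (θ.restrict (S m)ᶜ) x =
          ∫ z, SJ.indicator (fun z => h z x) z + ε * k z x + (S m)ᶜ.indicator (fun z => h z x) z ∂θ := by
        have i12 : Integrable (fun z => SJ.indicator (fun z => h z x) z + ε * k z x) θ := i1.add (ik.const_mul ε)
        rw [integral_add i12 i2, integral_add i1 (ik.const_mul ε),
          integral_indicator hSJm, integral_indicator (hSm m).compl, integral_const_mul]
        rfl
      have e7 : qf k h c θ x = ∫ z, h z x - c z * k z x ∂θ := by
        rw [integral_sub ih ick]; rfl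
      rw [e6, e7]
      refine integral_mono_ae (ih.sub ick) ((i1.add (ik.const_mul ε)).add i2) ?_
      filter_upwards [hfr] with z hz
      have hhz := W.E0.kn hz x hx
      have hkz := W.E.kn hz x hx
      have hcz := mul_nonneg (W.c0 z hz) hkz
      have hεk : 0 ≤ ε * k z x := by positivity
      have n1 : 0 ≤ SJ.indicator (fun z => h z x) z := indicator_apply_nonneg fun _ => hhz
      have n2 : 0 ≤ (S m)ᶜ.indicator (fun z => h z x) z := indicator_apply_nonneg fun _ => hhz
      by_cases b1 : z ∈ SJ
      · rw [indicator_of_mem b1]; linarith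
      by_cases b2 : z ∈ (S m)ᶜ
      · rw [indicator_of_mem b2]; linarith
      have b1' : dist z y < 48 * L * (8 ^ J * (t0 / 8 ^ n)) := not_le.1 b1
      have b3 : dist x z < B * (t0 / 8 ^ n) := by
        have := dist_triangle_right x z y
        rw [hB]
        linarith [show (1 + 48 * L * 8 ^ J) * (t0 / 8 ^ n) = t0 / 8 ^ n + 48 * L * (8 ^ J * (t0 / 8 ^ n)) by ring]
      have b4 : B * (t0 / 8 ^ n) ≤ L * B * dista Ω x := by
        rw [hxd] at hxn
        have : B * (t0 / 8 ^ n) ≤ B * (L * dista Ω x) := by gcongr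
        linarith [show B * (L * dista Ω x) = L * B * dista Ω x by ring]
      have := hSp m z (not_not.1 b2) hz x hx (b3.trans_le b4) (b3.trans e5)
      linarith
    have hphi := W.E0.phi_nonneg (θ := θ) ht0 h768 hy n
    have f1 : (∫ z in SJ, h z x ∂θ) ≤ C0 * (ε * phi L e h θ t0 y n) := T3.trans (by gcongr)
    have f2 : pot h θ x ≤ C0 * (Cq * phi L e h θ t0 y n) := T1.trans (by gcongr)
    have f3 : phi L e h θ t0 y n ≤ C2 * (C1 * pot k θ x) := T5.trans (by gcongr)
    have f4 : ε * pot h θ x ≤ ε * (C0 * (Cq * phi L e h θ t0 y n)) := by gcongr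
    have f5 : (ε * (C0 + C0 * Cq)) * phi L e h θ t0 y n ≤ (ε * (C0 + C0 * Cq)) * (C2 * (C1 * pot k θ x)) := by
      gcongr
    have f6 : qf k h c θ x ≤ ε * Kc * pot k θ x := by
      have e8 : ε * Kc * pot k θ x = ε * pot k θ x + (ε * (C0 + C0 * Cq)) * (C2 * (C1 * pot k θ x)) := by
        rw [hKc]; ring
      rw [e8]
      linarith [show (ε * (C0 + C0 * Cq)) * phi L e h θ t0 y n =
        C0 * (ε * phi L e h θ t0 y n) + ε * (C0 * (Cq * phi L e h θ t0 y n)) by ring]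
    have f7 : ε * Kc = c' / 4 := by rw [hεd]; field_simp
    rw [f7] at f6
    have f8 : c' * (1 / 2 * pot k θ x) < c' * pot k (θ.restrict A) x := by gcongr
    have f9 : 0 < c' * pot k θ x := by positivity
    linarith [show c' * (1 / 2 * pot k θ x) = c' * pot k θ x / 2 by ring,
      show c' / 4 * pot k θ x = c' * pot k θ x / 4 by ring]
  filter_upwards [hfr, key] with y hy hyA
  by_contra hcon
  rw [Filter.not_eventually] at hcon
  exact hyA ⟨hy, hcon.mono fun x hx => not_lt.1 hx⟩

/-- Ratio limit `K_θ / K_θ^V → c`. -/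
lemma ratio (W : Env2 Ω a V L R e F x₀ k h c) (κ : ℝ) (hκ : 1 ≤ κ) {θ : Measure (ES N)} [IsFiniteMeasure θ]
    (hθ : θ (frontier Ω)ᶜ = 0) :
    ∀ᵐ y ∂θ, Tendsto (fun x => pot h θ x / pot k θ x) (𝓝[ntRegion Ω y κ] y) (𝓝 (c y)) := by
  have h1 : ∀ᵐ y ∂θ, ∀ n : ℕ, ∀ᶠ x in 𝓝[ntRegion Ω y κ] y, qf k h c θ x < 1 / ((n:ℝ) + 1) * pot k θ x :=
    ae_all_iff.2 fun n => W.mainQ κ _ hκ (by positivity) hθ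
  filter_upwards [h1, W.E.thmA1 κ hκ hθ (W.c_int hθ), W.E.lemA0 κ hκ θ hθ] with y g1 g2 ⟨m, hm, g3⟩
  have g4 : Tendsto (fun x => qf k h c θ x / pot k θ x) (𝓝[ntRegion Ω y κ] y) (𝓝 0) := by
    rw [Metric.tendsto_nhds]
    intro ε hε
    obtain ⟨n, hn⟩ := exists_nat_one_div_lt hε
    filter_upwards [g1 n, g3, self_mem_nhdsWithin] with x i1 i2 i3
    have hp : 0 < pot k θ x := hm.trans_le i2
    rw [Real.dist_eq, sub_zero, abs_of_nonneg (div_nonneg (W.qf_nonneg hθ i3.1) hp.le)]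
    exact ((div_lt_iff₀ hp).2 i1).trans hn
  have g5 := g4.add g2
  rw [zero_add] at g5
  refine g5.congr fun x => ?_
  rw [← add_div]
  congr 1
  unfold qf; ring

end Env2

end


section
variable {N : ℕ} {Ω : Set (ES N)} {a : ℝ} {V : ES N → ℝ} {L R : ℝ} {e : ES N → ES N}
  {F : ES N → ES N → ℝ} {x₀ : ES N} {k h : ES N → ES N → ℝ} {c : ES N → ℝ}

lemma LVHarmonic.const_mul' {u : ES N → ℝ} (hu : LVHarmonic Ω V u) (r : ℝ) :
    LVHarmonic Ω V (fun x => r * u x) := by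
  obtain ⟨h1, h2, h3, h4⟩ := hu
  refine ⟨continuousOn_const.mul h1, ?_, ?_, ?_⟩
  · intro x hx
    obtain ⟨s, hs, hi⟩ := h2 x hx
    exact ⟨s, hs, Integrable.const_mul hi r⟩
  · intro x hx
    obtain ⟨s, hs, hi⟩ := h3 x hx
    refine ⟨s, hs, ?_⟩
    have := Integrable.const_mul hi r
    refine this.congr (ae_of_all _ fun z => ?_)
    simp only; ring
  · intro φ hφ
    have e1 : (fun x => r * u x * lap φ x) = fun x => r * (u x * lap φ x) := by funext x; ring
    have e2 : (fun x => V x * (r * u x) * φ x) = fun x => r * (V x * u x * φ x) := by funext x; ring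
    rw [e1, e2, integral_const_mul, integral_const_mul, h4 φ hφ]

lemma tendstoNT_of_nat {g : ES N → ℝ} {y : ES N} {l : Filter ℝ}
    (H : ∀ n : ℕ, Tendsto g (𝓝[ntRegion Ω y ((n:ℝ) + 1)] y) l) : TendstoNT Ω g y l := by
  intro κ _
  obtain ⟨n, hn⟩ := exists_nat_ge κ
  refine (H n).mono_left (nhdsWithin_mono _ fun x hx => ⟨hx.1, hx.2.trans ?_⟩)
  have : 0 ≤ dista Ω x := infDist_nonneg
  gcongr
  linarith

lemma env2_great (hx₀ : x₀ ∈ Ω)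
    (hKV : ∀ y ∈ frontier Ω, IsMartinKernel Ω V x₀ y (k y))
    (hc : ∀ y ∈ frontier Ω, 0 ≤ c y ∧ c y ≤ 1 ∧
      IsGreatestLVHarmMinorant Ω V (h y) (fun x => c y * k y x)) :
    ∀ y ∈ frontier Ω, ∀ ε > 0, ∃ x ∈ Ω, h y x < (c y + ε) * k y x := by
  intro y hy ε hε
  by_contra hcon
  push Not at hcon
  have h1 := (hc y hy).2.2.2.2 (fun x => (c y + ε) * k y x) ((hKV y hy).1.const_mul' _)
    (fun x hx => ⟨mul_nonneg (add_nonneg (hc y hy).1 hε.le) ((hKV y hy).2.1 x hx).le, hcon x hx⟩) x₀ hx₀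
  simp only [(hKV y hy).2.2.1, mul_one] at h1
  linarith

namespace Env2

lemma fin1 (W : Env2 Ω a V L R e F x₀ k h c) {μ : Measure (ES N)} [IsFiniteMeasure μ] (hμ : μ (frontier Ω)ᶜ = 0) :
    ∀ᵐ y ∂μ, (0 < c y → TendstoNT Ω (fun x => pot k μ x / pot h μ x) y (𝓝 (1 / c y))) ∧
      (c y = 0 → TendstoNT Ω (fun x => pot k μ x / pot h μ x) y atTop) := by
  have hn : ∀ n : ℕ, (1:ℝ) ≤ (n:ℝ) + 1 := fun n => by linarith [n.cast_nonneg (α := ℝ)]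
  have h1 := ae_all_iff.2 fun n : ℕ => W.ratio ((n:ℝ) + 1) (hn n) hμ
  have h2 := ae_all_iff.2 fun n : ℕ => W.E.lemA0 ((n:ℝ) + 1) (hn n) μ hμ
  have h3 := ae_all_iff.2 fun n : ℕ => W.E0.lemA0 ((n:ℝ) + 1) (hn n) μ hμ
  filter_upwards [h1, h2, h3] with y g1 g2 g3
  have ee : (fun x => pot k μ x / pot h μ x) = (fun x => pot h μ x / pot k μ x)⁻¹ := by
    funext x; simp
  rw [ee]
  refine ⟨fun hc => tendstoNT_of_nat fun n => ?_, fun hc => tendstoNT_of_nat fun n => ?_⟩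
  · rw [one_div]; exact (g1 n).inv₀ hc.ne'
  · obtain ⟨m, hm, i2⟩ := g2 n
    obtain ⟨m', hm', i3⟩ := g3 n
    have := g1 n
    rw [hc] at this
    refine Filter.Tendsto.inv_tendsto_nhdsGT_zero (tendsto_nhdsWithin_iff.2 ⟨this, ?_⟩)
    filter_upwards [i2, i3] with x j2 j3
    exact div_pos (hm'.trans_le j3) (hm.trans_le j2)

lemma fin2 (W : Env2 Ω a V L R e F x₀ k h c) {μ θ : Measure (ES N)} [IsFiniteMeasure μ] [IsFiniteMeasure θ] (hμ : μ (frontier Ω)ᶜ = 0)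
    (hθ : θ (frontier Ω)ᶜ = 0) :
    ∀ᵐ y ∂θ, 0 < c y → TendstoNT Ω (fun x => pot k μ x / pot h θ x) y
      (𝓝 (1 / c y * (μ.rnDeriv θ y).toReal)) := by
  have hn : ∀ n : ℕ, (1:ℝ) ≤ (n:ℝ) + 1 := fun n => by linarith [n.cast_nonneg (α := ℝ)]
  have h1 := ae_all_iff.2 fun n : ℕ => W.ratio ((n:ℝ) + 1) (hn n) hθ
  have h2 := ae_all_iff.2 fun n : ℕ => W.E.lemA0 ((n:ℝ) + 1) (hn n) θ hθ
  have h3 := ae_all_iff.2 fun n : ℕ => W.E.thmA ((n:ℝ) + 1) (hn n) hμ hθ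
  filter_upwards [h1, h2, h3] with y g1 g2 g3 hc
  refine tendstoNT_of_nat fun n => ?_
  obtain ⟨m, hm, i2⟩ := g2 n
  have := (g3 n).div (g1 n) hc.ne'
  rw [show 1 / c y * (μ.rnDeriv θ y).toReal = (μ.rnDeriv θ y).toReal / c y by ring]
  refine this.congr' ?_
  filter_upwards [i2] with x j2
  exact div_div_div_cancel_right₀ (hm.trans_le j2).ne' _ _

end Env2

end


/-- Corollary `coro33`. Let `u = K_μ^V`. (1) For `μ`-a.e.
`y ∈ ∂Ω`, `u/K_μ → 1/c(y)` nontangentially at `y` (`→ +∞` when `c(y) = 0`);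
(2) for every positive finite measure `θ` on `∂Ω`, `u/K_θ → (1/c(y))·(dμ/dθ)(y)`
nontangentially at `θ`-a.e. `y ∈ Reg_V(Ω)`. -/
theorem statement10 {N : ℕ} (hN : 2 ≤ N) (Ω : Set (ES N))
    (hΩ : IsLipschitzDomain Ω) (hbd : Bornology.IsBounded Ω)
    (x₀ : ES N) (hx₀ : x₀ ∈ Ω) (a : ℝ) (ha : 0 < a)
    (V : ES N → ℝ) (hV : VClass Ω a V)
    (K KV : ES N → ES N → ℝ) (c : ES N → ℝ)
    (hK : ∀ y ∈ frontier Ω, IsMartinKernel Ω (fun _ => 0) x₀ y (K y))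
    (hKV : ∀ y ∈ frontier Ω, IsMartinKernel Ω V x₀ y (KV y))
    (hc : ∀ y ∈ frontier Ω, 0 ≤ c y ∧ c y ≤ 1 ∧
      IsGreatestLVHarmMinorant Ω V (K y) (fun x => c y * KV y x))
    (μ : Measure (ES N)) [IsFiniteMeasure μ] (hμs : μ (frontier Ω)ᶜ = 0) :
    (∀ᵐ y ∂μ,
      (0 < c y →
        TendstoNT Ω (fun x => (∫ z, KV z x ∂μ) / ∫ z, K z x ∂μ) y (𝓝 (1 / c y))) ∧
      (c y = 0 →
        TendstoNT Ω (fun x => (∫ z, KV z x ∂μ) / ∫ z, K z x ∂μ) y atTop)) ∧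
    ∀ θ : Measure (ES N), IsFiniteMeasure θ → θ (frontier Ω)ᶜ = 0 →
      ∀ᵐ y ∂θ, 0 < c y →
        TendstoNT Ω (fun x => (∫ z, KV z x ∂μ) / ∫ z, K z x ∂θ) y
          (𝓝 (1 / c y * (μ.rnDeriv θ y).toReal)) := by
  obtain ⟨L, R, e, F, hG⟩ := exists_geo hΩ hbd
  have hN0 : 0 < N := by omega
  have W : Env2 Ω a V L R e F x₀ KV K c :=
    { ha := ha.le
      E := ⟨hN0, pot_of_VClass hN0 hG.opn hbd hV, hG, hx₀, Ker.of hKV⟩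
      E0 := ⟨hN0, pot_zero hG.opn ha.le, hG, hx₀, Ker.of hK⟩
      c0 := fun y hy => (hc y hy).1
      c1 := fun y hy => (hc y hy).2.1
      le := fun y hy x hx => ((hc y hy).2.2.2.1 x hx).2
      great := env2_great hx₀ hKV hc }
  refine ⟨W.fin1 hμs, fun θ hθf hθ => ?_⟩
  haveI := hθf
  exact W.fin2 hμs hθ
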